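/- Let S = {g_1, ..., g_s} be irreducible polynomials in ℝ[x,y]. Suppose that K = K_S ⊆ ℝ² is compact and that for each boundary point p of K one of the following holds: (1) there is an i such that p is a non-singular zero of g_i (the gradient of g_i at p is nonzero) and K coincides, in some neighbourhood of p, with the set {g_i ≥ 0}; or (2) there are i, j such that p is a non-singular zero of both g_i and g_j, the gradients of g_i and g_j at p are linearly independent, and K coincides near p with {g_i ≥ 0, g_j ≥ 0}; or (3) there are i, j such that p is a non-singular zero of both g_i and g_j, the curves g_i = 0 and g_j = 0 have the same tangent line at p but do not cross each other at p, and near p the set K is the region between the curves g_i = 0 and g_j = 0; or (4) there are i, j, k such that p is a non-singular zero of g_i, g_j and g_k, the curves g_i = 0 and g_j = 0 share a common tangent at p, the curves g_i = 0 and g_k = 0 meet transversally at p, and near p the set K is the part of the region between g_i = 0 and g_j = 0 on which g_k ≥ 0. Then the preordering of ℝ[x,y] generated by g_1, ..., g_s is saturated, i.e., it equals the set of all polynomials nonnegative on K. -/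

import Mathlib

noncomputable section

open MvPolynomial

/-- The preordering of a commutative ring `A` generated by a subset `S`:
the smallest subsemiring of `A` containing `S` together with all squares. -/
def preorderingGen {A : Type*} [CommRing A] (S : Set A) : Set A :=
  (Subsemiring.closure (S ∪ {a | ∃ b, a = b ^ 2}) : Set A)

end

section
set_option linter.all false

universe u

namespace PS

/-- `T` is a preordering (contains all squares). -/
def IsPre {A : Type*} [CommRing A] (T : Subsemiring A) : Prop := ∀ a : A, a ^ 2 ∈ T

/-- adjoining one element to a preordering -/
def adj {A : Type*} [CommRing A] (T : Subsemiring A) (hT : IsPre T) (a : A) : Subsemiring A where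
  carrier := {x | ∃ s ∈ T, ∃ t ∈ T, x = s + a * t}
  mul_mem' := by
    rintro x y ⟨s, hs, t, ht, rfl⟩ ⟨s', hs', t', ht', rfl⟩
    exact ⟨s * s' + a ^ 2 * (t * t'), add_mem (mul_mem hs hs') (mul_mem (hT a) (mul_mem ht ht')),
      s * t' + s' * t, add_mem (mul_mem hs ht') (mul_mem hs' ht), by ring⟩
  one_mem' := ⟨1, one_mem _, 0, zero_mem _, by ring⟩
  add_mem' := by
    rintro x y ⟨s, hs, t, ht, rfl⟩ ⟨s', hs', t', ht', rfl⟩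
    exact ⟨s + s', add_mem hs hs', t + t', add_mem ht ht', by ring⟩
  zero_mem' := ⟨0, zero_mem _, 0, zero_mem _, by ring⟩

section
variable {A : Type*} [CommRing A] {T : Subsemiring A} (hT : IsPre T) (a : A)

theorem mem_adj {x : A} : x ∈ adj T hT a ↔ ∃ s ∈ T, ∃ t ∈ T, x = s + a * t := Iff.rfl

theorem le_adj : T ≤ adj T hT a := fun x hx => ⟨x, hx, 0, zero_mem _, by ring⟩

theorem self_mem_adj : a ∈ adj T hT a := ⟨0, zero_mem _, 1, one_mem _, by ring⟩

theorem isPre_adj : IsPre (adj T hT a) := fun b => le_adj hT a (hT b)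

end

theorem exists_maximal {A : Type*} [CommRing A] (T : Subsemiring A) (hT : IsPre T)
    (h : (-1 : A) ∉ T) : ∃ P : Subsemiring A, T ≤ P ∧ IsPre P ∧ (-1 : A) ∉ P ∧
      ∀ a : A, a ∉ P → ∃ s ∈ P, ∃ t ∈ P, -1 = s + a * t := by
  obtain ⟨P, hTP, hP⟩ := zorn_le_nonempty₀ {P : Subsemiring A | IsPre P ∧ (-1 : A) ∉ P}
    (fun c hc hchain y hy => by
      have hdir : DirectedOn (· ≤ ·) c := hchain.directedOn
      refine ⟨sSup c, ⟨fun a => ?_, fun hm => ?_⟩, fun z hz => le_sSup hz⟩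
      · exact (le_sSup hy : y ≤ sSup c) ((hc hy).1 a)
      · obtain ⟨s, hs, hm⟩ := (Subsemiring.mem_sSup_of_directedOn ⟨y, hy⟩ hdir).1 hm
        exact (hc hs).2 hm) T ⟨hT, h⟩
  refine ⟨P, hTP, hP.prop.1, hP.prop.2, fun a ha => ?_⟩
  by_contra hcon
  apply ha
  refine hP.le_of_ge (y := adj P hP.prop.1 a) ⟨isPre_adj _ _, hcon⟩ (le_adj _ _) (self_mem_adj _ _)

/-- Field with a total cone. -/
theorem exists_order_of_cone {K : Type*} [Field K] (P : Subsemiring K)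
    (htot : ∀ x, x ∈ P ∨ -x ∈ P) (hz : ∀ x, x ∈ P → -x ∈ P → x = 0) :
    ∃ (_ : LinearOrder K) (_ : IsStrictOrderedRing K), ∀ x ∈ P, (0 : K) ≤ x := by
  classical
  let C : RingCone K := { P with eq_zero_of_mem_of_neg_mem' := fun {a} h1 h2 => hz a h1 h2 }
  haveI : HasMemOrNegMem C := ⟨htot⟩
  letI : LinearOrder K := LinearOrder.mkOfAddGroupCone C
  haveI : IsOrderedRing K := IsOrderedRing.mkOfCone C
  refine ⟨inferInstance, IsOrderedRing.toIsStrictOrderedRing K, fun x hx => ?_⟩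
  change x - 0 ∈ C
  rw [sub_zero]
  exact hx

theorem order_of_total {A : Type u} [CommRing A] {T : Subsemiring A} (P : Subsemiring A)
    (hP : IsPre P) (htot : ∀ a, a ∈ P ∨ -a ∈ P) {F : Type u} [Field F] (φ : A →+* F) (hTP : T ≤ P)
    (hφ : ∀ a, φ a = 0 ↔ a ∈ P ∧ -a ∈ P) (hrep0 : ∀ x : F, ∃ a b, φ b ≠ 0 ∧ x = φ a / φ b) :
    ∃ (F : Type u) (_ : Field F) (_ : LinearOrder F) (_ : IsStrictOrderedRing F) (θ : A →+* F),
      ∀ t ∈ T, 0 ≤ θ t := by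
  let Q : Subsemiring F :=
    { carrier := {x | ∃ a ∈ P, ∃ b, φ b ≠ 0 ∧ x = φ a / φ b ^ 2}
      mul_mem' := by
        rintro x y ⟨a, ha, b, hb, rfl⟩ ⟨a', ha', b', hb', rfl⟩
        exact ⟨a * a', mul_mem ha ha', b * b', by rw [map_mul]; exact mul_ne_zero hb hb', by
          rw [map_mul, map_mul]; field_simp⟩
      one_mem' := ⟨1, one_mem _, 1, by simp, by simp⟩
      add_mem' := by
        rintro x y ⟨a, ha, b, hb, rfl⟩ ⟨a', ha', b', hb', rfl⟩
        exact ⟨a * b' ^ 2 + a' * b ^ 2, add_mem (mul_mem ha (hP _)) (mul_mem ha' (hP _)),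
          b * b', by rw [map_mul]; exact mul_ne_zero hb hb', by
          simp only [map_mul, map_add, map_pow]; field_simp⟩
      zero_mem' := ⟨0, zero_mem _, 1, by simp, by simp⟩ }
  have hrep : ∀ x : F, ∃ a b, φ b ≠ 0 ∧ x = φ a / φ b ^ 2 := by
    intro x
    obtain ⟨a, b, hb, rfl⟩ := hrep0 x
    refine ⟨a * b, b, hb, ?_⟩
    rw [map_mul]
    field_simp
  obtain ⟨lo, so, hQ⟩ := exists_order_of_cone Q (by
    intro x
    obtain ⟨a, b, hb, rfl⟩ := hrep x
    rcases htot a with ha | ha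
    · exact Or.inl ⟨a, ha, b, hb, rfl⟩
    · exact Or.inr ⟨-a, ha, b, hb, by rw [map_neg]; ring⟩) (by
    rintro x ⟨a, ha, b, hb, rfl⟩ ⟨a', ha', b', hb', e⟩
    have : φ (a * b' ^ 2 + a' * b ^ 2) = 0 := by
      simp only [map_mul, map_add, map_pow]
      field_simp at e
      linear_combination -e
    have h2 := ((hφ _).1 this).2
    have h3 : -(a * b' ^ 2) ∈ P := by
      have := add_mem h2 (mul_mem ha' (hP b))
      simpa using this
    have h4 : φ (a * b' ^ 2) = 0 := (hφ _).2 ⟨mul_mem ha (hP _), h3⟩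
    rw [map_mul, map_pow] at h4
    have : φ a = 0 := by
      rcases mul_eq_zero.1 h4 with h | h
      · exact h
      · exact absurd h (pow_ne_zero _ hb')
    rw [this, zero_div])
  exact ⟨F, inferInstance, lo, so, φ, fun t ht => hQ _ ⟨t, hTP ht, 1, by simp, by simp⟩⟩

theorem exists_ordering {A : Type u} [CommRing A] (T : Subsemiring A) (hT : IsPre T)
    (h : (-1 : A) ∉ T) :
    ∃ (F : Type u) (_ : Field F) (_ : LinearOrder F) (_ : IsStrictOrderedRing F) (θ : A →+* F),
      ∀ t ∈ T, 0 ≤ θ t := by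
  obtain ⟨P, hTP, hP, h1, hmax⟩ := exists_maximal T hT h
  have htot : ∀ a, a ∈ P ∨ -a ∈ P := by
    intro a
    by_contra! hcon
    obtain ⟨s, hs, t, ht, e⟩ := hmax a hcon.1
    obtain ⟨s', hs', t', ht', e'⟩ := hmax (-a) hcon.2
    apply h1
    have : (-1 : A) = s + s' + s * s' + a ^ 2 * (t * t') := by
      linear_combination (1 + s') * e - a * t * e'
    rw [this]
    exact add_mem (add_mem (add_mem hs hs') (mul_mem hs hs')) (mul_mem (hP a) (mul_mem ht ht'))
  have hsm : ∀ a x, x ∈ P → -x ∈ P → a * x ∈ P ∧ -(a * x) ∈ P := by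
    intro a x hx hx'
    rcases htot a with ha | ha
    · exact ⟨mul_mem ha hx, by simpa using mul_mem ha hx'⟩
    · exact ⟨by simpa using mul_mem ha hx', by simpa using mul_mem ha hx⟩
  let I : Ideal A :=
    { carrier := {x | x ∈ P ∧ -x ∈ P}
      add_mem' := fun {x y} hx hy => ⟨add_mem hx.1 hy.1, by
        rw [neg_add]; exact add_mem hx.2 hy.2⟩
      zero_mem' := ⟨zero_mem _, by rw [neg_zero]; exact zero_mem _⟩
      smul_mem' := fun a x hx => hsm a x hx.1 hx.2 }
  have hI : ∀ x, x ∈ I ↔ x ∈ P ∧ -x ∈ P := fun x => Iff.rfl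
  -- elements outside the support
  have key : ∀ a, a ∉ I → ∃ s ∈ P, ∃ t ∈ P, -1 = s + a * t ∨ -1 = s - a * t := by
    intro a ha
    by_cases h2 : a ∈ P
    · have h3 : -a ∉ P := fun h3 => ha ⟨h2, h3⟩
      obtain ⟨s, hs, t, ht, e⟩ := hmax _ h3
      exact ⟨s, hs, t, ht, Or.inr (by rw [e]; ring)⟩
    · obtain ⟨s, hs, t, ht, e⟩ := hmax _ h2
      exact ⟨s, hs, t, ht, Or.inl e⟩
  have hprime : I.IsPrime := by
    refine ⟨fun htop => h1 ?_, fun {a b} hab => ?_⟩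
    · have : (1 : A) ∈ I := htop ▸ Submodule.mem_top
      exact this.2
    · by_contra! hcon
      obtain ⟨s, hs, t, ht, e⟩ := key a hcon.1
      obtain ⟨s', hs', t', ht', e'⟩ := key b hcon.2
      have h5 := hsm (t * t') _ hab.1 hab.2
      have h6 : s + s' + s * s' ∈ P := add_mem (add_mem hs hs') (mul_mem hs hs')
      apply h1
      rcases e with e | e <;> rcases e' with e' | e'
      · have : (-1 : A) = s + s' + s * s' + -(t * t' * (a * b)) := by
          linear_combination (1 + s') * e - a * t * e'
        rw [this]; exact add_mem h6 h5.2
      · have : (-1 : A) = s + s' + s * s' + (t * t' * (a * b)) := by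
          linear_combination (1 + s') * e - a * t * e'
        rw [this]; exact add_mem h6 h5.1
      · have : (-1 : A) = s + s' + s * s' + (t * t' * (a * b)) := by
          linear_combination (1 + s') * e + a * t * e'
        rw [this]; exact add_mem h6 h5.1
      · have : (-1 : A) = s + s' + s * s' + -(t * t' * (a * b)) := by
          linear_combination (1 + s') * e + a * t * e'
        rw [this]; exact add_mem h6 h5.2
  haveI := hprime
  exact order_of_total P hP htot (A := A) (F := FractionRing (A ⧸ I))
    ((algebraMap (A ⧸ I) (FractionRing (A ⧸ I))).comp (Ideal.Quotient.mk I)) hTP (by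
      intro a
      rw [RingHom.comp_apply, ← hI, ← Ideal.Quotient.eq_zero_iff_mem]
      constructor
      · intro h; exact (IsFractionRing.injective (A ⧸ I) (FractionRing (A ⧸ I)))
          (by rw [h, map_zero])
      · intro h; rw [h, map_zero]) (by
      intro x
      obtain ⟨a, b, hb, rfl⟩ := IsFractionRing.div_surjective (A := A ⧸ I) x
      obtain ⟨a, rfl⟩ := Ideal.Quotient.mk_surjective a
      obtain ⟨b, rfl⟩ := Ideal.Quotient.mk_surjective b
      exact ⟨a, b, by
        rw [RingHom.comp_apply]
        exact IsFractionRing.to_map_ne_zero_of_mem_nonZeroDivisors (R := A ⧸ I) hb, rfl⟩)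

theorem pst_pos {A : Type u} [CommRing A] (T : Subsemiring A) (hT : IsPre T) (f : A)
    (h : ∀ (F : Type u) [Field F] [LinearOrder F] [IsStrictOrderedRing F] (θ : A →+* F),
      (∀ t ∈ T, 0 ≤ θ t) → 0 < θ f) : ∃ t ∈ T, ∃ s ∈ T, f * t = 1 + s := by
  by_contra! hcon
  obtain ⟨F, _, _, _, θ, hθ⟩ := exists_ordering (adj T hT (-f)) (isPre_adj _ _) (by
    rintro ⟨s, hs, t, ht, e⟩
    exact hcon t ht s hs (by linear_combination e))
  have h1 := h F θ (fun t ht => hθ t (le_adj _ _ ht))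
  have h2 := hθ _ (self_mem_adj hT (-f))
  rw [map_neg] at h2
  linarith

end PS
end

section
set_option linter.all false

universe u

namespace PS
open Polynomial

/-- intermediate value property for polynomials -/
def IVT (R : Type*) [Field R] [LinearOrder R] : Prop :=
  ∀ (p : R[X]) (a b : R), a < b → p.eval a * p.eval b < 0 → ∃ c, a < c ∧ c < b ∧ p.eval c = 0

section
variable {E : Type*} [Field E] [LinearOrder E] [IsStrictOrderedRing E]

theorem exists_irr_factor_signchange (h : E[X]) (a b : E) (hab : h.eval a * h.eval b < 0) :
    ∃ q, Irreducible q ∧ q ∣ h ∧ q.eval a * q.eval b < 0 := by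
  revert hab
  induction h using WfDvdMonoid.induction_on_irreducible with
  | zero => simp
  | unit u hu =>
    obtain ⟨c, hc, rfl⟩ := Polynomial.isUnit_iff.1 hu
    intro h
    simp only [eval_C] at h
    exact absurd h (not_lt.2 (mul_self_nonneg c))
  | mul p i hp hi ih =>
    intro h
    by_cases h2 : i.eval a * i.eval b < 0
    · exact ⟨i, hi, dvd_mul_right _ _, h2⟩
    · obtain ⟨q, hq, hqp, hs⟩ := ih (by
        by_contra h3
        rw [eval_mul, eval_mul] at h
        have := mul_nonneg (not_lt.1 h2) (not_lt.1 h3)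
        nlinarith)
      exact ⟨q, hq, hqp.mul_left _, hs⟩

theorem exists_root_of_natDegree_one {p : E[X]} (hp : p.natDegree = 1) {a b : E} (hab : a < b)
    (hs : p.eval a * p.eval b < 0) : ∃ c, a < c ∧ c < b ∧ p.eval c = 0 := by
  obtain ⟨u, v, hu, rfl⟩ : ∃ u v, u ≠ 0 ∧ p = C u * X + C v := by
    obtain ⟨u, hu, v, h⟩ := natDegree_eq_one.1 hp
    exact ⟨u, v, hu, h.symm⟩
  simp only [eval_add, eval_mul, eval_C, eval_X] at hs ⊢
  have e : u * (-v / u) + v = 0 := by field_simp; ring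
  refine ⟨-v / u, ?_, ?_, e⟩
  · by_contra h
    have h1 : -v / u ≤ a := not_lt.1 h
    have h2 : u * a + v = u * (a - -v / u) := by linear_combination e
    have h3 : u * b + v = u * (b - -v / u) := by linear_combination e
    rw [h2, h3] at hs
    have : 0 ≤ (u * u) * ((a - -v / u) * (b - -v / u)) :=
      mul_nonneg (mul_self_nonneg _) (mul_nonneg (by linarith) (by linarith))
    linarith [this, hs, (by ring : u * (a - -v / u) * (u * (b - -v / u)) =
      (u * u) * ((a - -v / u) * (b - -v / u)))]
  · by_contra h
    have h1 : b ≤ -v / u := not_lt.1 h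
    have h2 : u * a + v = u * (a - -v / u) := by linear_combination e
    have h3 : u * b + v = u * (b - -v / u) := by linear_combination e
    rw [h2, h3] at hs
    have : 0 ≤ (u * u) * ((-v / u - a) * (-v / u - b)) :=
      mul_nonneg (mul_self_nonneg _) (mul_nonneg (by linarith) (by linarith))
    linarith [this, hs, (by ring : u * (a - -v / u) * (u * (b - -v / u)) =
      (u * u) * ((-v / u - a) * (-v / u - b)))]

theorem ivt_of_irr (H : ∀ (q : E[X]) (a b : E), Irreducible q → a < b → q.eval a * q.eval b < 0 →
    q.natDegree = 1) : IVT E := by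
  intro p a b hab hs
  obtain ⟨q, hq, hqp, h⟩ := exists_irr_factor_signchange p a b hs
  obtain ⟨c, h1, h2, h3⟩ := exists_root_of_natDegree_one (H q a b hq hab h) hab h
  exact ⟨c, h1, h2, eval_eq_zero_of_dvd_of_eval_eq_zero hqp h3⟩
end

theorem order_adjoinRoot {E : Type u} [Field E] [LinearOrder E] [IsStrictOrderedRing E]
    (Q : E[X]) (hQ : Irreducible Q) (hdeg : 2 ≤ Q.natDegree) (a b : E) (hab : a < b)
    (hs : Q.eval a * Q.eval b < 0)
    (H : ∀ (q : E[X]) (a b : E), q.natDegree < Q.natDegree → Irreducible q → a < b →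
      q.eval a * q.eval b < 0 → q.natDegree = 1) :
    ∃ (F : Type u) (_ : Field F) (_ : LinearOrder F) (_ : IsStrictOrderedRing F)
      (θ : AdjoinRoot Q →+* F), ∀ c : E, 0 ≤ c → 0 ≤ θ (AdjoinRoot.of Q c) := by
  let M : Submonoid (AdjoinRoot Q) :=
    { carrier := {x | ∃ c : E, 0 ≤ c ∧ ∃ s, x = AdjoinRoot.of Q c * s ^ 2}
      one_mem' := ⟨1, zero_le_one, 1, by simp⟩
      mul_mem' := by
        rintro x y ⟨c, hc, s, rfl⟩ ⟨c', hc', s', rfl⟩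
        exact ⟨c * c', mul_nonneg hc hc', s * s', by rw [map_mul]; ring⟩ }
  let T := M.subsemiringClosure
  have hMT : ∀ x ∈ M, x ∈ T := fun x hx =>
    (Submonoid.subsemiringClosure_mem M).2 (AddSubmonoid.subset_closure hx)
  have hT : IsPre T := fun s => hMT _ ⟨1, zero_le_one, s, by simp⟩
  have hgood : ∀ x ∈ T, ∃ p : E[X], AdjoinRoot.mk Q p = x ∧ (∀ r, 0 ≤ p.eval r) ∧
      p.natDegree ≤ 2 * Q.natDegree - 2 := by
    intro x hx
    replace hx := (Submonoid.subsemiringClosure_mem M).1 hx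
    induction hx using AddSubmonoid.closure_induction with
    | mem x hx =>
      obtain ⟨c, hc, s, rfl⟩ := hx
      obtain ⟨f, rfl⟩ := AdjoinRoot.mk_surjective s
      refine ⟨C c * (f % Q) ^ 2, ?_, fun r => ?_, ?_⟩
      · have : AdjoinRoot.mk Q (f % Q) = AdjoinRoot.mk Q f := by
          rw [AdjoinRoot.mk_eq_mk]
          refine ⟨-(f / Q), ?_⟩
          have := EuclideanDomain.div_add_mod f Q
          linear_combination this
        rw [map_mul, map_pow, this]; rfl
      · rw [eval_mul, eval_C, eval_pow]; exact mul_nonneg hc (sq_nonneg _)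
      · have h1 : (f % Q).natDegree < Q.natDegree := natDegree_mod_lt f (by omega)
        have h2 := natDegree_C_mul_le c ((f % Q) ^ 2)
        have h3 := natDegree_pow_le (p := f % Q) (n := 2)
        omega
    | zero => exact ⟨0, by simp, by simp, by simp⟩
    | add x y _ _ hx hy =>
      obtain ⟨p, hp, h1, h2⟩ := hx
      obtain ⟨q, hq, h3, h4⟩ := hy
      exact ⟨p + q, by rw [map_add, hp, hq], fun r => by
        rw [eval_add]; exact add_nonneg (h1 r) (h3 r),
        (natDegree_add_le _ _).trans (max_le h2 h4)⟩
  have hneg : (-1 : AdjoinRoot Q) ∉ T := by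
    intro h1
    obtain ⟨p, hp, hpos, hd⟩ := hgood _ h1
    have : Q ∣ p + 1 := by
      rw [← AdjoinRoot.mk_eq_zero, map_add, hp, map_one]; ring
    obtain ⟨h, hh⟩ := this
    have hev : ∀ r, 0 < Q.eval r * h.eval r := by
      intro r
      rw [← eval_mul, ← hh, eval_add, eval_one]
      linarith [hpos r]
    have hh0 : h ≠ 0 := by
      rintro rfl
      have := hev 0
      simp at this
    have hdh : h.natDegree < Q.natDegree := by
      have h2 : (Q * h).natDegree = Q.natDegree + h.natDegree := natDegree_mul hQ.ne_zero hh0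
      have h3 : (p + 1).natDegree ≤ 2 * Q.natDegree - 2 :=
        (natDegree_add_le _ _).trans (max_le hd (by simp))
      rw [hh] at h3
      omega
    have hsh : h.eval a * h.eval b < 0 := by
      have h4 := mul_pos (hev a) (hev b)
      by_contra h5
      have := mul_nonneg (neg_nonneg.2 hs.le) (not_lt.1 h5)
      nlinarith
    obtain ⟨q, hq, hqh, hqs⟩ := exists_irr_factor_signchange h a b hsh
    have hq1 := H q a b ((natDegree_le_of_dvd hqh hh0).trans_lt hdh) hq hab hqs
    obtain ⟨c, -, -, hc⟩ := exists_root_of_natDegree_one hq1 hab hqs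
    have := hev c
    rw [eval_eq_zero_of_dvd_of_eval_eq_zero hqh hc] at this
    simp at this
  obtain ⟨F, i1, i2, i3, θ, hθ⟩ := exists_ordering T hT hneg
  exact ⟨F, i1, i2, i3, θ, fun c hc => hθ _ (hMT _ ⟨c, hc, 1, by simp⟩)⟩

/-- cones whose associated `P ∪ -P` is a subfield of `Ω`. -/
structure FCone {Ω : Type*} [Field Ω] (P : Subsemiring Ω) : Prop where
  inv : ∀ x ∈ P, x⁻¹ ∈ P
  tot : ∀ x ∈ P, ∀ y ∈ P, x - y ∈ P ∨ y - x ∈ P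
  zero : ∀ x, x ∈ P → -x ∈ P → x = 0

/-- the subfield of an FCone -/
def FCone.field {Ω : Type*} [Field Ω] {P : Subsemiring Ω} (h : FCone P) : Subfield Ω where
  carrier := {x | x ∈ P ∨ -x ∈ P}
  mul_mem' := by
    rintro x y (hx | hx) (hy | hy)
    · exact Or.inl (mul_mem hx hy)
    · exact Or.inr (by simpa using mul_mem hx hy)
    · exact Or.inr (by simpa using mul_mem hx hy)
    · exact Or.inl (by simpa using mul_mem hx hy)
  one_mem' := Or.inl (one_mem _)
  add_mem' := by
    rintro x y (hx | hx) (hy | hy)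
    · exact Or.inl (add_mem hx hy)
    · rcases h.tot _ hx _ hy with h | h
      · exact Or.inl (by simpa using h)
      · exact Or.inr (by simpa [add_comm, sub_eq_add_neg] using h)
    · rcases h.tot _ hx _ hy with h | h
      · exact Or.inr (by simpa [add_comm, sub_eq_add_neg] using h)
      · exact Or.inl (by simpa [add_comm, sub_eq_add_neg] using h)
    · exact Or.inr (by rw [neg_add]; exact (add_mem hx hy))
  zero_mem' := Or.inl (zero_mem _)
  neg_mem' := by
    rintro x (hx | hx)
    · exact Or.inr (by simpa using hx)
    · exact Or.inl hx
  inv_mem' := by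
    rintro x (hx | hx)
    · exact Or.inl (h.inv _ hx)
    · exact Or.inr (by simpa using h.inv _ hx)

theorem exists_ivt (F : Type u) [Field F] [LinearOrder F] [IsStrictOrderedRing F] :
    ∃ (R : Type u) (_ : Field R) (_ : LinearOrder R) (_ : IsStrictOrderedRing R) (φ : F →+* R),
      IVT R ∧ ∀ x, 0 ≤ x → 0 ≤ φ x := by
  let Ω := AlgebraicClosure F
  let P0 : Subsemiring Ω := (Subsemiring.nonneg F).map (algebraMap F Ω)
  have inj := (algebraMap F Ω).injective
  have hP0 : FCone P0 := by
    constructor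
    · rintro _ ⟨c, hc, rfl⟩
      exact ⟨c⁻¹, (inv_nonneg.2 hc : (0 : F) ≤ c⁻¹), by rw [map_inv₀]⟩
    · rintro _ ⟨c, hc, rfl⟩ _ ⟨d, hd, rfl⟩
      rcases le_total c d with h | h
      · exact Or.inr ⟨d - c, (sub_nonneg.2 h : (0 : F) ≤ d - c), by rw [map_sub]⟩
      · exact Or.inl ⟨c - d, (sub_nonneg.2 h : (0 : F) ≤ c - d), by rw [map_sub]⟩
    · rintro _ ⟨c, hc, rfl⟩ ⟨d, hd, e⟩
      rw [← map_neg] at e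
      have := inj e
      have hc' : (0 : F) ≤ c := hc
      have hd' : (0 : F) ≤ d := hd
      have : c = 0 := by linarith
      rw [this, map_zero]
  obtain ⟨P, hPP, hP⟩ := zorn_le_nonempty₀ {P : Subsemiring Ω | FCone P}
    (fun c hc hchain y hy => by
      have hdir : DirectedOn (· ≤ ·) c := hchain.directedOn
      have hm : ∀ x, x ∈ sSup c ↔ ∃ s ∈ c, x ∈ s := fun x =>
        Subsemiring.mem_sSup_of_directedOn ⟨y, hy⟩ hdir
      refine ⟨sSup c, ⟨fun x hx => ?_, fun x hx y hy => ?_, fun x hx hx' => ?_⟩,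
        fun z hz => le_sSup hz⟩
      · obtain ⟨s, hs, hx⟩ := (hm x).1 hx
        exact (hm _).2 ⟨s, hs, (hc hs).inv x hx⟩
      · obtain ⟨s, hs, hx⟩ := (hm x).1 hx
        obtain ⟨t, ht, hy⟩ := (hm y).1 hy
        obtain ⟨w, hw, hsw, htw⟩ := hdir s hs t ht
        rcases (hc hw).tot x (hsw hx) y (htw hy) with h | h
        · exact Or.inl ((hm _).2 ⟨w, hw, h⟩)
        · exact Or.inr ((hm _).2 ⟨w, hw, h⟩)
      · obtain ⟨s, hs, hx⟩ := (hm x).1 hx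
        obtain ⟨t, ht, hy⟩ := (hm _).1 hx'
        obtain ⟨w, hw, hsw, htw⟩ := hdir s hs t ht
        exact (hc hw).zero x (hsw hx) (htw hy)) P0 hP0
  have hPC : FCone P := hP.prop
  let R := hPC.field
  obtain ⟨lo, so, hle⟩ := exists_order_of_cone (K := R) (P.comap R.subtype)
    (fun x => x.2) (fun x h1 h2 => Subtype.ext (hPC.zero x.1 h1 h2))
  have hnn : ∀ x : R, 0 ≤ x → (x : Ω) ∈ P := by
    intro x hx
    rcases x.2 with h | h
    · exact h
    · have h1 : (0 : R) ≤ -x := hle (-x) h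
      have : x = 0 := by linarith
      rw [this]
      exact zero_mem P
  let φ : F →+* R := (algebraMap F Ω).codRestrict R (fun x => by
    rcases le_total 0 x with h | h
    · exact Or.inl (hPP ⟨x, h, rfl⟩)
    · exact Or.inr (hPP ⟨-x, (neg_nonneg.2 h : (0 : F) ≤ -x), by rw [map_neg]⟩))
  refine ⟨R, inferInstance, lo, so, φ, ivt_of_irr ?_, fun x hx => hle _ (hPP ⟨x, hx, rfl⟩)⟩
  have main : ∀ n, ∀ (q : R[X]) (a b : R), q.natDegree = n → Irreducible q → a < b →
      q.eval a * q.eval b < 0 → q.natDegree = 1 := by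
    intro n
    induction n using Nat.strong_induction_on with
    | _ n ih =>
      intro q a b hn hq hab hs
      by_contra hne
      have hd : 2 ≤ q.natDegree := by
        have := hq.natDegree_pos
        omega
      obtain ⟨F', _, _, _, θ, hθ⟩ := order_adjoinRoot q hq hd a b hab hs
        (fun q' a b hlt hq' hab hs => ih _ (hn ▸ hlt) q' a b rfl hq' hab hs)
      haveI : Fact (Irreducible q) := ⟨hq⟩
      haveI : Algebra.IsAlgebraic F Ω := AlgebraicClosure.isAlgebraic F
      have hroot : ∃ z : Ω, q.eval₂ R.subtype z = 0 := by
        obtain ⟨z, hz⟩ := IsAlgClosed.exists_eval₂_eq_zero R.subtype q hq.degree_pos.ne'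
        exact ⟨z, hz⟩
      obtain ⟨z, hz⟩ := hroot
      let j : AdjoinRoot q →+* Ω := AdjoinRoot.lift R.subtype z hz
      let P' : Subsemiring Ω := ((Subsemiring.nonneg F').comap θ).map j
      have hP' : FCone P' := by
        constructor
        · rintro _ ⟨c, hc, rfl⟩
          exact ⟨c⁻¹, by
            change 0 ≤ θ c⁻¹
            rw [map_inv₀]; exact inv_nonneg.2 hc, by rw [map_inv₀]⟩
        · rintro _ ⟨c, hc, rfl⟩ _ ⟨d, hd, rfl⟩
          rcases le_total (θ c) (θ d) with h | h
          · exact Or.inr ⟨d - c, by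
              change 0 ≤ θ (d - c)
              rw [map_sub]; exact sub_nonneg.2 h, by rw [map_sub]⟩
          · exact Or.inl ⟨c - d, by
              change 0 ≤ θ (c - d)
              rw [map_sub]; exact sub_nonneg.2 h, by rw [map_sub]⟩
        · rintro _ ⟨c, hc, rfl⟩ ⟨d, hd, e⟩
          rw [← map_neg] at e
          have e := j.injective e
          have hc' : 0 ≤ θ c := hc
          have hd' : 0 ≤ θ d := hd
          rw [e, map_neg] at hd'
          have : θ c = 0 := by linarith
          have : c = 0 := θ.injective (by rw [this, map_zero])
          rw [this, map_zero]
      have hle' : P' ≤ P := hP.le_of_ge hP' (by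
        intro x hx
        exact ⟨AdjoinRoot.of q ⟨x, Or.inl hx⟩, hθ _ (hle ⟨x, Or.inl hx⟩ hx), by
          change AdjoinRoot.lift R.subtype z hz _ = _
          rw [AdjoinRoot.lift_of]; rfl⟩)
      have hzR : z ∈ R := by
        have hjz : j (AdjoinRoot.root q) = z := AdjoinRoot.lift_root hz
        rcases le_total 0 (θ (AdjoinRoot.root q)) with h | h
        · exact Or.inl (hle' ⟨_, h, hjz⟩)
        · exact Or.inr (hle' ⟨-AdjoinRoot.root q, by
            change 0 ≤ θ _
            rw [map_neg]; exact neg_nonneg.2 h, by rw [map_neg, hjz]⟩)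
      have hz0 : q.eval (⟨z, hzR⟩ : R) = 0 := by
        apply Subtype.ext
        have h5 := hom_eval₂ q (RingHom.id R) R.subtype ⟨z, hzR⟩
        rw [RingHom.comp_id] at h5
        change R.subtype (q.eval₂ (RingHom.id R) ⟨z, hzR⟩) = 0
        rw [h5]
        exact hz
      have := degree_eq_one_of_irreducible_of_root hq hz0
      exact hne (natDegree_eq_of_degree_eq_some this)
  exact fun q a b hq hab hs => main _ q a b rfl hq hab hs

end PS
end

section
set_option linter.all false

universe u

namespace PS
open Polynomial

section
variable {R : Type*} [Field R] [LinearOrder R] [IsStrictOrderedRing R]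

theorem sign_eq_of_mul_pos {x y : R} (h : 0 < x * y) : SignType.sign x = SignType.sign y := by
  rcases pos_and_pos_or_neg_and_neg_of_mul_pos h with ⟨h1, h2⟩ | ⟨h1, h2⟩
  · rw [sign_pos h1, sign_pos h2]
  · rw [sign_neg h1, sign_neg h2]

theorem ivt_mul_pos (hR : IVT R) (p : R[X]) {a b : R} (hab : a ≤ b)
    (h : ∀ c, a ≤ c → c ≤ b → p.eval c ≠ 0) : 0 < p.eval a * p.eval b := by
  rcases hab.eq_or_lt with rfl | hab
  · exact mul_self_pos.2 (h a le_rfl le_rfl)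
  · by_contra hcon
    have h1 : p.eval a * p.eval b < 0 := lt_of_le_of_ne (not_lt.1 hcon)
      (mul_ne_zero (h a le_rfl hab.le) (h b hab.le le_rfl))
    obtain ⟨c, h2, h3, h4⟩ := hR p a b hab h1
    exact h c h2.le h3.le h4

theorem ivt_sign_eq (hR : IVT R) (p : R[X]) {a b : R}
    (h : ∀ c, min a b ≤ c → c ≤ max a b → p.eval c ≠ 0) :
    SignType.sign (p.eval a) = SignType.sign (p.eval b) := by
  rcases le_total a b with hab | hab
  · rw [min_eq_left hab, max_eq_right hab] at h
    exact sign_eq_of_mul_pos (ivt_mul_pos hR p hab h)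
  · rw [min_eq_right hab, max_eq_left hab] at h
    exact (sign_eq_of_mul_pos (ivt_mul_pos hR p hab h)).symm

theorem rolle_simple (hR : IVT R) (Q : R[X]) (hQ : ∀ w, Q.eval w = 0 → Q.derivative.eval w ≠ 0)
    {u v : R} (huv : u < v) (hu : Q.eval u = 0) (hv : Q.eval v = 0) :
    ∃ c, u < c ∧ c < v ∧ Q.derivative.eval c = 0 := by
  classical
  have hQ0 : Q ≠ 0 := by
    rintro rfl
    exact hQ 0 (by simp) (by simp)
  -- smallest root in `(u, v]`
  let Z := Q.roots.toFinset.filter (fun z => u < z)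
  have hvZ : v ∈ Z := by simp [Z, hQ0, hv, huv]
  obtain ⟨w, hwZ, hmin⟩ := Z.exists_min_image id ⟨v, hvZ⟩
  simp only [Z, Finset.mem_filter, Multiset.mem_toFinset, mem_roots hQ0, IsRoot.def, id] at hwZ hmin
  have hwv : w ≤ v := hmin v ⟨hv, huv⟩
  obtain ⟨G1, hG1⟩ := dvd_iff_isRoot.2 hu
  have hw1 : G1.eval w = 0 := by
    have := hwZ.1
    rw [hG1, eval_mul] at this
    rcases mul_eq_zero.1 this with h | h
    · simp at h; linarith [hwZ.2]
    · exact h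
  obtain ⟨G, hG⟩ := dvd_iff_isRoot.2 hw1
  have hQG : Q = (X - C u) * ((X - C w) * G) := by rw [hG1, hG]
  have hder : ∀ t, Q.derivative.eval t = (t - w) * G.eval t + (t - u) * (G.eval t +
      (t - w) * G.derivative.eval t) := by
    intro t; rw [hQG]; simp [derivative_mul]
  have hdu : Q.derivative.eval u = (u - w) * G.eval u := by rw [hder]; ring
  have hdw : Q.derivative.eval w = (w - u) * G.eval w := by rw [hder]; ring
  have hGr : ∀ c, u ≤ c → c ≤ w → G.eval c ≠ 0 := by
    intro c hc1 hc2 hc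
    rcases hc1.eq_or_lt with rfl | hc1
    · exact hQ _ hu (by rw [hdu, hc, mul_zero])
    · have : Q.eval c = 0 := by rw [hQG]; simp [hc]
      have : c = w := le_antisymm hc2 (hmin c ⟨this, hc1⟩)
      subst this
      exact hQ _ hwZ.1 (by rw [hdw, hc, mul_zero])
  have hpos := ivt_mul_pos hR G hwZ.2.le hGr
  obtain ⟨c, h1, h2, h3⟩ := hR Q.derivative u w hwZ.2 (by
    rw [hdu, hdw]
    have : 0 < w - u := sub_pos.2 hwZ.2
    nlinarith [mul_pos (mul_pos this this) hpos])
  exact ⟨c, h1, h2.trans_le hwv, h3⟩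

theorem root_unique (hR : IVT R) (Q : R[X]) (hQ : ∀ w, Q.eval w = 0 → Q.derivative.eval w ≠ 0)
    {a b : R} (h : ∀ c, a < c → c < b → Q.derivative.eval c ≠ 0) {u v : R}
    (hu : Q.eval u = 0) (hv : Q.eval v = 0) (h1 : a < u) (h2 : u < b) (h3 : a < v) (h4 : v < b) :
    u = v := by
  rcases lt_trichotomy u v with huv | huv | huv
  · obtain ⟨c, hc1, hc2, hc⟩ := rolle_simple hR Q hQ huv hu hv
    exact absurd hc (h c (h1.trans hc1) (hc2.trans h4))
  · exact huv
  · obtain ⟨c, hc1, hc2, hc⟩ := rolle_simple hR Q hQ huv hv hu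
    exact absurd hc (h c (h3.trans hc1) (hc2.trans h2))

theorem neg_of_simple_root (hR : IVT R) (Q : R[X])
    (hQ : ∀ w, Q.eval w = 0 → Q.derivative.eval w ≠ 0)
    {a b : R} (h : ∀ c, a < c → c < b → Q.derivative.eval c ≠ 0) {u : R}
    (hu : Q.eval u = 0) (h1 : a < u) (h2 : u < b) (ha : Q.eval a ≠ 0) (hb : Q.eval b ≠ 0) :
    Q.eval a * Q.eval b < 0 := by
  obtain ⟨G, hG⟩ := dvd_iff_isRoot.2 hu
  have hdu : Q.derivative.eval u = G.eval u := by rw [hG]; simp [derivative_mul]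
  have hGr : ∀ c, a ≤ c → c ≤ b → G.eval c ≠ 0 := by
    intro c hc1 hc2 hc
    have hQc : Q.eval c = 0 := by rw [hG]; simp [hc]
    have h5 : a < c := lt_of_le_of_ne hc1 (by rintro rfl; exact ha hQc)
    have h6 : c < b := lt_of_le_of_ne hc2 (by rintro rfl; exact hb hQc)
    have := root_unique hR Q hQ h hu hQc h1 h2 h5 h6
    subst this
    exact hQ u hu (by rw [hdu, hc])
  have hpos := ivt_mul_pos hR G (h1.trans h2).le hGr
  rw [hG]
  simp only [eval_mul, eval_sub, eval_X, eval_C]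
  nlinarith [mul_pos (mul_pos (sub_pos.2 h1) (sub_pos.2 h2)) hpos]
end

section
variable {E : Type*} [Field E] [LinearOrder E] [IsStrictOrderedRing E]

theorem exists_bound (p : E[X]) (hp : p ≠ 0) : ∃ M δ : E, 0 < δ ∧ 0 < M ∧
    ∀ {R : Type u} [Field R] [LinearOrder R] [IsStrictOrderedRing R] (α : E →+* R),
      StrictMono α → ∀ y : R, α M ≤ |y| → α δ ≤ |p.eval₂ α y| := by
  induction h : p.natDegree generalizing p with
  | zero =>
    rw [eq_C_of_natDegree_eq_zero h] at hp ⊢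
    have hc : p.coeff 0 ≠ 0 := fun h0 => hp (by rw [h0, C_0])
    refine ⟨1, |p.coeff 0|, abs_pos.2 hc, one_pos, fun α hα y _ => ?_⟩
    rw [eval₂_C]
    rcases abs_cases (p.coeff 0) with ⟨h1, _⟩ | ⟨h1, _⟩
    · rw [h1]; exact le_abs_self _
    · rw [h1, map_neg]; exact neg_le_abs _
  | succ n ih =>
    have hd : p.divX.natDegree = n := by rw [natDegree_divX_eq_natDegree_tsub_one, h]; simp
    have h0 : p.divX ≠ 0 := by
      intro h0
      have := divX_eq_zero_iff.1 h0
      rw [this, natDegree_C] at h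
      omega
    obtain ⟨M, δ, hδ, hM, H⟩ := ih _ h0 hd
    refine ⟨M + (|p.coeff 0| + δ) / δ, δ, hδ, by positivity, fun α hα y hy => ?_⟩
    have e : p.eval₂ α y = y * p.divX.eval₂ α y + α (p.coeff 0) := by
      have := congrArg (eval₂ α y) (X_mul_divX_add p)
      rw [eval₂_add, eval₂_mul, eval₂_X, eval₂_C] at this
      exact this.symm
    have h1 : α M ≤ |y| := (hα.monotone (by
      have : 0 < (|p.coeff 0| + δ) / δ := by positivity
      linarith)).trans hy
    have h2 := H α hα y h1
    have hδ' : 0 < α δ := by simpa using hα hδ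
    have h3 : α ((|p.coeff 0| + δ) / δ) ≤ |y| := (hα.monotone (by linarith)).trans hy
    rw [map_div₀, div_le_iff₀ hδ', map_add] at h3
    have h4 : |α (p.coeff 0)| ≤ α |p.coeff 0| := by
      rw [abs_le]
      constructor
      · rw [← map_neg]; exact hα.monotone (neg_abs_le _)
      · exact hα.monotone (le_abs_self _)
    have h5 : |y| * |p.divX.eval₂ α y| - |α (p.coeff 0)| ≤ |p.eval₂ α y| := by
      rw [e, ← abs_mul]
      have := abs_sub_abs_le_abs_sub (y * p.divX.eval₂ α y) (-α (p.coeff 0))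
      rwa [abs_neg, sub_neg_eq_add] at this
    have h6 : |y| * α δ ≤ |y| * |p.divX.eval₂ α y| := mul_le_mul_of_nonneg_left h2 (abs_nonneg _)
    linarith

theorem sign_map {R : Type*} [Field R] [LinearOrder R] [IsStrictOrderedRing R] {α : E →+* R}
    (hα : StrictMono α) (x : E) : SignType.sign (α x) = SignType.sign x :=
  hα.sign_comp x

theorem sign_eval₂ {R : Type*} [Field R] [LinearOrder R] [IsStrictOrderedRing R] {α : E →+* R}
    (hα : StrictMono α) (p : E[X]) (x : E) :
    SignType.sign (p.eval₂ α (α x)) = SignType.sign (p.eval x) := by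
  rw [eval₂_at_apply, sign_map hα]
end

end PS
end

section
set_option linter.all false

universe u

namespace PS
open Polynomial

section
variable {E : Type*} [Field E] [LinearOrder E] [IsStrictOrderedRing E]
variable {R : Type u} [Field R] [LinearOrder R] [IsStrictOrderedRing R]
variable {R' : Type u} [Field R'] [LinearOrder R'] [IsStrictOrderedRing R']

/-- no roots of irreducible polynomials of degree between 2 and n -/
def NR (α : E →+* R) (n : ℕ) : Prop :=
  ∀ q : E[X], Irreducible q → 2 ≤ q.natDegree → q.natDegree < n → ∀ y, q.eval₂ α y ≠ 0

theorem NR.root_in {α : E →+* R} {n : ℕ} (h : NR α n) (p : E[X]) (hp : p ≠ 0)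
    (hn : p.natDegree < n) (y : R) (hy : p.eval₂ α y = 0) : ∃ e, α e = y ∧ p.eval e = 0 := by
  induction p using WfDvdMonoid.induction_on_irreducible with
  | zero => exact absurd rfl hp
  | unit u hu =>
    obtain ⟨c, hc, rfl⟩ := Polynomial.isUnit_iff.1 hu
    rw [eval₂_C] at hy
    exact absurd (α.injective (hy.trans (map_zero α).symm)) hc.ne_zero
  | mul p i hp0 hi ih =>
    have hd := natDegree_mul hi.ne_zero hp0
    rw [eval₂_mul] at hy
    rcases mul_eq_zero.1 hy with h1 | h1
    · by_cases h2 : 2 ≤ i.natDegree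
      · exact absurd h1 (h i hi h2 (by omega) y)
      · have h3 : i.natDegree = 1 := by have := hi.natDegree_pos; omega
        obtain ⟨u, hu, v, rfl⟩ := natDegree_eq_one.1 h3
        simp only [eval₂_add, eval₂_mul, eval₂_C, eval₂_X] at h1
        have hu' : α u ≠ 0 := by rwa [Ne, map_eq_zero]
        refine ⟨-v / u, ?_, ?_⟩
        · rw [map_div₀, map_neg, div_eq_iff hu']; linear_combination -h1
        · simp; left; field_simp; ring
    · obtain ⟨e, he, h2⟩ := ih hp0 (by omega) h1
      exact ⟨e, he, by rw [eval_mul, h2, mul_zero]⟩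

theorem sep_ne {Q : E[X]} (hQ : Irreducible Q) (α : E →+* R) :
    ∀ w, (Q.map α).eval w = 0 → (Q.map α).derivative.eval w ≠ 0 := by
  haveI := algebraRat.charZero E
  intro w hw
  rw [derivative_map, eval_map]
  rw [eval_map] at hw
  exact hQ.separable.eval₂_derivative_ne_zero α hw

theorem ext_root (hR : IVT R) (hR' : IVT R') {α : E →+* R} {β : E →+* R'} (hα : StrictMono α)
    (hβ : StrictMono β) (Q : E[X]) (hQ : Irreducible Q) (hd : 2 ≤ Q.natDegree)
    (h1 : NR α Q.natDegree) (h2 : NR β Q.natDegree) (θ : R) (hθ : Q.eval₂ α θ = 0) :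
    ∃ θ' : R', Q.eval₂ β θ' = 0 ∧
      ∀ G : E[X], SignType.sign (G.eval₂ α θ) = SignType.sign (G.eval₂ β θ') := by
  classical
  haveI := algebraRat.charZero E
  have hQE : ∀ e, Q.eval e ≠ 0 := by
    intro e he
    have : Q.natDegree = 1 := natDegree_eq_of_degree_eq_some (degree_eq_one_of_irreducible_of_root hQ he)
    omega
  have hθE : ∀ e, α e ≠ θ := by
    rintro e rfl
    rw [eval₂_at_apply, map_eq_zero] at hθ
    exact hQE e hθ
  have hD0 : Q.derivative ≠ 0 := by
    intro h0
    have := natDegree_eq_zero_of_derivative_eq_zero h0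
    omega
  have hDn : Q.derivative.natDegree < Q.natDegree := natDegree_derivative_lt (by omega)
  obtain ⟨M, δ, hδ, hM, hB⟩ := exists_bound.{u} Q hQ.ne_zero
  have hθM : |θ| < α M := by
    by_contra hcon
    have := hB α hα θ (not_lt.1 hcon)
    rw [hθ, abs_zero] at this
    have h3 : 0 < α δ := by simpa using hα hδ
    linarith
  -- choose `a`
  obtain ⟨a, haθ, hamax⟩ : ∃ a, α a < θ ∧ ∀ z, Q.derivative.eval z = 0 → α z < θ → z ≤ a := by
    obtain ⟨a, ha, hmax⟩ := (insert (-M) (Q.derivative.roots.toFinset.filter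
      (fun z => α z < θ))).exists_max_image id ⟨-M, Finset.mem_insert_self _ _⟩
    refine ⟨a, ?_, fun z hz hzθ => hmax z (Finset.mem_insert_of_mem (by simp [hD0, hz, hzθ]))⟩
    rcases Finset.mem_insert.1 ha with rfl | ha
    · rw [map_neg]; exact (abs_lt.1 hθM).1
    · exact (Finset.mem_filter.1 ha).2
  obtain ⟨b, hbθ, hbmin⟩ : ∃ b, θ < α b ∧ ∀ z, Q.derivative.eval z = 0 → θ < α z → b ≤ z := by
    obtain ⟨b, hb, hmin⟩ := (insert M (Q.derivative.roots.toFinset.filter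
      (fun z => θ < α z))).exists_min_image id ⟨M, Finset.mem_insert_self _ _⟩
    refine ⟨b, ?_, fun z hz hzθ => hmin z (Finset.mem_insert_of_mem (by simp [hD0, hz, hzθ]))⟩
    rcases Finset.mem_insert.1 hb with rfl | hb
    · exact (abs_lt.1 hθM).2
    · exact (Finset.mem_filter.1 hb).2
  have hab : a < b := hα.lt_iff_lt.1 (haθ.trans hbθ)
  have hDE : ∀ z, a < z → z < b → Q.derivative.eval z ≠ 0 := by
    intro z hz1 hz2 hz
    rcases lt_trichotomy (α z) θ with h | h | h
    · exact absurd (hamax z hz h) (not_le.2 hz1)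
    · exact hθE z h
    · exact absurd (hbmin z hz h) (not_le.2 hz2)
  have hDR : ∀ c, α a < c → c < α b → (Q.map α).derivative.eval c ≠ 0 := by
    intro c hc1 hc2 hc
    rw [derivative_map, eval_map] at hc
    obtain ⟨e, rfl, he⟩ := h1.root_in _ hD0 hDn c hc
    exact hDE e (hα.lt_iff_lt.1 hc1) (hα.lt_iff_lt.1 hc2) he
  have hDR' : ∀ c, β a < c → c < β b → (Q.map β).derivative.eval c ≠ 0 := by
    intro c hc1 hc2 hc
    rw [derivative_map, eval_map] at hc
    obtain ⟨e, rfl, he⟩ := h2.root_in _ hD0 hDn c hc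
    exact hDE e (hβ.lt_iff_lt.1 hc1) (hβ.lt_iff_lt.1 hc2) he
  have evα : ∀ e, (Q.map α).eval (α e) = α (Q.eval e) := fun e => by
    rw [eval_map, eval₂_at_apply]
  have evβ : ∀ e, (Q.map β).eval (β e) = β (Q.eval e) := fun e => by
    rw [eval_map, eval₂_at_apply]
  have hθm : (Q.map α).eval θ = 0 := by rw [eval_map, hθ]
  have hneg : Q.eval a * Q.eval b < 0 := by
    have := neg_of_simple_root hR (Q.map α) (sep_ne hQ α) hDR hθm haθ hbθ
      (by rw [evα, Ne, map_eq_zero]; exact hQE a) (by rw [evα, Ne, map_eq_zero]; exact hQE b)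
    rw [evα, evα, ← map_mul, ← map_zero α] at this
    exact hα.lt_iff_lt.1 this
  have rootα : ∀ x y, x < y → Q.eval x * Q.eval y < 0 →
      ∃ c, α x < c ∧ c < α y ∧ (Q.map α).eval c = 0 := by
    intro x y hxy h
    refine hR (Q.map α) _ _ (hα hxy) ?_
    rw [evα, evα, ← map_mul, ← map_zero α]
    exact hα h
  have rootβ : ∀ x y, x < y → Q.eval x * Q.eval y < 0 →
      ∃ c, β x < c ∧ c < β y ∧ (Q.map β).eval c = 0 := by
    intro x y hxy h
    refine hR' (Q.map β) _ _ (hβ hxy) ?_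
    rw [evβ, evβ, ← map_mul, ← map_zero β]
    exact hβ h
  obtain ⟨θ', ha', hb', hθ'⟩ := rootβ a b hab hneg
  -- cuts agree
  have hcut : ∀ e, (α e < θ ∧ β e < θ') ∨ (θ < α e ∧ θ' < β e) := by
    intro e
    rcases le_or_gt e a with hea | hea
    · exact Or.inl ⟨(hα.monotone hea).trans_lt haθ, (hβ.monotone hea).trans_lt ha'⟩
    rcases le_or_gt b e with heb | heb
    · exact Or.inr ⟨hbθ.trans_le (hα.monotone heb), hb'.trans_le (hβ.monotone heb)⟩
    by_cases hs : Q.eval a * Q.eval e < 0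
    · right
      obtain ⟨c, hc1, hc2, hc⟩ := rootα a e hea hs
      obtain ⟨c', hc1', hc2', hc'⟩ := rootβ a e hea hs
      rw [root_unique hR (Q.map α) (sep_ne hQ α) hDR hθm hc haθ hbθ hc1 (hc2.trans (hα heb)),
        root_unique hR' (Q.map β) (sep_ne hQ β) hDR' hθ' hc' ha' hb' hc1' (hc2'.trans (hβ heb))]
      exact ⟨hc2, hc2'⟩
    · left
      have hs' : Q.eval e * Q.eval b < 0 := by
        by_contra h5
        have h6 := mul_nonneg (not_lt.1 hs) (not_lt.1 h5)
        have h7 := mul_self_pos.2 (hQE e)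
        nlinarith [mul_pos (neg_pos.2 hneg) h7]
      obtain ⟨c, hc1, hc2, hc⟩ := rootα e b heb hs'
      obtain ⟨c', hc1', hc2', hc'⟩ := rootβ e b heb hs'
      rw [root_unique hR (Q.map α) (sep_ne hQ α) hDR hθm hc haθ hbθ ((hα hea).trans hc1) hc2,
        root_unique hR' (Q.map β) (sep_ne hQ β) hDR' hθ' hc' ha' hb' ((hβ hea).trans hc1') hc2']
      exact ⟨hc1, hc1'⟩
  rw [eval_map] at hθ'
  refine ⟨θ', hθ', ?_⟩
  have small : ∀ G : E[X], G.natDegree < Q.natDegree →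
      SignType.sign (G.eval₂ α θ) = SignType.sign (G.eval₂ β θ') := by
    intro G hG
    induction G using WfDvdMonoid.induction_on_irreducible with
    | zero => simp
    | unit u hu =>
      obtain ⟨c, hc, rfl⟩ := Polynomial.isUnit_iff.1 hu
      rw [eval₂_C, eval₂_C, sign_map hα, sign_map hβ]
    | mul p i hp0 hi ih =>
      have hd := natDegree_mul hi.ne_zero hp0
      rw [eval₂_mul, eval₂_mul, sign_mul, sign_mul, ih (by omega)]
      congr 1
      by_cases hi2 : 2 ≤ i.natDegree
      · have n1 := h1 i hi hi2 (by omega)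
        have n2 := h2 i hi hi2 (by omega)
        have e1 := ivt_sign_eq hR (i.map α) (a := θ) (b := α a)
          (fun c _ _ => by rw [eval_map]; exact n1 c)
        have e2 := ivt_sign_eq hR' (i.map β) (a := θ') (b := β a)
          (fun c _ _ => by rw [eval_map]; exact n2 c)
        rw [eval_map, eval_map, sign_eval₂ hα] at e1
        rw [eval_map, eval_map, sign_eval₂ hβ] at e2
        rw [e1, e2]
      · have h3 : i.natDegree = 1 := by have := hi.natDegree_pos; omega
        obtain ⟨u, hu, v, rfl⟩ := natDegree_eq_one.1 h3
        simp only [eval₂_add, eval₂_mul, eval₂_C, eval₂_X]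
        have hu1 : α u ≠ 0 := by rwa [Ne, map_eq_zero]
        have hu2 : β u ≠ 0 := by rwa [Ne, map_eq_zero]
        have e1 : α u * θ + α v = α u * (θ - α (-v / u)) := by
          rw [map_div₀, map_neg]; field_simp; ring
        have e2 : β u * θ' + β v = β u * (θ' - β (-v / u)) := by
          rw [map_div₀, map_neg]; field_simp; ring
        rw [e1, e2, sign_mul, sign_mul, sign_map hα, sign_map hβ]
        congr 1
        rcases hcut (-v / u) with ⟨h4, h5⟩ | ⟨h4, h5⟩
        · rw [sign_pos (sub_pos.2 h4), sign_pos (sub_pos.2 h5)]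
        · rw [sign_neg (sub_neg.2 h4), sign_neg (sub_neg.2 h5)]
  intro G
  have hdm := EuclideanDomain.div_add_mod G Q
  have e1 : G.eval₂ α θ = (G % Q).eval₂ α θ := by
    conv_lhs => rw [← hdm, eval₂_add, eval₂_mul, hθ, zero_mul, zero_add]
  have e2 : G.eval₂ β θ' = (G % Q).eval₂ β θ' := by
    conv_lhs => rw [← hdm, eval₂_add, eval₂_mul, hθ', zero_mul, zero_add]
  rw [e1, e2]
  exact small _ (natDegree_mod_lt G (by omega))

end
end PS
end

section
set_option linter.all false

universe u v

namespace PS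
open Polynomial

section
variable {R : Type u} [Field R] [LinearOrder R] [IsStrictOrderedRing R]
variable {R' : Type u} [Field R'] [LinearOrder R'] [IsStrictOrderedRing R']

/-- partial isomorphisms, as graphs -/
structure PI (Γ : Subring (R × R')) : Prop where
  sgn : ∀ x ∈ Γ, SignType.sign x.1 = SignType.sign x.2
  inv : ∀ x ∈ Γ, ((x.1⁻¹, x.2⁻¹) : R × R') ∈ Γ

theorem order_of_maps {E : Type u} [Field E] (α : E →+* R) (β : E →+* R')
    (hs : ∀ e, SignType.sign (α e) = SignType.sign (β e)) :
    ∃ (_ : LinearOrder E) (_ : IsStrictOrderedRing E), StrictMono α ∧ StrictMono β := by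
  obtain ⟨lo, so, hle⟩ := exists_order_of_cone (K := E) ((Subsemiring.nonneg R).comap α)
    (fun x => by
      rcases le_total 0 (α x) with h | h
      · exact Or.inl h
      · exact Or.inr (by
          change 0 ≤ α (-x)
          rw [map_neg]; exact neg_nonneg.2 h)) (fun x h1 h2 => by
      have h1' : 0 ≤ α x := h1
      have h2' : 0 ≤ α (-x) := h2
      rw [map_neg] at h2'
      have h3 : α x = 0 := by linarith
      exact α.injective (h3.trans (map_zero α).symm))
  have hα : StrictMono α := by
    intro x y hxy
    by_contra hcon
    have : 0 ≤ x - y := hle (x - y) (by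
      change 0 ≤ α (x - y)
      rw [map_sub]; exact sub_nonneg.2 (not_lt.1 hcon))
    linarith
  have hβ : StrictMono β := by
    intro x y hxy
    have h1 : 0 < α (y - x) := by rw [map_sub]; exact sub_pos.2 (hα hxy)
    have h2 := hs (y - x)
    rw [sign_pos h1] at h2
    have h3 := sign_eq_one_iff.1 h2.symm
    rw [map_sub] at h3
    exact sub_pos.1 h3
  exact ⟨lo, so, hα, hβ⟩

theorem PI.exists_field {Γ : Subring (R × R')} (h : PI Γ) {k : Type v} [Field k] (f : k →+* R × R')
    (hf : ∀ c, f c ∈ Γ) : ∃ (E : Type u) (_ : Field E) (_ : LinearOrder E)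
      (_ : IsStrictOrderedRing E) (α : E →+* R) (β : E →+* R') (κ : k →+* E),
      StrictMono α ∧ StrictMono β ∧ (∀ x : R × R', x ∈ Γ ↔ ∃ e, x = (α e, β e)) ∧
      ∀ c, f c = (α (κ c), β (κ c)) := by
  have h0 : ∀ x ∈ Γ, x.1 = 0 → x.2 = 0 := by
    intro x hx hx0
    have := h.sgn x hx
    rw [hx0, sign_zero] at this
    exact sign_eq_zero_iff.1 this.symm
  have hfield : IsField Γ :=
    { exists_pair_ne := ⟨0, 1, fun h => by
        have := congrArg (fun z : Γ => z.1.1) h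
        simp at this⟩
      mul_comm := mul_comm
      mul_inv_cancel := by
        intro x hx
        have h1 : x.1.1 ≠ 0 := fun h1 => hx (Subtype.ext (Prod.ext h1 (h0 _ x.2 h1)))
        have h2 : x.1.2 ≠ 0 := by
          intro h2
          have := h.sgn _ x.2
          rw [h2, sign_zero] at this
          exact h1 (sign_eq_zero_iff.1 this)
        exact ⟨⟨_, h.inv _ x.2⟩, Subtype.ext (Prod.ext (mul_inv_cancel₀ h1) (mul_inv_cancel₀ h2))⟩ }
  letI : Field Γ := hfield.toField
  let α : Γ →+* R := (RingHom.fst R R').comp Γ.subtype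
  let β : Γ →+* R' := (RingHom.snd R R').comp Γ.subtype
  obtain ⟨lo, so, hα, hβ⟩ := order_of_maps α β (fun e => h.sgn _ e.2)
  let κ0 : k →+* Γ := f.codRestrict Γ hf
  exact ⟨Γ, inferInstance, lo, so, α, β, κ0, hα, hβ, fun x => ⟨fun hx => ⟨⟨x, hx⟩, rfl⟩, by
    rintro ⟨e, rfl⟩; exact e.2⟩, fun c => rfl⟩

theorem PI.ext_of_root {E : Type u} [Field E] (Γ : Subring (R × R')) {α : E →+* R} {β : E →+* R'}
    (hΓ : ∀ x : R × R', x ∈ Γ ↔ ∃ e, x = (α e, β e)) (hmax : ∀ Γ', PI Γ' → Γ ≤ Γ' → Γ' ≤ Γ)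
    (Q : E[X]) (hQ : Irreducible Q) (θ : R) (θ' : R') (hθ : Q.eval₂ α θ = 0)
    (hθ' : Q.eval₂ β θ' = 0)
    (hs : ∀ G : E[X], SignType.sign (G.eval₂ α θ) = SignType.sign (G.eval₂ β θ')) :
    ∃ e, α e = θ ∧ β e = θ' := by
  haveI : Fact (Irreducible Q) := ⟨hQ⟩
  let j : AdjoinRoot Q →+* R := AdjoinRoot.lift α θ hθ
  let j' : AdjoinRoot Q →+* R' := AdjoinRoot.lift β θ' hθ'
  let Γ' : Subring (R × R') := (j.prod j').range
  have h1 : PI Γ' := by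
    constructor
    · rintro _ ⟨z, rfl⟩
      obtain ⟨G, rfl⟩ := AdjoinRoot.mk_surjective z
      change SignType.sign (j (AdjoinRoot.mk Q G)) = SignType.sign (j' (AdjoinRoot.mk Q G))
      simp only [j, j', AdjoinRoot.lift_mk]
      exact hs G
    · rintro _ ⟨z, rfl⟩
      refine ⟨z⁻¹, ?_⟩
      change (j z⁻¹, j' z⁻¹) = ((j z)⁻¹, (j' z)⁻¹)
      rw [map_inv₀, map_inv₀]
  have h2 := hmax Γ' h1 (by
    intro x hx
    obtain ⟨e, rfl⟩ := (hΓ x).1 hx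
    refine ⟨AdjoinRoot.of Q e, ?_⟩
    change (j _, j' _) = _
    simp only [j, j', AdjoinRoot.lift_of])
  have h3 : ((θ, θ') : R × R') ∈ Γ := h2 ⟨AdjoinRoot.root Q, by
    change (j _, j' _) = _
    simp only [j, j', AdjoinRoot.lift_root]⟩
  obtain ⟨e, he⟩ := (hΓ _).1 h3
  exact ⟨e, (congrArg Prod.fst he).symm, (congrArg Prod.snd he).symm⟩

/-- transfer of one element -/
theorem transfer {k : Type v} [Field k] [LinearOrder k] [IsStrictOrderedRing k]
    (hR : IVT R) (hR' : IVT R') (a : k →+* R) (b : k →+* R') (ha : StrictMono a) (hb : StrictMono b)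
    (S : Finset k[X]) (y : R) :
    ∃ y' : R', ∀ P ∈ S, SignType.sign (P.eval₂ a y) = SignType.sign (P.eval₂ b y') := by
  classical
  let Γ0 : Subring (R × R') := (a.prod b).range
  have h0 : PI Γ0 := by
    constructor
    · rintro _ ⟨c, rfl⟩
      change SignType.sign (a c) = SignType.sign (b c)
      rw [sign_map ha, sign_map hb]
    · rintro _ ⟨c, rfl⟩
      refine ⟨c⁻¹, ?_⟩
      change (a c⁻¹, b c⁻¹) = ((a c)⁻¹, (b c)⁻¹)
      rw [map_inv₀, map_inv₀]
  obtain ⟨Γ, hΓ0, hΓ⟩ := zorn_le_nonempty₀ {Γ : Subring (R × R') | PI Γ}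
    (fun c hc hchain y hy => by
      have hdir : DirectedOn (· ≤ ·) c := hchain.directedOn
      have hm : ∀ x, x ∈ sSup c ↔ ∃ s ∈ c, x ∈ s := fun x =>
        Subring.mem_sSup_of_directedOn ⟨y, hy⟩ hdir
      refine ⟨sSup c, ⟨fun x hx => ?_, fun x hx => ?_⟩, fun z hz => le_sSup hz⟩
      · obtain ⟨s, hs, hx⟩ := (hm x).1 hx
        exact (hc hs).sgn x hx
      · obtain ⟨s, hs, hx⟩ := (hm x).1 hx
        exact (hm _).2 ⟨s, hs, (hc hs).inv x hx⟩) Γ0 h0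
  obtain ⟨E, _, _, _, α, β, κ, hα, hβ, hE, hκ⟩ := PI.exists_field (hΓ.prop : PI Γ) (a.prod b)
    (fun c => hΓ0 ⟨c, rfl⟩)
  have hmax : ∀ Γ', PI Γ' → Γ ≤ Γ' → Γ' ≤ Γ := fun Γ' h1 h2 => hΓ.le_of_ge h1 h2
  have hno : ∀ n, NR α n ∧ NR β n := by
    intro n
    induction n with
    | zero => exact ⟨fun q _ _ h => absurd h (by omega), fun q _ _ h => absurd h (by omega)⟩
    | succ n ih =>
      have key : ∀ q : E[X], Irreducible q → 2 ≤ q.natDegree → q.natDegree = n → ∀ e,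
          q.eval e ≠ 0 := by
        intro q hq hd hn e he
        have : q.natDegree = 1 :=
          natDegree_eq_of_degree_eq_some (degree_eq_one_of_irreducible_of_root hq he)
        omega
      constructor
      · intro q hq hd hlt θ hθ
        rcases Nat.lt_succ_iff_lt_or_eq.1 hlt with h | h
        · exact ih.1 q hq hd h θ hθ
        · obtain ⟨θ', hθ', hs⟩ := ext_root hR hR' hα hβ q hq hd (h ▸ ih.1) (h ▸ ih.2) θ hθ
          obtain ⟨e, rfl, -⟩ := PI.ext_of_root Γ hE hmax q hq θ θ' hθ hθ' hs
          rw [eval₂_at_apply, map_eq_zero] at hθ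
          exact key q hq hd h e hθ
      · intro q hq hd hlt θ' hθ'
        rcases Nat.lt_succ_iff_lt_or_eq.1 hlt with h | h
        · exact ih.2 q hq hd h θ' hθ'
        · obtain ⟨θ, hθ, hs⟩ := ext_root hR' hR hβ hα q hq hd (h ▸ ih.2) (h ▸ ih.1) θ' hθ'
          obtain ⟨e, rfl, -⟩ := PI.ext_of_root Γ hE hmax q hq θ θ' hθ hθ' (fun G => (hs G).symm)
          rw [eval₂_at_apply, map_eq_zero] at hθ
          exact key q hq hd h e hθ
  have ea : ∀ P : k[X], ∀ y, P.eval₂ a y = (P.map κ).eval₂ α y := by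
    intro P y
    rw [eval₂_map]
    congr 1
    ext c
    exact congrArg Prod.fst (hκ c)
  have eb : ∀ P : k[X], ∀ y, P.eval₂ b y = (P.map κ).eval₂ β y := by
    intro P y
    rw [eval₂_map]
    congr 1
    ext c
    exact congrArg Prod.snd (hκ c)
  have fin : ∀ e : E, (∀ P ∈ S, SignType.sign ((P.map κ).eval₂ α y) =
      SignType.sign ((P.map κ).eval e)) →
      ∃ y' : R', ∀ P ∈ S, SignType.sign (P.eval₂ a y) = SignType.sign (P.eval₂ b y') := by
    intro e he
    refine ⟨β e, fun P hP => ?_⟩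
    rw [ea, eb, he P hP, sign_eval₂ hβ]
  by_cases hyE : ∃ e, α e = y
  · obtain ⟨e, rfl⟩ := hyE
    exact fin e (fun P hP => sign_eval₂ hα _ _)
  -- the finite set of roots
  let Z : Finset E := S.biUnion (fun P => (P.map κ).roots.toFinset)
  have hZ : ∀ P ∈ S, P ≠ 0 → ∀ w, (P.map κ).eval₂ α w = 0 → ∃ z ∈ Z, α z = w := by
    intro P hP hP0 w hw
    have hP1 : P.map κ ≠ 0 := (Polynomial.map_ne_zero_iff κ.injective).2 hP0
    obtain ⟨e, he, h2⟩ := (hno ((P.map κ).natDegree + 1)).1.root_in _ hP1 (by omega) w hw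
    exact ⟨e, Finset.mem_biUnion.2 ⟨P, hP, by simp [hP1, h2]⟩, he⟩
  have cell : ∀ e : E, (∀ z ∈ Z, α z < y → z < e) → (∀ z ∈ Z, y < α z → e < z) →
      ∃ y' : R', ∀ P ∈ S, SignType.sign (P.eval₂ a y) = SignType.sign (P.eval₂ b y') := by
    intro e h1 h2
    apply fin e
    intro P hP
    by_cases hP0 : P = 0
    · simp [hP0]
    rw [← sign_eval₂ hα, ← eval_map, ← eval_map]
    apply ivt_sign_eq hR
    intro c hc1 hc2 hc
    rw [eval_map] at hc
    obtain ⟨z, hz, rfl⟩ := hZ P hP hP0 c hc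
    rcases lt_trichotomy (α z) y with h | h | h
    · have := hα (h1 z hz h)
      rcases min_le_iff.1 hc1 with h3 | h3 <;> linarith
    · exact hyE ⟨z, h⟩
    · have := hα (h2 z hz h)
      rcases le_max_iff.1 hc2 with h3 | h3 <;> linarith
  let L := Z.filter (fun z => α z < y)
  let U := Z.filter (fun z => y < α z)
  rcases L.eq_empty_or_nonempty with hL | hL <;> rcases U.eq_empty_or_nonempty with hU | hU
  · refine cell 0 (fun z hz h => ?_) (fun z hz h => ?_)
    · exact absurd (Finset.mem_filter.2 ⟨hz, h⟩ : z ∈ L) (Finset.eq_empty_iff_forall_notMem.1 hL z)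
    · exact absurd (Finset.mem_filter.2 ⟨hz, h⟩ : z ∈ U) (Finset.eq_empty_iff_forall_notMem.1 hU z)
  · obtain ⟨m, hm, hmin⟩ := U.exists_min_image id hU
    refine cell (m - 1) (fun z hz h => ?_) (fun z hz h => ?_)
    · exact absurd (Finset.mem_filter.2 ⟨hz, h⟩ : z ∈ L) (Finset.eq_empty_iff_forall_notMem.1 hL z)
    · have := hmin z (Finset.mem_filter.2 ⟨hz, h⟩)
      simp only [id] at this
      linarith
  · obtain ⟨m, hm, hmax'⟩ := L.exists_max_image id hL
    refine cell (m + 1) (fun z hz h => ?_) (fun z hz h => ?_)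
    · have := hmax' z (Finset.mem_filter.2 ⟨hz, h⟩)
      simp only [id] at this
      linarith
    · exact absurd (Finset.mem_filter.2 ⟨hz, h⟩ : z ∈ U) (Finset.eq_empty_iff_forall_notMem.1 hU z)
  · obtain ⟨m, hm, hmax'⟩ := L.exists_max_image id hL
    obtain ⟨m', hm', hmin⟩ := U.exists_min_image id hU
    have hlt : m < m' := hα.lt_iff_lt.1
      ((Finset.mem_filter.1 hm).2.trans (Finset.mem_filter.1 hm').2)
    refine cell ((m + m') / 2) (fun z hz h => ?_) (fun z hz h => ?_)
    · have := hmax' z (Finset.mem_filter.2 ⟨hz, h⟩)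
      simp only [id] at this
      linarith
    · have := hmin z (Finset.mem_filter.2 ⟨hz, h⟩)
      simp only [id] at this
      linarith

end
end PS
end

section
set_option linter.all false

universe u v

namespace PS
open Polynomial

theorem ivt_real : IVT ℝ := by
  intro p a b hab h
  have hc : ContinuousOn (fun x => p.eval x) (Set.Icc a b) := p.continuous.continuousOn
  rcases mul_neg_iff.1 h with ⟨h1, h2⟩ | ⟨h1, h2⟩
  · obtain ⟨c, hc1, hc2⟩ := intermediate_value_Ioo' hab.le hc (⟨h2, h1⟩ : (0:ℝ) ∈ Set.Ioo _ _)
    exact ⟨c, hc1.1, hc1.2, hc2⟩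
  · obtain ⟨c, hc1, hc2⟩ := intermediate_value_Ioo hab.le hc (⟨h1, h2⟩ : (0:ℝ) ∈ Set.Ioo _ _)
    exact ⟨c, hc1.1, hc1.2, hc2⟩

section germ
variable {ι : Type} (U : Ultrafilter ι)

theorem germ_sign (f : ι → ℝ) : ∀ᶠ s in (U : Filter ι),
    SignType.sign (f s) = SignType.sign ((f : (U : Filter ι).Germ ℝ)) := by
  rcases lt_trichotomy ((f : (U : Filter ι).Germ ℝ)) 0 with h | h | h
  · rw [sign_neg h]
    have : ∀ᶠ s in (U : Filter ι), f s < 0 := Filter.Germ.coe_lt.1 h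
    filter_upwards [this] with s hs
    exact sign_neg hs
  · rw [h, sign_zero]
    have : ∀ᶠ s in (U : Filter ι), f s = 0 := Filter.Germ.coe_eq.1 h
    filter_upwards [this] with s hs
    rw [hs, sign_zero]
  · rw [sign_pos h]
    have : ∀ᶠ s in (U : Filter ι), 0 < f s := Filter.Germ.coe_lt.1 h
    filter_upwards [this] with s hs
    exact sign_pos hs

theorem germ_sum {κ : Type} (t : Finset κ) (f : κ → ι → ℝ) :
    ((fun s => ∑ i ∈ t, f i s : ι → ℝ) : (U : Filter ι).Germ ℝ) = ∑ i ∈ t, (f i : (U : Filter ι).Germ ℝ) := by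
  classical
  induction t using Finset.induction_on with
  | empty => simp; rfl
  | insert a t ha ih =>
    simp only [Finset.sum_insert ha]
    rw [← ih]; rfl

theorem germ_ivt : IVT ((U : Filter ι).Germ ℝ) := by
  intro p a b hab h
  have hC : ∀ i, ∃ C : ι → ℝ, (C : (U : Filter ι).Germ ℝ) = p.coeff i := fun i =>
    Quotient.exists_rep (p.coeff i)
  choose C hC using hC
  have hev : ∀ z : ι → ℝ, p.eval (z : (U : Filter ι).Germ ℝ) =
      ((fun s => (∑ i ∈ Finset.range (p.natDegree + 1), monomial i (C i s)).eval (z s) : ι → ℝ) :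
        (U : Filter ι).Germ ℝ) := by
    intro z
    rw [eval_eq_sum_range]
    simp only [eval_finset_sum, eval_monomial]
    rw [germ_sum U (Finset.range (p.natDegree + 1)) (fun i s => C i s * z s ^ i)]
    refine Finset.sum_congr rfl fun i _ => ?_
    rw [← hC]; rfl
  obtain ⟨a, rfl⟩ := Quotient.exists_rep a
  obtain ⟨b, rfl⟩ := Quotient.exists_rep b
  change p.eval (a : (U : Filter ι).Germ ℝ) * p.eval (b : (U : Filter ι).Germ ℝ) < 0 at h
  have hab' : ∀ᶠ s in (U : Filter ι), a s < b s := Filter.Germ.coe_lt.1 hab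
  rw [hev, hev] at h
  have h' := Filter.Germ.coe_lt.1 (h : (((fun s => _ * _ : ι → ℝ) : (U : Filter ι).Germ ℝ)) <
    ((fun s => 0 : ι → ℝ) : (U : Filter ι).Germ ℝ))
  have h3 : ∀ᶠ s in (U : Filter ι), ∃ c, a s < c ∧ c < b s ∧
      (∑ i ∈ Finset.range (p.natDegree + 1), monomial i (C i s)).eval c = 0 := by
    filter_upwards [hab', h'] with s h1 h2
    exact ivt_real _ _ _ h1 h2
  classical
  let c : ι → ℝ := fun s => if h : ∃ c, a s < c ∧ c < b s ∧
      (∑ i ∈ Finset.range (p.natDegree + 1), monomial i (C i s)).eval c = 0 then h.choose else 0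
  have hc : ∀ᶠ s in (U : Filter ι), a s < c s ∧ c s < b s ∧
      (∑ i ∈ Finset.range (p.natDegree + 1), monomial i (C i s)).eval (c s) = 0 := by
    filter_upwards [h3] with s hs
    simp only [c]
    rw [dif_pos hs]
    exact hs.choose_spec
  refine ⟨(c : (U : Filter ι).Germ ℝ), Filter.Germ.coe_lt.2 (hc.mono fun s h => h.1),
    Filter.Germ.coe_lt.2 (hc.mono fun s h => h.2.1), ?_⟩
  rw [hev]
  exact Filter.Germ.coe_eq.2 (hc.mono fun s h => h.2.2)

/-- constants -/
def gconst : ℝ →+* (U : Filter ι).Germ ℝ where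
  toFun r := ((fun _ => r : ι → ℝ) : (U : Filter ι).Germ ℝ)
  map_one' := rfl
  map_zero' := rfl
  map_mul' _ _ := rfl
  map_add' _ _ := rfl

theorem gconst_eval (x : ι → ℝ) (p : ℝ[X]) : p.eval₂ (gconst U) (x : (U : Filter ι).Germ ℝ) =
    ((fun s => p.eval (x s) : ι → ℝ) : (U : Filter ι).Germ ℝ) := by
  simp only [eval_eq_sum_range]
  rw [eval₂_eq_sum_range, germ_sum U _ (fun i s => p.coeff i * x s ^ i)]
  rfl

theorem gconst_mv (x : Fin 2 → ι → ℝ) (p : MvPolynomial (Fin 2) ℝ) :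
    MvPolynomial.eval₂ (gconst U) (fun i => (x i : (U : Filter ι).Germ ℝ)) p =
    ((fun s => MvPolynomial.eval (fun i => x i s) p : ι → ℝ) : (U : Filter ι).Germ ℝ) := by
  induction p using MvPolynomial.induction_on with
  | C a => simp; rfl
  | add p q hp hq => simp only [MvPolynomial.eval₂_add, hp, hq, map_add]; rfl
  | mul_X p i hp => simp only [MvPolynomial.eval₂_mul, MvPolynomial.eval₂_X, hp, map_mul, MvPolynomial.eval_X]; rfl

end germ

theorem real_strictMono {R : Type u} [Field R] [LinearOrder R] [IsStrictOrderedRing R]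
    (c : ℝ →+* R) : StrictMono c := by
  intro a b h
  have h1 : 0 ≤ c (b - a) := by
    rw [← Real.mul_self_sqrt (sub_nonneg.2 h.le), map_mul]
    exact mul_self_nonneg _
  have h2 : c (b - a) ≠ 0 := by
    rw [Ne, map_eq_zero]
    linarith
  have h3 := lt_of_le_of_ne h1 h2.symm
  rw [map_sub] at h3
  linarith

theorem strictMono_of_nonneg {F : Type u} [Field F] [LinearOrder F] [IsStrictOrderedRing F]
    {R : Type v} [Field R] [LinearOrder R] [IsStrictOrderedRing R]
    (c : F →+* R) (hc : ∀ x, 0 ≤ x → 0 ≤ c x) : StrictMono c := by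
  intro a b h
  have h1 : 0 ≤ c (b - a) := hc _ (sub_nonneg.2 h.le)
  have h2 : c (b - a) ≠ 0 := by
    rw [Ne, map_eq_zero]
    linarith
  have h3 := lt_of_le_of_ne h1 h2.symm
  rw [map_sub] at h3
  linarith

/-- one variable -/
theorem artin_lang_one {R : Type} [Field R] [LinearOrder R] [IsStrictOrderedRing R] (hR : IVT R)
    (c : ℝ →+* R) (x : R) (S : Finset ℝ[X]) :
    ∃ r : ℝ, ∀ p ∈ S, SignType.sign (p.eval₂ c x) = SignType.sign (p.eval r) := by
  obtain ⟨r, hr⟩ := transfer hR ivt_real c (RingHom.id ℝ) (real_strictMono c) (fun _ _ h => h) S x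
  exact ⟨r, fun p hp => hr p hp⟩

theorem exists_common {D : Type} [CommRing D] [IsDomain D]
    {R : Type} [Field R] [LinearOrder R] [IsStrictOrderedRing R]
    {R' : Type} [Field R'] [LinearOrder R'] [IsStrictOrderedRing R']
    (α0 : D →+* R) (β0 : D →+* R') (hα0 : Function.Injective α0) (hβ0 : Function.Injective β0)
    (hs0 : ∀ d, SignType.sign (α0 d) = SignType.sign (β0 d)) :
    ∃ (k : Type) (_ : Field k) (_ : LinearOrder k) (_ : IsStrictOrderedRing k) (α : k →+* R)
      (β : k →+* R') (j : D →+* k), StrictMono α ∧ StrictMono β ∧ (∀ d, α (j d) = α0 d) ∧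
      ∀ d, β (j d) = β0 d := by
  obtain ⟨k, _, _, _⟩ : ∃ (k : Type) (_ : Field k) (_ : Algebra D k), IsFractionRing D k :=
    ⟨FractionRing D, inferInstance, inferInstance, inferInstance⟩
  let α : k →+* R := IsFractionRing.lift hα0
  let β : k →+* R' := IsFractionRing.lift hβ0
  have hαd : ∀ d, α (algebraMap D k d) = α0 d := fun d => IsFractionRing.lift_algebraMap hα0 d
  have hβd : ∀ d, β (algebraMap D k d) = β0 d := fun d => IsFractionRing.lift_algebraMap hβ0 d
  have hs1 : ∀ e, SignType.sign (α e) = SignType.sign (β e) := by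
    intro e
    obtain ⟨a, b, hb, rfl⟩ := IsFractionRing.div_surjective (A := D) e
    have key : ∀ {L : Type} [Field L] [LinearOrder L] [IsStrictOrderedRing L] (u v : L), v ≠ 0 →
        SignType.sign (u / v) = SignType.sign u * SignType.sign v := by
      intro L _ _ _ u v hv
      rw [← sign_mul]
      have : u * v = (u / v) * (v * v) := by field_simp
      rw [this, sign_mul, sign_pos (mul_self_pos.2 hv), mul_one]
    have hb0 : b ≠ 0 := nonZeroDivisors.ne_zero hb
    rw [map_div₀ α, map_div₀ β, hαd, hαd, hβd, hβd, key, key, hs0, hs0]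
    · exact fun h => hb0 ((injective_iff_map_eq_zero β0).1 hβ0 b h)
    · exact fun h => hb0 ((injective_iff_map_eq_zero α0).1 hα0 b h)
  obtain ⟨lo, so, hα, hβ⟩ := order_of_maps α β hs1
  exact ⟨k, inferInstance, lo, so, α, β, algebraMap D k, hα, hβ, hαd, hβd⟩

theorem artin_lang_two {R : Type} [Field R] [LinearOrder R] [IsStrictOrderedRing R] (hR : IVT R)
    (ρ : MvPolynomial (Fin 2) ℝ →+* R) (S : Finset (MvPolynomial (Fin 2) ℝ)) :
    ∃ q : Fin 2 → ℝ, ∀ P ∈ S, SignType.sign (MvPolynomial.eval q P) = SignType.sign (ρ P) := by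
  classical
  let c : ℝ →+* R := ρ.comp MvPolynomial.C
  choose x0 hx0 using artin_lang_one hR c (ρ (MvPolynomial.X 0))
  let U : Ultrafilter (Finset ℝ[X]) := Ultrafilter.of Filter.atTop
  have hU : (U : Filter (Finset ℝ[X])) ≤ Filter.atTop := Ultrafilter.of_le _
  let ψ : ℝ[X] →+* R := eval₂RingHom c (ρ (MvPolynomial.X 0))
  let ψ' : ℝ[X] →+* (U : Filter (Finset ℝ[X])).Germ ℝ := eval₂RingHom (gconst U) (x0 : (U : Filter (Finset ℝ[X])).Germ ℝ)
  have hs : ∀ p, SignType.sign (ψ p) = SignType.sign (ψ' p) := by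
    intro p
    have h1 : ∀ᶠ s in (U : Filter (Finset ℝ[X])), p ∈ s :=
      hU (Filter.mem_of_superset (Filter.mem_atTop {p}) fun s hs => hs (by simp))
    have h2 := germ_sign U (fun s => p.eval (x0 s))
    rw [← gconst_eval] at h2
    obtain ⟨s, h3, h4⟩ := (h1.and h2).exists
    exact (hx0 s p h3).trans h4
  let α0 : (ℝ[X] ⧸ RingHom.ker ψ) →+* R := RingHom.kerLift ψ
  let β0 : (ℝ[X] ⧸ RingHom.ker ψ) →+* (U : Filter (Finset ℝ[X])).Germ ℝ := Ideal.Quotient.lift _ ψ' (by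
    intro a ha
    have h1 : ψ a = 0 := ha
    have := hs a
    rw [h1, sign_zero] at this
    exact sign_eq_zero_iff.1 this.symm)
  have hα0 : Function.Injective α0 := RingHom.kerLift_injective ψ
  have hs0 : ∀ d, SignType.sign (α0 d) = SignType.sign (β0 d) := by
    intro d
    obtain ⟨p, rfl⟩ := Ideal.Quotient.mk_surjective d
    exact hs p
  have hβ0 : Function.Injective β0 := by
    rw [injective_iff_map_eq_zero]
    intro d hd
    have := hs0 d
    rw [hd, sign_zero] at this
    exact (injective_iff_map_eq_zero α0).1 hα0 d (sign_eq_zero_iff.1 this)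
  haveI : (RingHom.ker ψ).IsPrime := RingHom.ker_isPrime ψ
  obtain ⟨k, _, _, _, α, β, j0, hα, hβ, hαd, hβd⟩ := exists_common α0 β0 hα0 hβ0 hs0
  let j : ℝ[X] →+* k := j0.comp (Ideal.Quotient.mk _)
  let hat : MvPolynomial (Fin 2) ℝ →+* k[X] :=
    MvPolynomial.eval₂Hom (Polynomial.C.comp (j.comp Polynomial.C)) ![Polynomial.C (j Polynomial.X), Polynomial.X]
  have hαj : ∀ p, α (j p) = ψ p := fun p => hαd _
  have hβj : ∀ p, β (j p) = ψ' p := fun p => hβd _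
  obtain ⟨y', hy'⟩ := transfer hR (germ_ivt U) α β hα hβ (S.image hat) (ρ (MvPolynomial.X 1))
  obtain ⟨y0, rfl⟩ := Quotient.exists_rep y'
  have e1 : ∀ P, (hat P).eval₂ α (ρ (MvPolynomial.X 1)) = ρ P := by
    intro P
    have : (eval₂RingHom α (ρ (MvPolynomial.X 1))).comp hat = ρ := by
      apply MvPolynomial.ringHom_ext
      · intro r
        simp [hat, hαj, ψ, c]
      · intro i
        fin_cases i <;> simp [hat, hαj, ψ, c]
    exact congrArg (fun f => f P) this
  have e2 : ∀ P, (hat P).eval₂ β (y0 : (U : Filter (Finset ℝ[X])).Germ ℝ) =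
      ((fun s => MvPolynomial.eval ![x0 s, y0 s] P : _ → ℝ) : (U : Filter (Finset ℝ[X])).Germ ℝ) := by
    intro P
    have : (eval₂RingHom β (y0 : (U : Filter (Finset ℝ[X])).Germ ℝ)).comp hat =
        MvPolynomial.eval₂Hom (gconst U) (fun i => ((![x0, y0] i : _ → ℝ) : (U : Filter (Finset ℝ[X])).Germ ℝ)) := by
      apply MvPolynomial.ringHom_ext
      · intro r
        simp [hat, hβj, ψ', c]
      · intro i
        fin_cases i <;> simp [hat, hβj, ψ', c]
    have h2 := congrArg (fun f => f P) this
    refine h2.trans ((gconst_mv U ![x0, y0] P).trans ?_)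
    congr 1
    funext s
    congr 2
    funext i
    fin_cases i <;> rfl
  have h5 : ∀ᶠ s in (U : Filter (Finset ℝ[X])), ∀ P ∈ S,
      SignType.sign (MvPolynomial.eval ![x0 s, y0 s] P) = SignType.sign (ρ P) := by
    rw [Filter.eventually_all_finset]
    intro P hP
    filter_upwards [germ_sign U (fun s => MvPolynomial.eval ![x0 s, y0 s] P)] with s hs
    rw [hs, ← e2, ← e1]
    exact (hy' (hat P) (Finset.mem_image_of_mem _ hP)).symm
  obtain ⟨s, hs⟩ := h5.exists
  exact ⟨_, hs⟩

theorem artin_lang {F : Type} [Field F] [LinearOrder F] [IsStrictOrderedRing F]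
    (θ : MvPolynomial (Fin 2) ℝ →+* F) (S : Finset (MvPolynomial (Fin 2) ℝ)) :
    ∃ q : Fin 2 → ℝ, ∀ P ∈ S, SignType.sign (MvPolynomial.eval q P) = SignType.sign (θ P) := by
  obtain ⟨R, _, _, _, φ, hR, hφ⟩ := exists_ivt F
  obtain ⟨q, hq⟩ := artin_lang_two hR (φ.comp θ) S
  refine ⟨q, fun P hP => (hq P hP).trans ?_⟩
  exact sign_map (strictMono_of_nonneg φ hφ) _

end PS
end

section
set_option linter.all false

universe u v

namespace PS
open Polynomial

/-- the polynomial ring -/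
abbrev A2 := MvPolynomial (Fin 2) ℝ

/-- constants -/
noncomputable abbrev cc (r : ℝ) : A2 := MvPolynomial.C r

/-- evaluation -/
noncomputable abbrev ev (q : Fin 2 → ℝ) (f : A2) : ℝ := MvPolynomial.eval q f

theorem ev_cc (q : Fin 2 → ℝ) (r : ℝ) : ev q (cc r) = r := MvPolynomial.eval_C r

/-- the preordering -/
noncomputable def TT {s : ℕ} (g : Fin s → A2) : Subsemiring A2 :=
  Subsemiring.closure (Set.range g ∪ {a | ∃ b, a = b ^ 2})

/-- the set -/
def KK {s : ℕ} (g : Fin s → A2) : Set (Fin 2 → ℝ) := {p | ∀ i, 0 ≤ ev p (g i)}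

theorem cc_mem {T : Subsemiring A2} (hT : IsPre T) {r : ℝ} (hr : 0 ≤ r) : cc r ∈ T := by
  have := hT (cc (Real.sqrt r))
  rwa [cc, ← map_pow, Real.sq_sqrt hr] at this

theorem ev_continuous (f : A2) : Continuous (fun q => ev q f) := MvPolynomial.continuous_eval f

section arch
variable {T : Subsemiring A2}

/-- bounded elements form a subring -/
theorem arch_of_ball (hT : IsPre T) (M : ℝ)
    (hM : cc M - MvPolynomial.X 0 ^ 2 - MvPolynomial.X 1 ^ 2 ∈ T) :
    ∀ f : A2, ∃ n : ℝ, 0 < n ∧ cc n - f ∈ T ∧ cc n + f ∈ T := by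
  intro f
  induction f using MvPolynomial.induction_on with
  | C a =>
    refine ⟨|a| + 1, by positivity, ?_, ?_⟩
    · change cc _ - cc a ∈ T
      rw [cc, cc, ← map_sub]
      exact cc_mem hT (by linarith [le_abs_self a])
    · change cc _ + cc a ∈ T
      rw [cc, cc, ← map_add]
      exact cc_mem hT (by linarith [neg_abs_le a])
  | add p q hp hq =>
    obtain ⟨n, hn, h1, h2⟩ := hp
    obtain ⟨m, hm, h3, h4⟩ := hq
    refine ⟨n + m, by positivity, ?_, ?_⟩
    · have := T.add_mem h1 h3
      rw [cc, map_add]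
      convert this using 1; ring
    · have := T.add_mem h2 h4
      rw [cc, map_add]
      convert this using 1; ring
  | mul_X p i hp =>
    obtain ⟨n, hn, h1, h2⟩ := hp
    obtain ⟨m, hm, h3, h4⟩ : ∃ m : ℝ, 0 < m ∧ cc m - MvPolynomial.X i ∈ T ∧
        cc m + MvPolynomial.X i ∈ T := by
      refine ⟨|M| + 1/4, by positivity, ?_⟩
      have hc : cc (|M| - M) ∈ T := cc_mem hT (by linarith [le_abs_self M])
      have h0 : cc (1/4) = cc (1/2) ^ 2 := by
        rw [cc, cc, ← map_pow]; norm_num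
      have h00 : cc (1/2) + cc (1/2) = 1 := by
        rw [cc, ← map_add, ← map_one MvPolynomial.C]; norm_num
      have hcm : cc (|M| + 1/4) = cc (|M| - M) + cc M + cc (1/2)^2 := by
        rw [← h0, cc, cc, cc, cc, ← map_add, ← map_add]
        congr 1; ring
      rw [hcm]
      constructor
      · have h5 := T.add_mem (T.add_mem hc hM) (T.add_mem (hT (MvPolynomial.X i - cc (1/2)))
          (hT (MvPolynomial.X (1 - i))))
        convert h5 using 1
        fin_cases i
        · simp only [Fin.zero_eta, sub_zero]
          linear_combination (MvPolynomial.X 0) * h00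
        · simp only [Fin.mk_one, sub_self]
          linear_combination (MvPolynomial.X 1) * h00
      · have h5 := T.add_mem (T.add_mem hc hM) (T.add_mem (hT (MvPolynomial.X i + cc (1/2)))
          (hT (MvPolynomial.X (1 - i))))
        convert h5 using 1
        fin_cases i
        · simp only [Fin.zero_eta, sub_zero]
          linear_combination (MvPolynomial.X 0) * (-h00)
        · simp only [Fin.mk_one, sub_self]
          linear_combination (MvPolynomial.X 1) * (-h00)
    have hh : cc (1/2) ∈ T := cc_mem hT (by norm_num)
    have h00 : cc (1/2) + cc (1/2) = 1 := by
      rw [cc, ← map_add, ← map_one MvPolynomial.C]; norm_num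
    refine ⟨n * m, by positivity, ?_, ?_⟩
    · have := T.mul_mem hh (T.add_mem (T.mul_mem h1 h4) (T.mul_mem h2 h3))
      rw [cc, map_mul]
      convert this using 1
      linear_combination (cc n * cc m - p * MvPolynomial.X i) * (-h00)
    · have := T.mul_mem hh (T.add_mem (T.mul_mem h1 h3) (T.mul_mem h2 h4))
      rw [cc, map_mul]
      convert this using 1
      linear_combination (cc n * cc m + p * MvPolynomial.X i) * (-h00)

/-- archimedean -/
def Arch (T : Subsemiring A2) : Prop := ∀ f : A2, ∃ n : ℝ, 0 < n ∧ cc n - f ∈ T ∧ cc n + f ∈ T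

theorem arch_of_pst (hT : IsPre T) (N : ℝ) (hN : 0 ≤ N) (t q : A2) (ht : t ∈ T) (hq : q ∈ T)
    (h : (cc N - MvPolynomial.X 0 ^ 2 - MvPolynomial.X 1 ^ 2) * t = 1 + q) : Arch T := by
  set k : A2 := cc N - MvPolynomial.X 0 ^ 2 - MvPolynomial.X 1 ^ 2 with hk
  have h1 : (1 + q) * k ∈ T := by
    rw [← h, show k * t * k = k ^ 2 * t by ring]
    exact T.mul_mem (hT k) ht
  let S0 : Subsemiring A2 := Subsemiring.closure {a | ∃ b, a = b ^ 2}
  have hS0 : IsPre S0 := fun a => Subsemiring.subset_closure ⟨a, rfl⟩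
  have hST : S0 ≤ T := Subsemiring.closure_le.2 (by rintro _ ⟨b, rfl⟩; exact hT b)
  obtain ⟨s, hs, h2, -⟩ := arch_of_ball (isPre_adj hS0 k) N (self_mem_adj hS0 k) q
  obtain ⟨s0, hs0, s1, hs1, h3⟩ := (mem_adj hS0 k).1 h2
  have h4 : (1 + q) * (cc s - q) ∈ T := by
    rw [h3, show (1 + q) * (s0 + k * s1) = (1 + q) * s0 + (1 + q) * k * s1 by ring]
    exact T.add_mem (T.mul_mem (T.add_mem T.one_mem hq) (hST hs0)) (T.mul_mem h1 (hST hs1))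
  have h5 := T.add_mem h4 (hT (q - cc (s/2)))
  have h6 := T.add_mem (T.add_mem h1 (T.mul_mem (cc_mem hT hN) h5))
    (T.mul_mem hq (T.add_mem (hT (MvPolynomial.X 0)) (hT (MvPolynomial.X 1))))
  refine arch_of_ball hT (N * (s/2+1)^2) ?_
  have hss : cc s = cc (s/2) + cc (s/2) := by
    rw [cc, cc, ← map_add]; congr 1; ring
  convert h6 using 1
  rw [hk, hss]
  simp only [cc, map_mul, map_pow, map_add, map_one]
  ring

theorem schmudgen_step (hT : IsPre T) (hA : Arch T) (f p q : A2) (hp : p ∈ T) (hq : q ∈ T)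
    (h : f * p = 1 + q) : f ∈ T := by
  obtain ⟨n, hn, h1, -⟩ := hA p
  obtain ⟨k0, hk0, -, h2⟩ := hA f
  have step : ∀ k : ℝ, 0 ≤ k → f + cc k ∈ T → f + cc (k - 1/n) ∈ T := by
    intro k hk hfk
    have h3 := T.add_mem (T.add_mem (T.mul_mem h1 hfk) hq) (T.mul_mem hp (cc_mem hT hk))
    have h4 := T.mul_mem (cc_mem hT (one_div_pos.2 hn).le) h3
    have h5 : cc (1/n) * cc n = 1 := by
      rw [cc, ← map_mul, one_div_mul_cancel hn.ne', map_one]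
    convert h4 using 1
    rw [cc, map_sub]
    linear_combination (-f - cc k) * h5 + cc (1/n) * h
  have all : ∀ j : ℕ, f + cc (max (k0 - j / n) 0) ∈ T := by
    intro j
    induction j with
    | zero => simpa [max_eq_left hk0.le, add_comm] using h2
    | succ j ih =>
      have h3 := step _ (le_max_right _ _) ih
      have h4 := T.add_mem h3 (cc_mem hT (r := max (k0 - (j+1 : ℕ) / n) 0 - (max (k0 - j / n) 0 - 1/n)) (by
        rcases max_cases (k0 - j / n) 0 with h | h
        · rw [h.1]
          have := le_max_left (k0 - ((j+1 : ℕ) : ℝ) / n) 0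
          push_cast at this ⊢
          rw [add_div] at this ⊢
          linarith
        · rw [h.1]
          have := le_max_right (k0 - ((j+1 : ℕ) : ℝ) / n) 0
          have := one_div_pos.2 hn
          linarith))
      convert h4 using 1
      rw [add_assoc, cc, cc, cc, ← map_add]
      congr 2; ring
  obtain ⟨j, hj⟩ := exists_nat_gt (k0 * n)
  have := all j
  rw [max_eq_right] at this
  · simpa [cc] using this
  · have : k0 ≤ j / n := (le_div_iff₀ hn).2 hj.le
    linarith

end arch

section main
variable {s : ℕ} (g : Fin s → A2)

theorem TT_pre : IsPre (TT g) := fun a => Subsemiring.subset_closure (Or.inr ⟨a, rfl⟩)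

theorem g_mem (i) : g i ∈ TT g := Subsemiring.subset_closure (Or.inl ⟨i, rfl⟩)

theorem TT_nonneg {f : A2} (hf : f ∈ TT g) {q} (hq : q ∈ KK g) : 0 ≤ ev q f := by
  induction hf using Subsemiring.closure_induction with
  | mem x hx =>
    rcases hx with ⟨i, rfl⟩ | ⟨b, rfl⟩
    · exact hq i
    · rw [ev, map_pow]; positivity
  | zero => simp
  | one => simp
  | add a b _ _ h1 h2 => rw [ev, map_add]; exact add_nonneg h1 h2
  | mul a b _ _ h1 h2 => rw [ev, map_mul]; exact mul_nonneg h1 h2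

theorem TT_nonneg_hom {F : Type} [Field F] [LinearOrder F] [IsStrictOrderedRing F] (θ : A2 →+* F)
    (hθ : ∀ i, 0 ≤ θ (g i)) {f : A2} (hf : f ∈ TT g) : 0 ≤ θ f := by
  induction hf using Subsemiring.closure_induction with
  | mem x hx =>
    rcases hx with ⟨i, rfl⟩ | ⟨b, rfl⟩
    · exact hθ i
    · rw [map_pow]; positivity
  | zero => simp
  | one => simp
  | add a b _ _ h1 h2 => rw [map_add]; exact add_nonneg h1 h2
  | mul a b _ _ h1 h2 => rw [map_mul]; exact mul_nonneg h1 h2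

theorem sign_eq_nonneg {F F' : Type*} [Zero F] [LinearOrder F] [Zero F'] [LinearOrder F'] {a : F} {b : F'}
    (h : SignType.sign a = SignType.sign b) (hb : 0 ≤ b) : 0 ≤ a := by
  rw [← sign_nonneg_iff, h, sign_nonneg_iff]; exact hb

theorem sign_eq_pos {F F' : Type*} [Zero F] [LinearOrder F] [Zero F'] [LinearOrder F'] {a : F} {b : F'}
    (h : SignType.sign a = SignType.sign b) (hb : 0 < b) : 0 < a := by
  rw [← sign_eq_one_iff, h, sign_eq_one_iff]; exact hb

theorem sign_eq_zero' {F F' : Type*} [Zero F] [LinearOrder F] [Zero F'] [LinearOrder F'] {a : F} {b : F'}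
    (h : SignType.sign a = SignType.sign b) (hb : b = 0) : a = 0 := by
  rw [← sign_eq_zero_iff, h, sign_eq_zero_iff]; exact hb

theorem pst_K (f : A2) (hf : ∀ q ∈ KK g, 0 < ev q f) : ∃ t ∈ TT g, ∃ q ∈ TT g, f * t = 1 + q := by
  classical
  apply pst_pos (TT g) (TT_pre g) f
  intro F _ _ _ θ hθ
  obtain ⟨q, hq⟩ := artin_lang θ (insert f (Finset.univ.image g))
  refine sign_eq_pos (hq f (by simp)).symm (hf q fun i => ?_)
  exact sign_eq_nonneg (hq (g i) (by simp)) (hθ _ (g_mem g i))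

theorem arch_TT (hK : IsCompact (KK g)) : Arch (TT g) := by
  obtain ⟨N, hN⟩ := hK.bddAbove_image (f := fun q : Fin 2 → ℝ => q 0 ^ 2 + q 1 ^ 2)
    (by fun_prop)
  obtain ⟨t, ht, q, hq, h⟩ := pst_K g (cc (|N| + 1) - MvPolynomial.X 0 ^ 2 - MvPolynomial.X 1 ^ 2) (by
    intro q hq
    have : q 0 ^ 2 + q 1 ^ 2 ≤ N := hN ⟨q, hq, rfl⟩
    simp only [ev, cc, map_sub, MvPolynomial.eval_C, map_pow, MvPolynomial.eval_X]
    linarith [le_abs_self N])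
  exact arch_of_pst (TT_pre g) _ (by positivity) t q ht hq h

theorem schmudgen (hK : IsCompact (KK g)) (f : A2) (hf : ∀ q ∈ KK g, 0 < ev q f) : f ∈ TT g := by
  obtain ⟨t, ht, q, hq, h⟩ := pst_K g f hf
  exact schmudgen_step (TT_pre g) (arch_TT g hK) f t q ht hq h

theorem lojasiewicz (hK : IsCompact (KK g)) (f d : A2) (hf : ∀ q ∈ KK g, 0 ≤ ev q f)
    (hfd : ∀ q ∈ KK g, ev q f = 0 → ev q d = 0) :
    ∃ m : ℕ, ∃ c : ℝ, 0 < c ∧ ∀ q ∈ KK g, c * ev q d ^ (2 * m) ≤ ev q f := by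
  classical
  by_cases hd : d = 0
  · refine ⟨1, 1, one_pos, fun q hq => ?_⟩
    simp [hd]; exact hf q hq
  let L := Localization.Away d
  let a : A2 →+* L := algebraMap A2 L
  have hinj : Function.Injective a := IsLocalization.injective L (powers_le_nonZeroDivisors_of_noZeroDivisors hd)
  have hu : IsUnit (a d) := IsLocalization.Away.algebraMap_isUnit d
  let TL : Subsemiring L :=
    { carrier := {z | ∃ t ∈ TT g, ∃ h : A2, ∃ m : ℕ, z * (a d) ^ (2 * m) = a (t + f * h)}
      zero_mem' := ⟨0, zero_mem _, 0, 0, by simp⟩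
      one_mem' := ⟨1, one_mem _, 0, 0, by simp⟩
      add_mem' := by
        rintro z w ⟨t, ht, h, m, e⟩ ⟨t', ht', h', m', e'⟩
        have hdd : ∀ m : ℕ, d ^ (2 * m) ∈ TT g := fun m => by
          rw [mul_comm, pow_mul]; exact TT_pre g _
        refine ⟨t * d ^ (2 * m') + t' * d ^ (2 * m), add_mem (mul_mem ht (hdd _)) (mul_mem ht' (hdd _)),
          h * d ^ (2 * m') + h' * d ^ (2 * m), m + m', ?_⟩
        have : t * d ^ (2 * m') + t' * d ^ (2 * m) + f * (h * d ^ (2 * m') + h' * d ^ (2 * m)) =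
          (t + f * h) * d ^ (2 * m') + (t' + f * h') * d ^ (2 * m) := by ring
        rw [this, map_add, map_mul, map_mul, ← e, ← e', map_pow, map_pow]
        ring
      mul_mem' := by
        rintro z w ⟨t, ht, h, m, e⟩ ⟨t', ht', h', m', e'⟩
        refine ⟨t * t', mul_mem ht ht', t * h' + h * t' + f * h * h', m + m', ?_⟩
        have : t * t' + f * (t * h' + h * t' + f * h * h') = (t + f * h) * (t' + f * h') := by ring
        rw [this, map_mul, ← e, ← e']
        ring }
  have hTL : IsPre TL := by
    intro z
    obtain ⟨⟨b, ⟨_, m, rfl⟩⟩, hb⟩ := IsLocalization.surj (Submonoid.powers d) z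
    refine ⟨b ^ 2, TT_pre g b, 0, m, ?_⟩
    rw [mul_zero, add_zero, map_pow, ← hb]
    simp only [a, map_pow]
    ring
  by_cases h1 : (-1 : L) ∈ TL
  · obtain ⟨t, ht, h, m, e⟩ := h1
    have e' : f * (-h) = d ^ (2 * m) + t := by
      apply hinj
      rw [map_add, map_mul, map_neg, map_pow]
      rw [map_add, map_mul] at e
      linear_combination e
    obtain ⟨C, hC⟩ := hK.bddAbove_image (f := fun q => ev q (-h)) (ev_continuous _).continuousOn
    refine ⟨m, (|C| + 1)⁻¹, by positivity, fun q hq => ?_⟩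
    have h2 : ev q (-h) ≤ C := hC ⟨q, hq, rfl⟩
    have h3 := congrArg (ev q) e'
    simp only [ev, map_mul, map_add, map_pow] at h3 h2 ⊢
    have h4 : 0 ≤ MvPolynomial.eval q t := TT_nonneg g ht hq
    have h5 : 0 ≤ MvPolynomial.eval q f := hf q hq
    rw [inv_mul_le_iff₀ (by positivity)]
    have h6 : MvPolynomial.eval q f * MvPolynomial.eval q (-h) ≤ MvPolynomial.eval q f * (|C| + 1) :=
      mul_le_mul_of_nonneg_left (by linarith [le_abs_self C]) h5
    linarith
  · exfalso
    obtain ⟨F, _, _, _, θ, hθ⟩ := exists_ordering TL hTL h1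
    obtain ⟨q, hq⟩ := artin_lang (θ.comp a) (insert f (insert d (Finset.univ.image g)))
    have hqK : q ∈ KK g := by
      intro i
      refine sign_eq_nonneg (hq (g i) (by simp)) (hθ _ ⟨g i, g_mem g i, 0, 0, by simp⟩)
    have hf0 : θ (a f) = 0 := by
      have h2 := hθ (a f) ⟨0, zero_mem _, 1, 0, by simp⟩
      have h3 := hθ (-a f) ⟨0, zero_mem _, -1, 0, by simp⟩
      rw [map_neg] at h3
      linarith
    have h4 := hfd q hqK (sign_eq_zero' (hq f (by simp)) hf0)
    have h5 : θ (a d) = 0 := sign_eq_zero' (hq d (by simp)).symm h4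
    exact (hu.map θ).ne_zero h5

end main
end PS
end

section
set_option linter.all false

namespace PS
open Polynomial

theorem cc_inv_mul {r : ℝ} (hr : r ≠ 0) : cc r⁻¹ * cc r = 1 := by
  rw [cc, ← map_mul, inv_mul_cancel₀ hr, map_one]

theorem half_add : cc (1/2) + cc (1/2) = 1 := by
  rw [cc, ← map_add, ← map_one MvPolynomial.C]; norm_num

/-- elements dominated by `d` -/
def WW {T : Subsemiring A2} (hT : IsPre T) (hA : Arch T) (d : A2) (hd : d ∈ T) : Ideal A2 where
  carrier := {w | ∃ l : ℝ, 0 < l ∧ cc l * d + w ∈ T ∧ cc l * d - w ∈ T}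
  zero_mem' := ⟨1, one_pos, by simpa [cc] using hd, by simpa [cc] using hd⟩
  add_mem' := by
    rintro a b ⟨l, hl, h1, h2⟩ ⟨m, hm, h3, h4⟩
    refine ⟨l + m, by positivity, ?_, ?_⟩
    · convert T.add_mem h1 h3 using 1
      rw [cc, map_add]; ring
    · convert T.add_mem h2 h4 using 1
      rw [cc, map_add]; ring
  smul_mem' := by
    rintro b w ⟨l, hl, h1, h2⟩
    obtain ⟨n, hn, h3, h4⟩ := hA b
    have hh : cc (1/2) ∈ T := cc_mem hT (by norm_num)
    refine ⟨l * n, by positivity, ?_, ?_⟩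
    · convert T.mul_mem hh (T.add_mem (T.mul_mem h1 h4) (T.mul_mem h2 h3)) using 1
      rw [cc, map_mul, smul_eq_mul]
      linear_combination (cc l * cc n * d + b * w) * (-half_add)
    · convert T.mul_mem hh (T.add_mem (T.mul_mem h1 h3) (T.mul_mem h2 h4)) using 1
      rw [cc, map_mul, smul_eq_mul]
      linear_combination (cc l * cc n * d - b * w) * (-half_add)

section W
variable {T : Subsemiring A2} (hT : IsPre T) (hA : Arch T)

theorem mem_WW {d : A2} (hd : d ∈ T) {w : A2} : w ∈ WW hT hA d hd ↔
    ∃ l : ℝ, 0 < l ∧ cc l * d + w ∈ T ∧ cc l * d - w ∈ T := Iff.rfl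

theorem WW_mul {d d' : A2} (hd : d ∈ T) (hd' : d' ∈ T) :
    WW hT hA d hd * WW hT hA d' hd' ≤ WW hT hA (d * d') (T.mul_mem hd hd') := by
  rw [Ideal.mul_le]
  rintro a ⟨l, hl, h1, h2⟩ b ⟨n, hn, h4, h3⟩
  have hh : cc (1/2) ∈ T := cc_mem hT (by norm_num)
  refine ⟨l * n, by positivity, ?_, ?_⟩
  · convert T.mul_mem hh (T.add_mem (T.mul_mem h1 h4) (T.mul_mem h2 h3)) using 1
    rw [cc, map_mul]
    linear_combination (cc l * cc n * d * d' + a * b) * (-half_add)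
  · convert T.mul_mem hh (T.add_mem (T.mul_mem h1 h3) (T.mul_mem h2 h4)) using 1
    rw [cc, map_mul]
    linear_combination (cc l * cc n * d * d' - a * b) * (-half_add)

/-- maximal ideal -/
noncomputable def mm (p : Fin 2 → ℝ) : Ideal A2 :=
  Ideal.span {MvPolynomial.X 0 - cc (p 0), MvPolynomial.X 1 - cc (p 1)}

/-- squared distance -/
noncomputable def dd (p : Fin 2 → ℝ) : A2 :=
  (MvPolynomial.X 0 - cc (p 0)) ^ 2 + (MvPolynomial.X 1 - cc (p 1)) ^ 2

theorem dd_mem (hT : IsPre T) (p) : dd p ∈ T := T.add_mem (hT _) (hT _)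

theorem mm_sq_le (p) : mm p ^ 2 ≤ WW hT hA (dd p) (dd_mem hT p) := by
  rw [pow_two, mm, Ideal.span_mul_span, Ideal.span_le]
  set a : A2 := MvPolynomial.X 0 - cc (p 0)
  set b : A2 := MvPolynomial.X 1 - cc (p 1)
  have hh : cc (1/2) ∈ T := cc_mem hT (by norm_num)
  have hab : cc 1 * dd p + a * b ∈ T ∧ cc 1 * dd p - a * b ∈ T := by
    have e : dd p = a ^ 2 + b ^ 2 := rfl
    rw [e, cc, map_one]
    constructor
    · convert T.mul_mem hh (T.add_mem (T.add_mem (hT (a + b)) (hT a)) (hT b)) using 1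
      linear_combination (a ^ 2 + b ^ 2 + a * b) * (-half_add)
    · convert T.mul_mem hh (T.add_mem (T.add_mem (hT (a - b)) (hT a)) (hT b)) using 1
      linear_combination (a ^ 2 + b ^ 2 - a * b) * (-half_add)
  intro z hz
  obtain ⟨u, rfl | rfl, v, rfl | rfl, rfl⟩ := Set.mem_mul.1 hz
  · refine ⟨1, one_pos, ?_, ?_⟩ <;> rw [cc, map_one]
    · convert T.add_mem (T.add_mem (hT a) (hT b)) (hT a) using 1
      rw [dd]; ring
    · convert hT b using 1
      rw [dd]; ring
  · exact ⟨1, one_pos, hab⟩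
  · rw [mul_comm]; exact ⟨1, one_pos, hab⟩
  · refine ⟨1, one_pos, ?_, ?_⟩ <;> rw [cc, map_one]
    · convert T.add_mem (T.add_mem (hT a) (hT b)) (hT b) using 1
      rw [dd]; ring
    · convert hT a using 1
      rw [dd]; ring

theorem WW_pow {d : A2} (hd : d ∈ T) (k : ℕ) :
    WW hT hA d hd ^ k ≤ WW hT hA (d ^ k) (T.pow_mem hd k) := by
  induction k with
  | zero =>
    intro w hw
    obtain ⟨n, hn, h1, h2⟩ := hA w
    exact ⟨n, hn, by simpa using h2, by simpa using h1⟩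
  | succ k ih =>
    rw [pow_succ]
    refine (Ideal.mul_mono ih le_rfl).trans ((WW_mul hT hA _ hd).trans ?_)
    intro w hw
    simpa only [mem_WW, pow_succ] using hw

/-- product of distances -/
noncomputable def DD (P : Finset (Fin 2 → ℝ)) (k : ℕ) : A2 := ∏ p ∈ P, dd p ^ k

theorem DD_mem (hT : IsPre T) (P k) : DD P k ∈ T := T.prod_mem fun p _ => T.pow_mem (dd_mem hT p) k

theorem prod_le_WW (P : Finset (Fin 2 → ℝ)) (k : ℕ) :
    ∏ p ∈ P, (mm p ^ 2) ^ k ≤ WW hT hA (DD P k) (DD_mem hT P k) := by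
  classical
  induction P using Finset.induction_on with
  | empty =>
    intro w hw
    obtain ⟨n, hn, h1, h2⟩ := hA w
    exact ⟨n, hn, by simpa [DD] using h2, by simpa [DD] using h1⟩
  | insert p P hp ih =>
    rw [Finset.prod_insert hp]
    have h1 : (mm p ^ 2) ^ k ≤ WW hT hA (dd p ^ k) (T.pow_mem (dd_mem hT p) k) :=
      (Ideal.pow_right_mono (mm_sq_le hT hA p) k).trans (WW_pow hT hA _ k)
    refine (Ideal.mul_mono h1 ih).trans ((WW_mul hT hA _ _).trans ?_)
    intro w hw
    simpa only [mem_WW, DD, Finset.prod_insert hp] using hw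

end W

section S
variable {s : ℕ} (g : Fin s → A2)

theorem stepA (hK : IsCompact (KK g)) (f τ D : A2) (ρ : (Fin 2 → ℝ) → ℝ) (hρc : Continuous ρ)
    (c : ℝ) (hc : 0 < c) (hD0 : ∀ q ∈ KK g, 0 ≤ ev q D) (hDf : ∀ q ∈ KK g, c * ev q D ≤ ev q f)
    (hτ : τ ∈ TT g) (hr : ∀ q ∈ KK g, |ev q (f - τ - cc c * D)| ≤ ρ q * ev q D)
    (hρ : ∀ q ∈ KK g, ev q D = 0 → ρ q = 0) :
    ∃ e ∈ TT g, D ^ 2 ∣ 1 - e ∧ ∃ c' : ℝ, 0 < c' ∧ ∀ q ∈ KK g, c' * ev q D ≤ ev q (f - e * τ) := by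
  have hK' : IsCompact (KK g ∩ {q | c / 2 ≤ ρ q}) :=
    hK.inter_right (isClosed_le continuous_const hρc)
  obtain ⟨ε1, hε1, h1⟩ := hK'.exists_forall_le' (f := fun q => ev q D) (ev_continuous D).continuousOn
    (a := 0) (by
      rintro q ⟨hq, hq2⟩
      refine lt_of_le_of_ne (hD0 q hq) (fun h => ?_)
      have := hρ q hq h.symm
      simp only [Set.mem_setOf_eq] at hq2
      linarith)
  obtain ⟨B0, hB0⟩ := hK.bddAbove_image (f := fun q => ev q D) (ev_continuous D).continuousOn
  obtain ⟨M0, hM0⟩ := hK.bddAbove_image (f := fun q => ev q τ) (ev_continuous τ).continuousOn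
  obtain ⟨B, hB, hB1⟩ : ∃ B : ℝ, 0 < B ∧ ∀ q ∈ KK g, ev q D ≤ B :=
    ⟨|B0| + 1, by positivity, fun q hq => by
      have : ev q D ≤ B0 := hB0 ⟨q, hq, rfl⟩
      linarith [le_abs_self B0]⟩
  obtain ⟨M, hM, hM1⟩ : ∃ B : ℝ, 0 < B ∧ ∀ q ∈ KK g, ev q τ ≤ B :=
    ⟨|M0| + 1, by positivity, fun q hq => by
      have : ev q τ ≤ M0 := hM0 ⟨q, hq, rfl⟩
      linarith [le_abs_self M0]⟩
  set ε := min ε1 B with hε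
  have hε0 : 0 < ε := lt_min hε1 hB
  have hεB : ε ≤ B := min_le_right _ _
  have hb0 : 0 ≤ 1 - (ε / B) ^ 2 := by
    have : (ε / B) ^ 2 ≤ 1 := pow_le_one₀ (by positivity) ((div_le_one hB).2 hεB)
    linarith
  have hb1 : 1 - (ε / B) ^ 2 < 1 := by
    have : 0 < (ε / B) ^ 2 := by positivity
    linarith
  obtain ⟨n, hn⟩ := exists_pow_lt_of_lt_one (show 0 < c * ε / (2 * M) by positivity) hb1
  refine ⟨((1 - cc (1 / B ^ 2) * D ^ 2) ^ n) ^ 2, TT_pre g _, ?_, c / 2, by positivity, ?_⟩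
  · have h2 := sub_dvd_pow_sub_pow (1 : A2) (1 - cc (1 / B ^ 2) * D ^ 2) (n * 2)
    rw [one_pow, pow_mul] at h2
    refine Dvd.dvd.trans ⟨cc (1 / B ^ 2), by ring⟩ h2
  · intro q hq
    have hqD := hD0 q hq
    have hqB := hB1 q hq
    have hτ0 : 0 ≤ ev q τ := TT_nonneg g hτ hq
    have hee : ev q (f - ((1 - cc (1 / B ^ 2) * D ^ 2) ^ n) ^ 2 * τ) =
        ev q f - ((1 - (ev q D / B) ^ 2) ^ n) ^ 2 * ev q τ := by
      simp only [ev, map_sub, map_mul, map_pow, map_one, cc, MvPolynomial.eval_C]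
      ring
    rw [hee]
    have hx0 : 0 ≤ 1 - (ev q D / B) ^ 2 := by
      have : (ev q D / B) ^ 2 ≤ 1 := pow_le_one₀ (by positivity) ((div_le_one hB).2 hqB)
      linarith
    have hx1 : 1 - (ev q D / B) ^ 2 ≤ 1 := by
      have : 0 ≤ (ev q D / B) ^ 2 := by positivity
      linarith
    have hp0 : 0 ≤ (1 - (ev q D / B) ^ 2) ^ n := pow_nonneg hx0 n
    have hp1 : (1 - (ev q D / B) ^ 2) ^ n ≤ 1 := pow_le_one₀ hx0 hx1
    set x := (1 - (ev q D / B) ^ 2) ^ n with hx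
    have hxx : x ^ 2 ≤ x := by nlinarith
    by_cases hcase : c / 2 ≤ ρ q
    · have h3 : ε ≤ ev q D := (min_le_left _ _).trans (h1 q ⟨hq, hcase⟩)
      have h4 : x < c * ε / (2 * M) := by
        refine lt_of_le_of_lt ?_ hn
        apply pow_le_pow_left₀ hx0
        have : (ε / B) ^ 2 ≤ (ev q D / B) ^ 2 := by
          apply pow_le_pow_left₀ (by positivity)
          exact div_le_div_of_nonneg_right h3 hB.le
        linarith
      have h5 : x ^ 2 * ev q τ ≤ c * ε / (2 * M) * M :=
        mul_le_mul (hxx.trans h4.le) (hM1 q hq) hτ0 (by positivity)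
      have h6 : c * ε / (2 * M) * M = c * ε / 2 := by field_simp
      have h7 : c * ε ≤ c * ev q D := mul_le_mul_of_nonneg_left h3 hc.le
      linarith [hDf q hq]
    · push Not at hcase
      have h3 := (abs_le.1 (hr q hq)).1
      simp only [ev, map_sub, map_mul, cc, MvPolynomial.eval_C] at h3 hqD hτ0 ⊢
      have h4 : x ^ 2 * MvPolynomial.eval q τ ≤ MvPolynomial.eval q τ :=
        mul_le_of_le_one_left hτ0 (by linarith)
      have h5 : ρ q * MvPolynomial.eval q D ≤ c / 2 * MvPolynomial.eval q D :=
        mul_le_mul_of_nonneg_right hcase.le hqD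
      linarith

theorem stepB (hK : IsCompact (KK g)) (F D : A2) (ρ : (Fin 2 → ℝ) → ℝ) (hρc : Continuous ρ)
    (hρ0 : ∀ q, 0 ≤ ρ q)
    (c c' : ℝ) (hc : 0 < c) (hc' : 0 < c') (hD : D ∈ TT g)
    (hF : ∀ q ∈ KK g, c' * ev q D ≤ ev q F)
    (hρ : ∀ q ∈ KK g, ev q D = 0 → ρ q = 0)
    (hQ : ∀ u e : A2, (∀ q ∈ KK g, |ev q e| * ρ q < ev q u) → u * D + e * (F - cc c * D) ∈ TT g) :
    F ∈ TT g := by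
  have hD0 : ∀ q ∈ KK g, 0 ≤ ev q D := fun q hq => TT_nonneg g hD hq
  have hK' : IsCompact (KK g ∩ {q | c ≤ ρ q}) :=
    hK.inter_right (isClosed_le continuous_const hρc)
  obtain ⟨ε1, hε1, h1⟩ := hK'.exists_forall_le' (f := fun q => ev q D) (ev_continuous D).continuousOn
    (a := 0) (by
      rintro q ⟨hq, hq2⟩
      refine lt_of_le_of_ne (hD0 q hq) (fun h => ?_)
      have := hρ q hq h.symm
      simp only [Set.mem_setOf_eq] at hq2
      linarith)
  obtain ⟨B0, hB0⟩ := hK.bddAbove_image (f := fun q => ev q D) (ev_continuous D).continuousOn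
  obtain ⟨M0, hM0⟩ := hK.bddAbove_image (f := ρ) hρc.continuousOn
  obtain ⟨B, hB, hB1⟩ : ∃ B : ℝ, 0 < B ∧ ∀ q ∈ KK g, ev q D < B :=
    ⟨|B0| + 1, by positivity, fun q hq => by
      have : ev q D ≤ B0 := hB0 ⟨q, hq, rfl⟩
      linarith [le_abs_self B0]⟩
  obtain ⟨M, hM, hM1⟩ : ∃ B : ℝ, 0 < B ∧ ∀ q ∈ KK g, ρ q ≤ B :=
    ⟨|M0| + 1, by positivity, fun q hq => by
      have : ρ q ≤ M0 := hM0 ⟨q, hq, rfl⟩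
      linarith [le_abs_self M0]⟩
  set δ := c' / (2 * B) with hδ
  have hδ0 : 0 < δ := by positivity
  set ε := min ε1 B with hε
  have hε0 : 0 < ε := lt_min hε1 hB
  have hεB : ε ≤ B := min_le_right _ _
  have hb0 : 0 ≤ 1 - (ε / B) := by
    have : (ε / B) ≤ 1 := ((div_le_one hB).2 hεB)
    linarith
  have hb1 : 1 - (ε / B) < 1 := by
    have : 0 < (ε / B) := by positivity
    linarith
  obtain ⟨n0, hn0⟩ := exists_pow_lt_of_lt_one (show 0 < δ * ε / M by positivity) hb1
  set n := n0 + 1 with hnn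
  have hn : (1 - ε / B) ^ n < δ * ε / M := by
    refine lt_of_le_of_lt ?_ hn0
    exact pow_le_pow_of_le_one hb0 hb1.le (by omega)
  set x : A2 := 1 - cc (1 / B) * D with hx
  have hxe : ∀ q, ev q x = 1 - ev q D / B := by
    intro q
    simp only [hx, ev, map_sub, map_mul, map_one, cc, MvPolynomial.eval_C]
    ring
  have hx0 : ∀ q ∈ KK g, 0 < ev q x := by
    intro q hq
    rw [hxe]
    have : ev q D / B < 1 := (div_lt_one hB).2 (hB1 q hq)
    linarith
  have hG : ∀ q ∈ KK g, 0 < c * (ev q x) ^ n + δ * ev q D - (ev q x) ^ n * ρ q := by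
    intro q hq
    have h2 := pow_pos (hx0 q hq) n
    by_cases hcase : c ≤ ρ q
    · have h3 : ε ≤ ev q D := (min_le_left _ _).trans (h1 q ⟨hq, hcase⟩)
      have h4 : (ev q x) ^ n < δ * ε / M := by
        refine lt_of_le_of_lt ?_ hn
        apply pow_le_pow_left₀ (hx0 q hq).le
        rw [hxe]
        have : ε / B ≤ ev q D / B := div_le_div_of_nonneg_right h3 hB.le
        linarith
      have h5 : (ev q x) ^ n * ρ q ≤ δ * ε / M * M :=
        mul_le_mul h4.le (hM1 q hq) (hρ0 q) (by positivity)
      have h6 : δ * ε / M * M = δ * ε := by field_simp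
      have h7 : δ * ε ≤ δ * ev q D := mul_le_mul_of_nonneg_left h3 hδ0.le
      have := mul_pos hc h2
      linarith
    · push Not at hcase
      have h3 : (ev q x) ^ n * ρ q < (ev q x) ^ n * c := mul_lt_mul_of_pos_left hcase h2
      have h4 : 0 ≤ δ * ev q D := mul_nonneg hδ0.le (hD0 q hq)
      linarith
  obtain ⟨δ2, hδ2, hG2⟩ := hK.exists_forall_le' (f := fun q => c * (ev q x) ^ n + δ * ev q D - (ev q x) ^ n * ρ q)
    (((((continuous_const.mul ((ev_continuous x).pow n)).add (continuous_const.mul (ev_continuous D))).sub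
      (((ev_continuous x).pow n).mul hρc))).continuousOn) hG
  have hm1 := hQ (cc c * x ^ n + cc δ * D - cc (δ2 / 2)) (x ^ n) (by
    intro q hq
    have h2 := hG2 q hq
    have h3 := pow_pos (hx0 q hq) n
    simp only [ev, map_sub, map_mul, map_add, map_pow, cc, MvPolynomial.eval_C] at h2 h3 ⊢
    rw [abs_of_pos h3]
    linarith)
  set η : A2 := cc (1 / B) * ∑ i ∈ Finset.range n, x ^ i with hη
  have hηD : η * D = 1 - x ^ n := by
    rw [← mul_neg_geom_sum x n, hη, hx]; ring
  have hη1 : ∀ q ∈ KK g, 1 / B ≤ ev q η := by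
    intro q hq
    have : ev q η = 1 / B * ∑ i ∈ Finset.range n, (ev q x) ^ i := by
      simp only [hη, ev, map_mul, map_sum, map_pow, cc, MvPolynomial.eval_C]
    rw [this]
    apply le_mul_of_one_le_right (by positivity)
    have h3 := Finset.single_le_sum (f := fun i => (ev q x) ^ i) (s := Finset.range n)
      (fun i _ => pow_nonneg (hx0 q hq).le i) (Finset.mem_range.2 (show 0 < n by omega))
    simpa using h3
  have hψ : η * F - cc δ * D + cc (δ2 / 2) ∈ TT g := by
    apply schmudgen g hK
    intro q hq
    have h2 := hη1 q hq
    have h3 := hF q hq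
    have h4 := hD0 q hq
    simp only [ev, map_sub, map_mul, map_add, cc, MvPolynomial.eval_C] at h2 h3 h4 ⊢
    have h5 : 1 / B * (c' * MvPolynomial.eval q D) ≤ MvPolynomial.eval q η * MvPolynomial.eval q F :=
      mul_le_mul h2 h3 (by positivity) (le_trans (by positivity) h2)
    have h6 : δ * MvPolynomial.eval q D ≤ 1 / B * (c' * MvPolynomial.eval q D) := by
      have : 1 / B * (c' * MvPolynomial.eval q D) = 2 * (δ * MvPolynomial.eval q D) := by
        rw [hδ]; field_simp
      rw [this]
      have : 0 ≤ δ * MvPolynomial.eval q D := by positivity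
      linarith
    linarith
  have := (TT g).add_mem ((TT g).mul_mem hD hψ) hm1
  convert this using 1
  linear_combination (-F) * hηD

/-- remainders -/
def QQ (D : A2) (r : A2) : Prop :=
  ∃ ρ : (Fin 2 → ℝ) → ℝ, Continuous ρ ∧ (∀ q, 0 ≤ ρ q) ∧ (∀ q ∈ KK g, ev q D = 0 → ρ q = 0) ∧
    (∀ q ∈ KK g, |ev q r| ≤ ρ q * ev q D) ∧
    ∀ u e : A2, (∀ q ∈ KK g, |ev q e| * ρ q < ev q u) → u * D + e * r ∈ TT g

theorem QQ_mul (hK : IsCompact (KK g)) (D : A2) (hD : D ∈ TT g) (a w : A2)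
    (ha : ∀ q ∈ KK g, ev q D = 0 → ev q a = 0)
    (hw : w ∈ WW (TT_pre g) (arch_TT g hK) D hD) : QQ g D (a * w) := by
  obtain ⟨l, hl, h1, h2⟩ := hw
  refine ⟨fun q => l * |ev q a|, continuous_const.mul (ev_continuous a).abs, fun q => by positivity,
    fun q hq h => by simp only [ha q hq h]; simp, fun q hq => ?_, fun u e hue => ?_⟩
  · have h3 := TT_nonneg g h1 hq
    have h4 := TT_nonneg g h2 hq
    simp only [ev, map_sub, map_mul, map_add, cc, MvPolynomial.eval_C, abs_mul] at h3 h4 ⊢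
    have h5 : |MvPolynomial.eval q w| ≤ l * MvPolynomial.eval q D := abs_le.2 ⟨by linarith, by linarith⟩
    have := mul_le_mul_of_nonneg_left h5 (abs_nonneg (MvPolynomial.eval q a))
    linarith
  · have key : ∀ q ∈ KK g, |ev q e * ev q a| < l⁻¹ * ev q u := by
      intro q hq
      have h3 := hue q hq
      rw [abs_mul, lt_inv_mul_iff₀ hl]
      linarith
    have h5 : cc l⁻¹ * u + e * a ∈ TT g := by
      apply schmudgen g hK
      intro q hq
      have := (abs_lt.1 (key q hq)).1
      simp only [ev, map_sub, map_mul, map_add, cc, MvPolynomial.eval_C] at this ⊢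
      linarith
    have h6 : cc l⁻¹ * u - e * a ∈ TT g := by
      apply schmudgen g hK
      intro q hq
      have := (abs_lt.1 (key q hq)).2
      simp only [ev, map_sub, map_mul, map_add, cc, MvPolynomial.eval_C] at this ⊢
      linarith
    have hh : cc (1/2) ∈ TT g := cc_mem (TT_pre g) (by norm_num)
    convert (TT g).mul_mem hh ((TT g).add_mem ((TT g).mul_mem h5 h1) ((TT g).mul_mem h6 h2)) using 1
    linear_combination (u * D + e * a * w) * (-half_add) - u * D * (cc (1/2) + cc (1/2)) * (cc_inv_mul hl.ne')

theorem QQ_add (D : A2) (r r' : A2) (hD : D ∈ TT g) (h : QQ g D r) (h' : QQ g D r') : QQ g D (r + r') := by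
  obtain ⟨ρ, h1, h2, h3, h4, h5⟩ := h
  obtain ⟨ρ', h1', h2', h3', h4', h5'⟩ := h'
  refine ⟨fun q => 2 * (ρ q + ρ' q), by fun_prop, fun q => ?_, fun q hq hqD => ?_, fun q hq => ?_, fun u e hue => ?_⟩
  · have := h2 q; have := h2' q; positivity
  · simp only [h3 q hq hqD, h3' q hq hqD]; simp
  · have a1 := h4 q hq
    have a2 := h4' q hq
    rw [ev, map_add]
    refine (abs_add_le _ _).trans ?_
    have : 0 ≤ (ρ q + ρ' q) * ev q D :=
      mul_nonneg (add_nonneg (h2 q) (h2' q)) (TT_nonneg g hD hq)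
    simp only [ev] at *
    nlinarith
  · have a1 := h5 (cc (1/2) * u) e (fun q hq => by
      have := hue q hq
      have hh : ev q (cc (1/2) * u) = 1/2 * ev q u := by simp [ev, cc]
      rw [hh]
      have : 0 ≤ |ev q e| * ρ' q := mul_nonneg (abs_nonneg _) (h2' q)
      nlinarith)
    have a2 := h5' (cc (1/2) * u) e (fun q hq => by
      have := hue q hq
      have hh : ev q (cc (1/2) * u) = 1/2 * ev q u := by simp [ev, cc]
      rw [hh]
      have : 0 ≤ |ev q e| * ρ q := mul_nonneg (abs_nonneg _) (h2 q)
      nlinarith)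
    convert (TT g).add_mem a1 a2 using 1
    linear_combination (u * D) * (-half_add)

theorem ev_dd (q p) : ev q (dd p) = (q 0 - p 0) ^ 2 + (q 1 - p 1) ^ 2 := by
  simp [ev, dd, cc]

theorem ev_dd_eq_zero {q p : Fin 2 → ℝ} : ev q (dd p) = 0 ↔ q = p := by
  rw [ev_dd]
  constructor
  · intro h
    have h0 : q 0 - p 0 = 0 := by nlinarith [sq_nonneg (q 0 - p 0), sq_nonneg (q 1 - p 1)]
    have h1 : q 1 - p 1 = 0 := by nlinarith [sq_nonneg (q 0 - p 0), sq_nonneg (q 1 - p 1)]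
    funext i
    fin_cases i
    · simpa using sub_eq_zero.1 h0
    · simpa using sub_eq_zero.1 h1
  · rintro rfl; simp

theorem ev_DD_eq_zero {P : Finset (Fin 2 → ℝ)} {k : ℕ} (hk : k ≠ 0) {q} :
    ev q (DD P k) = 0 ↔ q ∈ P := by
  rw [ev, DD, map_prod, Finset.prod_eq_zero_iff]
  simp only [map_pow, pow_eq_zero_iff hk]
  constructor
  · rintro ⟨p, hp, h⟩
    rw [ev_dd_eq_zero.1 h]; exact hp
  · intro h
    exact ⟨q, h, ev_dd_eq_zero.2 rfl⟩

theorem mm_ev {p : Fin 2 → ℝ} {a : A2} (ha : a ∈ mm p) : ev p a = 0 := by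
  have : mm p ≤ RingHom.ker (MvPolynomial.eval p) := by
    rw [mm, Ideal.span_le]
    rintro z (rfl | rfl) <;> simp [RingHom.mem_ker, cc]
  exact this ha

theorem mm_coprime {p q : Fin 2 → ℝ} (h : p ≠ q) : IsCoprime (mm p) (mm q) := by
  rw [Ideal.isCoprime_iff_exists]
  have key : ∀ i, p i ≠ q i → MvPolynomial.X i - cc (p i) ∈ mm p → MvPolynomial.X i - cc (q i) ∈ mm q →
      ∃ a ∈ mm p, ∃ b ∈ mm q, a + b = 1 := by
    intro i hi h1 h2
    have h3 : q i - p i ≠ 0 := sub_ne_zero.2 hi.symm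
    refine ⟨cc (q i - p i)⁻¹ * (MvPolynomial.X i - cc (p i)), Ideal.mul_mem_left _ _ h1,
      -cc (q i - p i)⁻¹ * (MvPolynomial.X i - cc (q i)), Ideal.mul_mem_left _ _ h2, ?_⟩
    have h4 := cc_inv_mul h3
    rw [cc, cc, map_sub] at h4
    linear_combination h4
  by_cases h0 : p 0 = q 0
  · refine key 1 ?_ (Ideal.subset_span (by simp)) (Ideal.subset_span (by simp))
    intro h1
    apply h
    funext i
    fin_cases i
    · exact h0
    · exact h1
  · exact key 0 h0 (Ideal.subset_span (by simp)) (Ideal.subset_span (by simp))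

theorem QQ_of_mem (hK : IsCompact (KK g)) (P : Finset (Fin 2 → ℝ)) (k : ℕ) (hk : k ≠ 0) (r : A2)
    (hr : ∀ p ∈ P, r ∈ mm p ^ (2 * k + 1)) : QQ g (DD P k) r := by
  have h1 : r ∈ ∏ p ∈ P, mm p ^ (2 * k + 1) := by
    rw [Ideal.prod_eq_iInf_of_pairwise_isCoprime]
    · simp only [Submodule.mem_iInf]; exact hr
    · intro p hp q hq hpq
      exact (mm_coprime hpq).pow
  have h2 : ∏ p ∈ P, mm p ^ (2 * k + 1) = (∏ p ∈ P, mm p) * ∏ p ∈ P, (mm p ^ 2) ^ k := by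
    rw [← Finset.prod_mul_distrib]
    refine Finset.prod_congr rfl fun p _ => ?_
    rw [pow_succ', pow_mul]
  rw [h2] at h1
  refine Submodule.mul_induction_on h1 ?_ ?_
  · intro a ha w hw
    refine QQ_mul g hK _ (DD_mem (TT_pre g) P k) a w ?_ (prod_le_WW _ _ P k hw)
    intro q hq hq0
    have hqP := (ev_DD_eq_zero hk).1 hq0
    exact mm_ev ((Ideal.prod_le_inf.trans (Finset.inf_le hqP)) ha)
  · intro a b ha hb
    exact QQ_add g _ _ _ (DD_mem (TT_pre g) P k) ha hb

theorem dd_mem_mm (p) : dd p ∈ mm p ^ 2 := by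
  rw [dd]
  exact Ideal.add_mem _ (Ideal.pow_mem_pow (Ideal.subset_span (by simp)) 2)
    (Ideal.pow_mem_pow (Ideal.subset_span (by simp)) 2)

theorem DD_mem_mm (P : Finset (Fin 2 → ℝ)) (k : ℕ) {p} (hp : p ∈ P) : DD P k ∈ mm p ^ (2 * k) := by
  classical
  rw [DD, ← Finset.mul_prod_erase P _ hp, pow_mul]
  exact Ideal.mul_mem_right _ _ (Ideal.pow_mem_pow (dd_mem_mm p) k)

theorem globalize (hK : IsCompact (KK g)) (P : Finset (Fin 2 → ℝ)) (k : ℕ) (hk : k ≠ 0) (f : A2) (c : ℝ)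
    (hc : 0 < c) (hf : ∀ q ∈ KK g, c * ev q (DD P k) ≤ ev q f)
    (hloc : ∀ p ∈ P, ∃ τ ∈ TT g, f - cc c * DD P k - τ ∈ mm p ^ (2 * k + 1)) : f ∈ TT g := by
  classical
  choose! τ hτ hτm using hloc
  have hcrt : ∀ p : P, ∃ e : A2, ∀ q : P, e - (if q = p then 1 else 0) ∈ mm q ^ (2 * k + 1) := fun p =>
    Ideal.exists_forall_sub_mem_ideal (I := fun q : P => mm q ^ (2 * k + 1))
      (fun q q' h => (mm_coprime (fun h' => h (Subtype.ext h'))).pow) _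
  choose e he using hcrt
  set t : A2 := ∑ p : P, e p ^ 2 * τ p with ht
  have htT : t ∈ TT g := (TT g).sum_mem fun p _ => (TT g).mul_mem (TT_pre g _) (hτ p p.2)
  have htm : ∀ p ∈ P, f - cc c * DD P k - t ∈ mm p ^ (2 * k + 1) := by
    intro p hp
    have h1 : t - τ p ∈ mm p ^ (2 * k + 1) := by
      rw [← Ideal.Quotient.eq, ht, map_sum, Finset.sum_eq_single (⟨p, hp⟩ : P)]
      · have := Ideal.Quotient.eq.2 (he ⟨p, hp⟩ ⟨p, hp⟩)
        rw [if_pos rfl] at this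
        rw [map_mul, map_pow, this]; simp
      · intro q _ hq
        have := Ideal.Quotient.eq.2 (he q ⟨p, hp⟩)
        rw [if_neg (Ne.symm hq)] at this
        rw [map_mul, map_pow, this]; simp
      · intro h; exact absurd (Finset.mem_univ _) h
    have := Ideal.sub_mem _ (hτm p hp) h1
    convert this using 1; ring
  have hDT := DD_mem (TT_pre g) P k
  obtain ⟨ρ, h1, h2, h3, h4, h5⟩ := QQ_of_mem g hK P k hk _ htm
  obtain ⟨E, hE, ⟨η, hη⟩, c', hc', hF⟩ := stepA g hK f t (DD P k) ρ h1 c hc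
    (fun q hq => TT_nonneg g hDT hq) hf htT (fun q hq => by
      have := h4 q hq
      rwa [show f - t - cc c * DD P k = f - cc c * DD P k - t by ring]) h3
  have hm2 : ∀ p ∈ P, f - E * t - cc c * DD P k ∈ mm p ^ (2 * k + 1) := by
    intro p hp
    have : f - E * t - cc c * DD P k = (f - cc c * DD P k - t) + DD P k ^ 2 * (η * t) := by
      linear_combination t * hη
    rw [this]
    refine Ideal.add_mem _ (htm p hp) (Ideal.mul_mem_right _ _ ?_)
    have h6 := Ideal.pow_mem_pow (DD_mem_mm P k hp) 2
    rw [← pow_mul] at h6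
    exact Ideal.pow_le_pow_right (by omega) h6
  obtain ⟨ρ', h1', h2', h3', h4', h5'⟩ := QQ_of_mem g hK P k hk _ hm2
  have hFT := stepB g hK (f - E * t) (DD P k) ρ' h1' h2' c c' hc hc' hDT hF h3' h5'
  have := (TT g).add_mem hFT ((TT g).mul_mem hE htT)
  convert this using 1; ring

end S
end PS
end

section
set_option linter.all false
set_option maxHeartbeats 400000
namespace PS
open Polynomial

theorem elim_one {R : Type} [CommRing R] [IsDomain R] [UniqueFactorizationMonoid R] (a b : Polynomial R)
    (ha : Irreducible a) (hb : Irreducible b) (hab : ¬ Associated a b) :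
    ∃ (c : R) (U V : Polynomial R), c ≠ 0 ∧ U * a + V * b = C c := by
  classical
  by_cases da : a.natDegree = 0
  · obtain ⟨r, hr⟩ := Polynomial.natDegree_eq_zero.1 da
    exact ⟨r, 1, 0, by rintro rfl; exact ha.ne_zero (by simpa using hr.symm), by rw [hr]; ring⟩
  by_cases db : b.natDegree = 0
  · obtain ⟨r, hr⟩ := Polynomial.natDegree_eq_zero.1 db
    exact ⟨r, 0, 1, by rintro rfl; exact hb.ne_zero (by simpa using hr.symm), by rw [hr]; ring⟩
  letI : NormalizedGCDMonoid R := Classical.choice inferInstance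
  have pa := ha.isPrimitive da
  have pb := hb.isPrimitive db
  let k := FractionRing R
  have ia := (pa.irreducible_iff_irreducible_map_fraction_map (K := k)).1 ha
  have hnd : ¬ (a.map (algebraMap R k)) ∣ (b.map (algebraMap R k)) := by
    intro h
    have := (Polynomial.IsPrimitive.dvd_iff_fraction_map_dvd_fraction_map k pa).2 h
    exact hab (ha.associated_of_dvd hb this)
  obtain ⟨u, v, huv⟩ := (ia.coprime_iff_not_dvd).2 hnd
  obtain ⟨c1, hc1⟩ := IsLocalization.integerNormalization_map_to_map (nonZeroDivisors R) u
  obtain ⟨c2, hc2⟩ := IsLocalization.integerNormalization_map_to_map (nonZeroDivisors R) v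
  refine ⟨c1 * c2, C (c2 : R) * IsLocalization.integerNormalization (nonZeroDivisors R) u,
    C (c1 : R) * IsLocalization.integerNormalization (nonZeroDivisors R) v, ?_, ?_⟩
  · exact mul_ne_zero (nonZeroDivisors.ne_zero c1.2) (nonZeroDivisors.ne_zero c2.2)
  · apply Polynomial.map_injective (algebraMap R k) (IsFractionRing.injective R k)
    rw [Polynomial.map_add, Polynomial.map_mul, Polynomial.map_mul, Polynomial.map_mul, Polynomial.map_mul, hc1, hc2]
    simp only [C_mul, Polynomial.map_mul, Polynomial.map_C, map_mul, Algebra.smul_def, Polynomial.algebraMap_apply, Submonoid.smul_def]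
    linear_combination (C (algebraMap R k c1) * C (algebraMap R k c2)) * huv

theorem elim_two (a b : A2) (ha : Irreducible a) (hb : Irreducible b) (hab : ¬ Associated a b) :
    {y : ℝ | ∃ q, ev q a = 0 ∧ ev q b = 0 ∧ q 1 = y}.Finite := by
  let φ := MvPolynomial.finSuccEquiv ℝ 1
  obtain ⟨c, U, V, hc, h⟩ := elim_one (φ a) (φ b) ((MulEquiv.irreducible_iff φ).2 ha) ((MulEquiv.irreducible_iff φ).2 hb)
    (by
      intro h
      apply hab
      have := h.map φ.symm
      simpa using this)
  have key : ∀ q : Fin 2 → ℝ, ev q a = 0 → ev q b = 0 → MvPolynomial.eval (fun _ => q 1) c = 0 := by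
    intro q h1 h2
    have e : ∀ f, ev q f = Polynomial.eval (q 0) (Polynomial.map (MvPolynomial.eval (fun _ : Fin 1 => q 1)) (φ f)) := by
      intro f
      rw [← MvPolynomial.eval_eq_eval_mv_eval']
      congr 2
      funext i
      fin_cases i <;> simp
    rw [e] at h1 h2
    have := congrArg (fun P => Polynomial.eval (q 0) (Polynomial.map (MvPolynomial.eval (fun _ : Fin 1 => q 1)) P)) h
    simp only [Polynomial.map_add, Polynomial.map_mul, Polynomial.eval_add, Polynomial.eval_mul, h1, h2, Polynomial.map_C, Polynomial.eval_C] at this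
    rw [← this]; ring
  let ψ := MvPolynomial.uniqueAlgEquiv ℝ (Fin 1)
  have hψ : ψ c ≠ 0 := by simpa using hc
  have e2 : ∀ y : ℝ, Polynomial.eval y (ψ c) = MvPolynomial.eval (fun _ => y) c := by
    intro y
    have : (Polynomial.evalRingHom y).comp (ψ : MvPolynomial (Fin 1) ℝ →+* Polynomial ℝ) = MvPolynomial.eval (fun _ => y) := by
      apply MvPolynomial.ringHom_ext
      · intro r; simp [ψ]
      · intro i; simp [ψ]
    exact congrArg (fun k : MvPolynomial (Fin 1) ℝ →+* ℝ => k c) this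
  refine Set.Finite.subset (Polynomial.finite_setOf_isRoot hψ) ?_
  rintro y ⟨q, h1, h2, rfl⟩
  simp only [Set.mem_setOf_eq, Polynomial.IsRoot.def]
  rw [e2]; exact key q h1 h2

theorem finite_common (a b : A2) (ha : Irreducible a) (hb : Irreducible b) (hab : ¬ Associated a b) :
    {q : Fin 2 → ℝ | ev q a = 0 ∧ ev q b = 0}.Finite := by
  have f1 := elim_two a b ha hb hab
  let σ := MvPolynomial.renameEquiv ℝ (Equiv.swap (0 : Fin 2) 1)
  have f0 := elim_two (σ a) (σ b) ((MulEquiv.irreducible_iff σ).2 ha) ((MulEquiv.irreducible_iff σ).2 hb)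
    (by
      intro h
      apply hab
      have := h.map σ.symm
      simpa using this)
  have : {q : Fin 2 → ℝ | ev q a = 0 ∧ ev q b = 0} ⊆
      Set.pi Set.univ (fun i : Fin 2 => if i = 0 then {y : ℝ | ∃ q, ev q (σ a) = 0 ∧ ev q (σ b) = 0 ∧ q 1 = y} else
        {y : ℝ | ∃ q, ev q a = 0 ∧ ev q b = 0 ∧ q 1 = y}) := by
    rintro q ⟨h1, h2⟩ i -
    have e : ∀ f : A2, ev (q ∘ Equiv.swap (0 : Fin 2) 1) (σ f) = ev q f := by
      intro f
      simp only [ev, σ, MvPolynomial.renameEquiv_apply, MvPolynomial.eval_rename]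
      congr 2
      funext i
      simp
    fin_cases i
    · exact ⟨q ∘ Equiv.swap (0 : Fin 2) 1, by rw [e]; exact h1, by rw [e]; exact h2, by simp⟩
    · exact ⟨q, h1, h2, rfl⟩
  refine Set.Finite.subset (Set.Finite.pi' (ι := Fin 2) (κ := fun _ => ℝ) (t := fun i : Fin 2 => if i = 0 then {y : ℝ | ∃ q, ev q (σ a) = 0 ∧ ev q (σ b) = 0 ∧ q 1 = y} else
        {y : ℝ | ∃ q, ev q a = 0 ∧ ev q b = 0 ∧ q 1 = y}) ?_) (fun q hq i => this hq i (Set.mem_univ i))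
  intro i
  fin_cases i
  · exact f0
  · exact f1
end PS
end

section
set_option linter.all false
set_option maxHeartbeats 400000

namespace PS
open Polynomial

/-- sum of squares, in indexed form -/
def SS {R : Type*} [CommRing R] (x : R) : Prop := ∃ (n : ℕ) (a : Fin n → R), x = ∑ i, a i ^ 2

theorem SS_of_isSumSq {R : Type*} [CommRing R] {x : R} (h : IsSumSq x) : SS x := by
  induction h with
  | zero => exact ⟨0, Fin.elim0, by simp⟩
  | sq_add a hs ih =>
    obtain ⟨n, b, hb⟩ := ih
    exact ⟨n + 1, Fin.cons a b, by simp [Fin.sum_univ_succ, hb, sq]⟩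

theorem SS.mem {R : Type*} [CommRing R] {x : R} (h : SS x) {T : Subsemiring R} (hT : IsPre T) :
    x ∈ T := by
  obtain ⟨n, a, rfl⟩ := h
  exact sum_mem fun i _ => hT _

/-- real rings -/
def RealRing (R : Type*) [CommRing R] : Prop :=
  ∀ (n : ℕ) (a : Fin n → R), ∑ i, a i ^ 2 = 0 → ∀ i, a i = 0

theorem realRing_of_order {R : Type*} [CommRing R] {F : Type*} [Field F] [LinearOrder F]
    [IsStrictOrderedRing F] (θ : R →+* F) (hθ : Function.Injective θ) : RealRing R := by
  intro n a h i
  have h1 : ∑ i, θ (a i) ^ 2 = 0 := by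
    have := congrArg θ h
    simpa using this
  have := (Finset.sum_eq_zero_iff_of_nonneg (fun i _ => sq_nonneg (θ (a i)))).1 h1 i (Finset.mem_univ i)
  apply hθ
  simpa using this

theorem realRing_poly {R : Type*} [CommRing R] [IsDomain R] [Infinite R] (hR : RealRing R) :
    RealRing R[X] := by
  intro n a h i
  apply Polynomial.funext
  intro r
  have h1 : ∑ i, (a i).eval r ^ 2 = 0 := by
    have := congrArg (Polynomial.eval r) h
    simpa [Polynomial.eval_finsetSum] using this
  simpa using hR n _ h1 i

/-- Cassels descent -/
theorem cassels {k : Type*} [Field k] (hk : RealRing k[X]) (p : k[X]) {n : ℕ} :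
    ∀ (d : ℕ) (h : k[X]) (a : Fin n → k[X]), h ≠ 0 → h.natDegree ≤ d → p * h ^ 2 = ∑ i, a i ^ 2 →
      SS p := by
  intro d
  induction d with
  | zero =>
    intro h a h0 hd he
    obtain ⟨c, rfl⟩ := Polynomial.natDegree_eq_zero.1 (Nat.le_zero.1 hd)
    have hc : c ≠ 0 := by rintro rfl; simp at h0
    refine ⟨n, fun i => C c⁻¹ * a i, ?_⟩
    have : p = C c⁻¹ ^ 2 * (p * C c ^ 2) := by
      have : (C c⁻¹ : k[X]) * C c = 1 := by rw [← C_mul, inv_mul_cancel₀ hc, C_1]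
      linear_combination (-p) * (C c⁻¹ * C c + 1) * this
    rw [this, he, Finset.mul_sum]
    exact Finset.sum_congr rfl fun i _ => by ring
  | succ d ih =>
    intro h a h0 hd he
    by_cases hb : ∀ i, a i % h = 0
    · refine ⟨n, fun i => a i / h, ?_⟩
      have h1 : ∀ i, a i = h * (a i / h) := fun i => by
        have := EuclideanDomain.div_add_mod (a i) h
        rw [hb i, add_zero] at this; exact this.symm
      have h2 : p * h ^ 2 = (∑ i, (a i / h) ^ 2) * h ^ 2 := by
        rw [he, Finset.sum_mul]
        exact Finset.sum_congr rfl fun i _ => by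
          conv_lhs => rw [h1 i]
          ring
      exact mul_right_cancel₀ (pow_ne_zero 2 h0) h2
    · set q := fun i => a i / h with hq
      set b := fun i => a i % h with hbdef
      have hab : ∀ i, a i = h * q i + b i := fun i => (EuclideanDomain.div_add_mod (a i) h).symm
      set Q := ∑ i, q i ^ 2 - p with hQ
      set B := ∑ i, a i * q i - p * h with hB
      have e1 : h * (Q * h - 2 * B) = ∑ i, b i ^ 2 := by
        have : ∑ i, b i ^ 2 = ∑ i, a i ^ 2 - 2 * h * ∑ i, a i * q i + h ^ 2 * ∑ i, q i ^ 2 := by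
          rw [Finset.mul_sum, Finset.mul_sum, ← Finset.sum_sub_distrib, ← Finset.sum_add_distrib]
          exact Finset.sum_congr rfl fun i _ => by
            have : b i = a i - h * q i := by rw [hab i]; ring
            rw [this]; ring
        rw [this, ← he, hQ, hB]; ring
      have e2 : p * (Q * h - 2 * B) ^ 2 = ∑ i, (Q * a i - 2 * B * q i) ^ 2 := by
        have : ∑ i, (Q * a i - 2 * B * q i) ^ 2
            = Q ^ 2 * ∑ i, a i ^ 2 - 4 * Q * B * ∑ i, a i * q i + 4 * B ^ 2 * ∑ i, q i ^ 2 := by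
          rw [Finset.mul_sum, Finset.mul_sum, Finset.mul_sum, ← Finset.sum_sub_distrib,
            ← Finset.sum_add_distrib]
          exact Finset.sum_congr rfl fun i _ => by ring
        have hs1 : ∑ i, a i * q i = B + p * h := by rw [hB]; ring
        have hs2 : ∑ i, q i ^ 2 = Q + p := by rw [hQ]; ring
        rw [this, ← he, hs1, hs2]; ring
      have hne : Q * h - 2 * B ≠ 0 := by
        intro h3
        rw [h3, mul_zero] at e1
        exact hb fun i => hk n b e1.symm i
      have hpos : 0 < h.natDegree := by
        by_contra h3
        have h3 : h.natDegree = 0 := by omega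
        apply hb
        intro i
        obtain ⟨c, rfl⟩ := Polynomial.natDegree_eq_zero.1 h3
        have hc : c ≠ 0 := by rintro rfl; simp at h0
        exact EuclideanDomain.mod_eq_zero.2 ((Polynomial.isUnit_C.2 (isUnit_iff_ne_zero.2 hc)).dvd)
      refine ih _ _ hne ?_ e2
      have hdeg : (∑ i, b i ^ 2).natDegree ≤ 2 * (h.natDegree - 1) := by
        apply Polynomial.natDegree_sum_le_of_forall_le
        intro i _
        refine (Polynomial.natDegree_pow_le).trans ?_
        have : (b i).natDegree < h.natDegree :=
          Polynomial.natDegree_mod_lt _ (by omega)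
        gcongr
        omega
      rw [← e1, Polynomial.natDegree_mul h0 hne] at hdeg
      omega

theorem ss_of_field {k : Type} [Field k] (hk : RealRing k[X]) (p : k[X])
    (h : ∀ (F : Type) [Field F] [LinearOrder F] [IsStrictOrderedRing F] (θ : k[X] →+* F),
      Function.Injective θ → 0 ≤ θ p) : SS p := by
  by_cases hp : p = 0
  · subst hp; exact ⟨0, Fin.elim0, by simp⟩
  have hinj : Function.Injective (algebraMap k[X] (FractionRing k[X])) :=
    IsFractionRing.injective _ _
  set ι := algebraMap k[X] (FractionRing k[X]) with hι
  have hpre : IsPre (Subsemiring.sumSq (FractionRing k[X])) := fun a => by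
    rw [Subsemiring.mem_sumSq]
    rw [sq]; exact IsSumSq.mul_self a
  obtain ⟨t, ht, s, hs, he⟩ := pst_pos (Subsemiring.sumSq (FractionRing k[X])) hpre (ι p)
    (fun F _ _ _ θ _ => by
      have h1 := h F (θ.comp ι) (θ.injective.comp hinj)
      have h2 : θ (ι p) ≠ 0 := by
        rw [Ne, map_eq_zero, map_eq_zero_iff ι hinj]; exact hp
      exact lt_of_le_of_ne h1 (Ne.symm h2))
  have hm : ι p * t ^ 2 ∈ Subsemiring.sumSq (FractionRing k[X]) := by
    have : ι p * t ^ 2 = (1 + s) * t := by rw [← he]; ring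
    rw [this]
    exact mul_mem (add_mem (one_mem _) hs) ht
  have ht0 : t ≠ 0 := by
    rintro rfl
    rw [mul_zero] at he
    have hsp : 1 + s ∈ Subsemiring.sumSq (FractionRing k[X]) := add_mem (one_mem _) hs
    -- -1 is a sum of squares in the fraction field; contradiction with realness
    have : IsSumSq s := Subsemiring.mem_sumSq.1 hs
    obtain ⟨n, a, ha⟩ := SS_of_isSumSq this
    obtain ⟨d, hd⟩ := IsLocalization.exist_integer_multiples_of_finite (nonZeroDivisors k[X]) a
    choose c hc using fun i => hd i
    have h3 : ∑ i : Fin (n+1), (Fin.cons (d : k[X]) c : Fin (n+1) → k[X]) i ^ 2 = 0 := by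
      apply hinj
      rw [Fin.sum_univ_succ]
      simp only [Fin.cons_zero, Fin.cons_succ, map_add, map_sum, map_pow, map_zero]
      have : ∀ i, ι (c i) = ι d * a i := fun i => by
        rw [hι, hc i, Algebra.smul_def]
      simp only [this, mul_pow, ← Finset.mul_sum, ← ha]
      linear_combination (- ι d ^ 2) * he
    have := hk _ _ h3 0
    simp only [Fin.cons_zero] at this
    exact nonZeroDivisors.ne_zero d.2 this
  obtain ⟨n, a, ha⟩ := SS_of_isSumSq (x := ι p * t ^ 2) (Subsemiring.mem_sumSq.1 hm)
  -- p = sum (a_i/t)^2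
  obtain ⟨d, hd⟩ := IsLocalization.exist_integer_multiples_of_finite (nonZeroDivisors k[X])
      (fun i => a i / t)
  choose c hc using fun i => hd i
  refine cassels hk p _ d c (nonZeroDivisors.ne_zero d.2) le_rfl ?_
  apply hinj
  have h4 : ∀ i, ι (c i) = ι d * (a i / t) := fun i => by
    rw [hι, hc i, Algebra.smul_def]
  have h5 : ι p = ∑ i, (a i / t) ^ 2 := by
    simp only [div_pow, ← Finset.sum_div, ← ha]
    field_simp
  simp only [map_mul, map_pow, map_sum, h4, mul_pow, ← Finset.mul_sum, ← h5]
  ring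

end PS
end

section
set_option linter.all false
set_option maxHeartbeats 400000

namespace PS
open Polynomial

/-- the ring `ℝ⟦X⟧[Y]` -/
abbrev BB := Polynomial (PowerSeries ℝ)
/-- the variable X -/
noncomputable def tX : BB := C PowerSeries.X
/-- the variable Y -/
noncomputable def tY : BB := X

/-- ordered field of Laurent series -/
abbrev LL := Lex (HahnSeries ℤ ℝ)

noncomputable def toLL : LaurentSeries ℝ →+* LL where
  toFun := toLex
  map_one' := rfl
  map_mul' _ _ := rfl
  map_zero' := rfl
  map_add' _ _ := rfl

noncomputable def psLL : PowerSeries ℝ →+* LL := toLL.comp (HahnSeries.ofPowerSeries ℤ ℝ)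

theorem psLL_inj : Function.Injective psLL := by
  have h1 : Function.Injective toLL := fun a b h => toLex.injective h
  exact h1.comp HahnSeries.ofPowerSeries_injective

theorem psLL_X_pos : 0 < psLL PowerSeries.X := by
  rw [← HahnSeries.leadingCoeff_pos_iff]
  have : ofLex (psLL PowerSeries.X) = HahnSeries.single (1:ℤ) (1:ℝ) := by
    change HahnSeries.ofPowerSeries ℤ ℝ PowerSeries.X = _
    rw [HahnSeries.ofPowerSeries_X]
  rw [this, HahnSeries.leadingCoeff_of_single]
  norm_num

theorem real_laurent : RealRing (LaurentSeries ℝ) :=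
  realRing_of_order toLL (RingHom.injective toLL)

theorem real_real : RealRing ℝ := realRing_of_order (RingHom.id ℝ) Function.injective_id

/-- reduction mod X -/
noncomputable def redX : BB →+* ℝ[X] := Polynomial.mapRingHom PowerSeries.constantCoeff

theorem redX_eq_zero {b : BB} (h : redX b = 0) : ∃ c, b = tX * c := by
  have h1 : ∀ n, PowerSeries.constantCoeff (b.coeff n) = 0 := fun n => by
    have := congrArg (fun q => Polynomial.coeff q n) h
    simpa [redX] using this
  have h2 : C (PowerSeries.X : PowerSeries ℝ) ∣ b := by
    rw [Polynomial.C_dvd_iff_dvd_coeff]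
    intro n
    exact PowerSeries.X_dvd_iff.2 (h1 n)
  exact h2

theorem tX_ne : tX ≠ 0 := by
  rw [tX, Ne, Polynomial.C_eq_zero]; exact PowerSeries.X_ne_zero

theorem redX_tX : redX tX = 0 := by simp [redX, tX]
theorem redX_tY : redX tY = X := by simp [redX, tY]
theorem redX_C (a : PowerSeries ℝ) : redX (C a) = C (PowerSeries.constantCoeff a) := by simp [redX]

theorem ss_clear {n : ℕ} (p : BB) : ∀ (e : ℕ) (a : Fin n → BB), tX ^ (2 * e) * p = ∑ i, a i ^ 2 → SS p := by
  intro e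
  induction e with
  | zero => intro a h; exact ⟨n, a, by simpa using h⟩
  | succ e ih =>
    intro a h
    have h1 : ∑ i, redX (a i) ^ 2 = 0 := by
      have := congrArg redX h
      simp only [map_mul, map_pow, redX_tX, map_sum] at this
      rw [← this]; simp
    have h2 := realRing_poly real_real n _ h1
    choose c hc using fun i => redX_eq_zero (h2 i)
    apply ih c
    have : tX ^ 2 * (tX ^ (2 * e) * p) = tX ^ 2 * ∑ i, c i ^ 2 := by
      rw [Finset.mul_sum]
      calc _ = tX ^ (2 * (e+1)) * p := by ring
        _ = _ := by rw [h]; exact Finset.sum_congr rfl fun i _ => by rw [hc i]; ring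
    exact mul_left_cancel₀ (pow_ne_zero 2 tX_ne) this

/-- the embedding into polynomials over Laurent series -/
noncomputable def toKY : BB →+* (LaurentSeries ℝ)[X] :=
  Polynomial.mapRingHom (algebraMap (PowerSeries ℝ) (LaurentSeries ℝ))

theorem toKY_inj : Function.Injective toKY := by
  apply Polynomial.map_injective
  exact IsFractionRing.injective _ _

theorem thm0 (p : BB) (h : ∀ (F : Type) [Field F] [LinearOrder F] [IsStrictOrderedRing F]
    (θ : BB →+* F), θ tX ≠ 0 → 0 ≤ θ p) : SS p := by
  haveI : Infinite (LaurentSeries ℝ) := Infinite.of_injective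
    (fun r : ℝ => (HahnSeries.C r : LaurentSeries ℝ)) HahnSeries.C_injective
  have hk : RealRing (LaurentSeries ℝ)[X] := realRing_poly real_laurent
  obtain ⟨n, a, ha⟩ := ss_of_field hk (toKY p) (fun F _ _ _ θ hθ => h F (θ.comp toKY) (by
    intro h0
    apply tX_ne
    apply toKY_inj
    apply hθ
    simpa using h0))
  have key : ∀ i, ∃ (m : ℕ) (c : BB), toKY c = toKY (tX ^ m) * a i := by
    intro i
    obtain ⟨⟨b, m, rfl⟩, hb⟩ := IsLocalization.integerNormalization_map_to_map
      (Submonoid.powers (PowerSeries.X : PowerSeries ℝ)) (S := LaurentSeries ℝ) (a i)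
    refine ⟨m, _, hb.trans ?_⟩
    rw [Algebra.smul_def]
    congr 1
    simp only [toKY, tX, map_pow, Polynomial.coe_mapRingHom, Polynomial.map_C, Polynomial.map_pow]
    rw [IsScalarTower.algebraMap_apply (PowerSeries ℝ) (LaurentSeries ℝ) (LaurentSeries ℝ)[X],
      Polynomial.algebraMap_eq]
  choose m c hc using key
  set M := ∑ i, m i
  have hm : ∀ i, m i ≤ M := fun i => Finset.single_le_sum (f := m) (fun _ _ => Nat.zero_le _) (Finset.mem_univ i)
  refine ss_clear p M (fun i => tX ^ (M - m i) * c i) ?_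
  apply toKY_inj
  rw [map_mul, ha, Finset.mul_sum, map_sum]
  refine Finset.sum_congr rfl fun i _ => ?_
  have h5 : toKY tX ^ (M - m i) * toKY tX ^ m i = toKY tX ^ M := by
    rw [← pow_add, Nat.sub_add_cancel (hm i)]
  simp only [map_mul, map_pow, hc]
  rw [mul_comm 2 M, pow_mul, ← h5]
  ring

/-- parity lemma -/
theorem parity {R R' : Type*} [CommRing R] [CommRing R'] (σ : R →+* R') (ζ : R') (z : R)
    (hz : ζ ^ 2 = σ z) (hrep : ∀ b : R', ∃ u w, b = σ u + ζ * σ w) (E : R' →+ R)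
    (hE : ∀ u w, E (σ u + ζ * σ w) = u) (T : Subsemiring R) (hT : IsPre T) (hzT : z ∈ T)
    (S : Set R) (hS : S ⊆ T) (b : R') (hb : b ∈ Subsemiring.closure (σ '' S ∪ {a | ∃ c, a = c ^ 2})) :
    E b ∈ T := by
  -- the elements are sums of σ(t) a²
  have key : ∀ b ∈ Subsemiring.closure (σ '' S ∪ {a | ∃ c, a = c ^ 2}),
      b ∈ AddSubmonoid.closure {x : R' | ∃ t ∈ T, ∃ a, x = σ t * a ^ 2} := by
    intro b hb
    induction hb using Subsemiring.closure_induction with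
    | mem x hx =>
      apply AddSubmonoid.subset_closure
      rcases hx with ⟨s, hs, rfl⟩ | ⟨c, rfl⟩
      · exact ⟨s, hS hs, 1, by ring⟩
      · exact ⟨1, one_mem _, c, by simp⟩
    | zero => exact zero_mem _
    | one => exact AddSubmonoid.subset_closure ⟨1, one_mem _, 1, by simp⟩
    | add x y _ _ hx hy => exact add_mem hx hy
    | mul x y hx0 hy0 hx hy =>
      clear hx0 hy0
      induction hx using AddSubmonoid.closure_induction with
      | zero => rw [zero_mul]; exact zero_mem _
      | add x x' _ _ hx hx' => rw [add_mul]; exact add_mem hx hx'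
      | mem x hx =>
        obtain ⟨t, ht, a, rfl⟩ := hx
        induction hy using AddSubmonoid.closure_induction with
        | zero => rw [mul_zero]; exact zero_mem _
        | add x x' _ _ hx hx' => rw [mul_add]; exact add_mem hx hx'
        | mem y hy =>
          obtain ⟨t', ht', a', rfl⟩ := hy
          apply AddSubmonoid.subset_closure
          exact ⟨t * t', mul_mem ht ht', a * a', by rw [map_mul]; ring⟩
  have aux : ∀ x, x ∈ AddSubmonoid.closure {x : R' | ∃ t ∈ T, ∃ a, x = σ t * a ^ 2} → E x ∈ T := by
    intro x hx
    induction hx using AddSubmonoid.closure_induction with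
    | zero => rw [map_zero]; exact zero_mem _
    | add x y _ _ hx hy => rw [map_add]; exact add_mem hx hy
    | mem x hx =>
      obtain ⟨t, ht, a, rfl⟩ := hx
      obtain ⟨u, w, rfl⟩ := hrep a
      have : σ t * (σ u + ζ * σ w) ^ 2 = σ (t * (u ^ 2 + z * w ^ 2)) + ζ * σ (t * (2 * u * w)) := by
        simp only [map_mul, map_add, map_pow, map_ofNat, ← hz]; ring
      rw [this, hE]
      exact mul_mem ht (add_mem (hT _) (mul_mem hzT (hT _)))
  exact aux b (key b hb)

end PS
end

section
set_option linter.all false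
set_option maxHeartbeats 400000

namespace PS
open Polynomial

theorem contract_rep (b : BB) : b = expand (PowerSeries ℝ) 2 (contract 2 b)
    + tY * expand (PowerSeries ℝ) 2 (contract 2 (divX b)) := by
  ext1 n
  rw [coeff_add, tY]
  rcases Nat.even_or_odd' n with ⟨m, rfl | rfl⟩
  · rw [coeff_expand two_pos, if_pos (dvd_mul_right _ _), coeff_contract two_ne_zero]
    have : (X * expand (PowerSeries ℝ) 2 (contract 2 (divX b)) : BB).coeff (2 * m) = 0 := by
      cases m with
      | zero => simp
      | succ m =>
        rw [show 2 * (m+1) = (2 * m + 1) + 1 by ring, coeff_X_mul, coeff_expand two_pos, if_neg (by omega)]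
    rw [this, add_zero]
    congr 1; omega
  · rw [coeff_X_mul, coeff_expand two_pos, if_neg (by omega), coeff_expand two_pos,
      if_pos (dvd_mul_right _ _), coeff_contract two_ne_zero, coeff_divX, zero_add]
    congr 1; omega

/-- the even part -/
noncomputable def evenPart : BB →+ BB where
  toFun := contract 2
  map_zero' := by ext1 n; simp [coeff_contract]
  map_add' a b := by ext1 n; simp [coeff_contract]

theorem evenPart_eq (u w : BB) : evenPart (expand (PowerSeries ℝ) 2 u + tY * expand (PowerSeries ℝ) 2 w) = u := by
  change contract 2 _ = u
  ext1 n
  rw [coeff_contract two_ne_zero, coeff_add, coeff_expand two_pos, if_pos (dvd_mul_left _ _)]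
  have : (tY * expand (PowerSeries ℝ) 2 w : BB).coeff (n * 2) = 0 := by
    cases n with
    | zero => simp [tY]
    | succ m =>
      rw [show (m+1) * 2 = (2 * m + 1) + 1 by ring, tY, coeff_X_mul, coeff_expand two_pos, if_neg (by omega)]
  rw [this, add_zero]
  congr 1; omega

theorem thm1 (p : BB) (h : ∀ (F : Type) [Field F] [LinearOrder F] [IsStrictOrderedRing F]
    (θ : BB →+* F), θ tX ≠ 0 → 0 ≤ θ tY → 0 ≤ θ p) (T : Subsemiring BB) (hT : IsPre T)
    (hY : tY ∈ T) : p ∈ T := by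
  set σ : BB →+* BB := (expand (PowerSeries ℝ) 2 : BB →ₐ[PowerSeries ℝ] BB).toRingHom with hσ
  have hσa : ∀ b, σ b = expand (PowerSeries ℝ) 2 b := fun b => rfl
  have hσX : σ tX = tX := by rw [hσa, tX, expand_C]
  have hσY : σ tY = tY ^ 2 := by rw [hσa, tY, expand_X]
  have h1 : SS (σ p) := by
    apply thm0
    intro F _ _ _ θ hθ
    refine h F (θ.comp σ) ?_ ?_
    · rw [RingHom.comp_apply, hσX]; exact hθ
    · rw [RingHom.comp_apply, hσY, map_pow]; exact sq_nonneg _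
  have h2 := parity σ tY tY hσY.symm (fun b => ⟨_, _, contract_rep b⟩) evenPart
    (fun u w => evenPart_eq u w) T hT hY ∅ (by simp) (σ p)
    (h1.mem (fun a => Subsemiring.subset_closure (Or.inr ⟨a, rfl⟩)))
  have h3 := evenPart_eq p 0
  rw [map_zero, mul_zero, add_zero] at h3
  rw [hσa, h3] at h2
  exact h2

theorem ps_sqrt (a : PowerSeries ℝ) (h : 0 < PowerSeries.constantCoeff a) : ∃ b, a = b ^ 2 := by
  have hmem : ∀ b : PowerSeries ℝ, b ∈ Ideal.span {(PowerSeries.X : PowerSeries ℝ)} ↔ PowerSeries.constantCoeff b = 0 := by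
    intro b; rw [Ideal.mem_span_singleton, PowerSeries.X_dvd_iff]
  obtain ⟨b, hb, -⟩ := HenselianRing.is_henselian (R := PowerSeries ℝ)
    (I := Ideal.span {(PowerSeries.X : PowerSeries ℝ)}) (X ^ 2 - C a)
    (monic_X_pow_sub_C _ two_ne_zero) (PowerSeries.C (Real.sqrt (PowerSeries.constantCoeff a)))
    (by rw [hmem]; simp [Real.sq_sqrt h.le])
    (by
      apply IsUnit.map
      rw [PowerSeries.isUnit_iff_constantCoeff]
      simp [h.le, (Real.sqrt_pos.2 h).ne', h])
  refine ⟨b, ?_⟩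
  have : b ^ 2 - a = 0 := by simpa [IsRoot] using hb
  linear_combination -this

section inf
variable {F : Type*} [Field F] [LinearOrder F] [IsStrictOrderedRing F] (α : PowerSeries ℝ →+* F)

theorem ps_pos {a : PowerSeries ℝ} (h : 0 < PowerSeries.constantCoeff a) : 0 < α a := by
  obtain ⟨b, rfl⟩ := ps_sqrt a h
  have : IsUnit (α (b ^ 2)) := by
    apply IsUnit.map
    rw [PowerSeries.isUnit_iff_constantCoeff]
    exact h.ne'.isUnit
  refine lt_of_le_of_ne ?_ this.ne_zero.symm
  rw [map_pow]; exact sq_nonneg _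

/-- real constants -/
noncomputable def rc (r : ℝ) : F := α (PowerSeries.C r)

theorem rc_lt {r s : ℝ} (h : r < s) : rc α r < rc α s := by
  have := ps_pos α (a := PowerSeries.C (s - r)) (by simpa using h)
  rw [map_sub, map_sub] at this
  exact sub_pos.1 this

theorem rc_pos {r : ℝ} (h : 0 < r) : 0 < rc α r := ps_pos α (by simpa using h)

theorem ps_abs_lt {a : PowerSeries ℝ} {N : ℝ} (h : |PowerSeries.constantCoeff a| < N) : |α a| < rc α N := by
  rw [abs_lt] at h ⊢
  have h1 := ps_pos α (a := PowerSeries.C N - a) (by simp; linarith)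
  have h2 := ps_pos α (a := PowerSeries.C N + a) (by simp; linarith)
  rw [map_sub] at h1; rw [map_add] at h2
  unfold rc
  constructor <;> linarith

theorem fin_eval {w : F} (hw : |w| < 1) (G : BB) : ∃ N : ℝ, 0 < N ∧ |eval₂ α w G| < rc α N := by
  induction G using Polynomial.induction_on' with
  | add p q hp hq =>
    obtain ⟨N, hN, h1⟩ := hp
    obtain ⟨M, hM, h2⟩ := hq
    refine ⟨N + M, add_pos hN hM, ?_⟩
    rw [eval₂_add]
    refine (abs_add_le _ _).trans_lt ?_
    have : rc α (N + M) = rc α N + rc α M := by simp [rc]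
    rw [this]; linarith
  | monomial n a =>
    refine ⟨|PowerSeries.constantCoeff a| + 1, by positivity, ?_⟩
    rw [eval₂_monomial, abs_mul, abs_pow]
    calc |α a| * |w| ^ n ≤ |α a| * 1 := by
          gcongr
          exact pow_le_one₀ (abs_nonneg _) hw.le
      _ = |α a| := mul_one _
      _ < _ := ps_abs_lt α (by linarith)

/-- infinitesimal -/
def Infi (w : F) : Prop := ∀ ε : ℝ, 0 < ε → |w| < rc α ε

theorem Infi.lt_one {w : F} (hw : Infi α w) : |w| < 1 := by
  have := hw 1 one_pos
  simpa [rc] using this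

theorem eval_infi {w : F} (hw : Infi α w) (G : BB) (hG : 0 < (redX G).eval 0) : 0 < eval₂ α w G := by
  set r := (redX G).eval 0 with hr
  have hr' : r = PowerSeries.constantCoeff (G.coeff 0) := by
    rw [hr, ← coeff_zero_eq_eval_zero]; simp [redX]
  obtain ⟨N, hN, h1⟩ := fin_eval α hw.lt_one (divX G)
  have h2 := hw (r / 2 / N) (by positivity)
  have h3 := ps_pos α (a := G.coeff 0 - PowerSeries.C (r/2)) (by simp [← hr']; linarith)
  rw [map_sub] at h3
  have h4 : eval₂ α w G = eval₂ α w (divX G) * w + α (G.coeff 0) := by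
    conv_lhs => rw [← divX_mul_X_add G]
    simp
  have h5 : |eval₂ α w (divX G) * w| < rc α (r / 2) := by
    rw [abs_mul]
    calc _ ≤ rc α N * |w| := by gcongr
      _ < rc α N * rc α (r/2/N) := by
        have := rc_pos α hN
        gcongr
      _ = rc α (r/2) := by
        unfold rc
        rw [← map_mul, ← map_mul]; congr 2; field_simp
  rw [h4]
  have := neg_abs_le (eval₂ α w (divX G) * w)
  unfold rc at h5
  linarith

theorem dich (f : BB) (hf : f.Monic) (hr : redX f = X ^ f.natDegree) (w : F) :
    (0 ≤ w ^ f.natDegree → 0 ≤ eval₂ α w f) ∨ Infi α w := by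
  set r := f.natDegree with hrdef
  have hc : ∀ i < r, PowerSeries.constantCoeff (f.coeff i) = 0 := fun i hi => by
    have := congrArg (fun q => q.coeff i) hr
    simp only [redX, coe_mapRingHom, coeff_map, coeff_X_pow, if_neg hi.ne] at this
    exact this
  by_cases h : ∃ i < r, |w| ^ (r - i) < r * |α (f.coeff i)|
  · right
    obtain ⟨i, hi, h⟩ := h
    intro ε hε
    by_contra h1
    push Not at h1
    have hr0 : (0:ℝ) < r := by exact_mod_cast (by omega : 0 < r)
    have h2 := ps_abs_lt α (a := f.coeff i) (N := ε ^ (r - i) / r) (by rw [hc i hi, abs_zero]; positivity)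
    have h3 : rc α (ε ^ (r - i) / r) * r = rc α ε ^ (r - i) := by
      have : (r : F) = rc α r := by simp [rc]
      rw [this]; unfold rc
      rw [← map_mul, ← map_mul, ← map_pow, ← map_pow]; congr 2; field_simp
    have hr0' : (0:F) < r := by exact_mod_cast (by omega : 0 < r)
    have h4 : rc α ε ^ (r - i) ≤ |w| ^ (r - i) := by
      have := rc_pos α hε
      gcongr
    have h5 := mul_lt_mul_of_pos_right h2 hr0'
    rw [h3] at h5
    linarith
  · left
    push Not at h
    intro hw
    rw [eval₂_eq_sum_range, Finset.sum_range_succ, ← hrdef]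
    have hl : f.coeff r = 1 := hf
    rw [hl, map_one, one_mul]
    have h1 : |∑ i ∈ Finset.range r, α (f.coeff i) * w ^ i| ≤ w ^ r := by
      rcases Nat.eq_zero_or_pos r with h0 | h0
      · rw [h0]; simp
      have hr0' : (0:F) < r := by exact_mod_cast h0
      calc _ ≤ ∑ i ∈ Finset.range r, |α (f.coeff i) * w ^ i| := Finset.abs_sum_le_sum_abs _ _
        _ ≤ ∑ i ∈ Finset.range r, w ^ r / r := by
          apply Finset.sum_le_sum
          intro i hi
          have hi := Finset.mem_range.1 hi
          rw [abs_mul, abs_pow, le_div_iff₀ hr0']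
          calc _ = (r * |α (f.coeff i)|) * |w| ^ i := by ring
            _ ≤ |w| ^ (r - i) * |w| ^ i := by gcongr; exact h i hi
            _ = |w ^ r| := by rw [← pow_add, Nat.sub_add_cancel hi.le, abs_pow]
            _ = w ^ r := abs_of_nonneg hw
        _ = w ^ r := by simp; field_simp
    have := neg_abs_le (∑ i ∈ Finset.range r, α (f.coeff i) * w ^ i)
    linarith

end inf

instance adic_inst : IsAdicComplete (IsLocalRing.maximalIdeal (PowerSeries ℝ)) (PowerSeries ℝ) := by
  rw [PowerSeries.maximalIdeal_eq_span_X]; infer_instance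

theorem mem_maxIdeal {a : PowerSeries ℝ} : a ∈ IsLocalRing.maximalIdeal (PowerSeries ℝ) ↔ PowerSeries.constantCoeff a = 0 := by
  rw [PowerSeries.maximalIdeal_eq_span_X, Ideal.mem_span_singleton, PowerSeries.X_dvd_iff]

theorem cluster (f : BB) (hf : redX f ≠ 0) : ∃ F1 F2 : BB, f = F1 * F2 ∧ F1.Monic ∧
    redX F1 = X ^ F1.natDegree ∧ (redX F2).eval 0 ≠ 0 := by
  have h0 : (f : PowerSeries (PowerSeries ℝ)).map (IsLocalRing.residue (PowerSeries ℝ)) ≠ 0 := by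
    intro h
    apply hf
    ext1 n
    have := congrArg (PowerSeries.coeff n) h
    rw [PowerSeries.coeff_map, Polynomial.coeff_coe, map_zero, IsLocalRing.residue_eq_zero_iff, mem_maxIdeal] at this
    simpa [redX] using this
  obtain ⟨F1, h, H⟩ := PowerSeries.exists_isWeierstrassFactorization h0
  have hD := H.isDistinguishedAt
  have hm := hD.monic
  refine ⟨F1, f /ₘ F1, ?_⟩
  have hdiv := modByMonic_add_div f F1
  have hu := (hD.isWeierstrassDivisorAt' ).eq_of_mul_add_eq_mul_add (q := (f /ₘ F1 : BB)) (q' := h)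
    (r := f %ₘ F1) (r' := 0) ?_ ?_ ?_
  · obtain ⟨h1, h2⟩ := hu
    rw [h2, zero_add] at hdiv
    refine ⟨hdiv.symm, hm, ?_, ?_⟩
    · ext1 i
      simp only [redX, coe_mapRingHom, coeff_map, coeff_X_pow]
      split_ifs with hi
      · rw [hi]
        have : F1.coeff F1.natDegree = 1 := hm
        rw [this, map_one]
      · rcases lt_or_gt_of_ne hi with hi | hi
        · exact mem_maxIdeal.1 (hD.mem hi)
        · rw [coeff_eq_zero_of_natDegree_lt hi, map_zero]
    · rw [← coeff_zero_eq_eval_zero]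
      simp only [redX, coe_mapRingHom, coeff_map]
      have hu := H.isUnit
      rw [← h1, PowerSeries.isUnit_iff_constantCoeff, ← PowerSeries.coeff_zero_eq_constantCoeff_apply,
        Polynomial.coeff_coe, PowerSeries.isUnit_iff_constantCoeff] at hu
      exact hu.ne_zero
  · have e0 := hD.coe_natDegree_eq_order_map F1 1
      (by rw [map_one, ← Ideal.ne_top_iff_one]; exact Ideal.IsPrime.ne_top') (by simp)
    have e1 := congrArg ENat.toNat e0
    rw [ENat.toNat_coe] at e1
    rw [← e1]
    rw [← Polynomial.degree_eq_natDegree hm.ne_zero]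
    exact degree_modByMonic_lt _ hm
  · simp
  · have e2 := H.eq_mul
    rw [Polynomial.coe_zero, add_zero, ← e2]
    conv_rhs => rw [← hdiv]
    push_cast
    ring

end PS
end

section
set_option linter.all false
set_option maxHeartbeats 400000

namespace PS
open Polynomial

/-- the maximal ideal (X,Y) -/
noncomputable def II : Ideal BB := Ideal.span {tX, tY}

/-- value at the origin -/
noncomputable def e0 : BB →+* ℝ := (Polynomial.evalRingHom (0:ℝ)).comp redX

/-- real constants in BB -/
noncomputable def rr : ℝ →+* BB := (C : PowerSeries ℝ →+* BB).comp (PowerSeries.C : ℝ →+* PowerSeries ℝ)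

theorem e0_eq (b : BB) : e0 b = (redX b).eval 0 := rfl
theorem e0_coeff (b : BB) : e0 b = PowerSeries.constantCoeff (b.coeff 0) := by
  rw [e0_eq, ← coeff_zero_eq_eval_zero]; simp [redX]
@[simp] theorem e0_rr (r : ℝ) : e0 (rr r) = r := by simp [e0_coeff, rr]
@[simp] theorem e0_tX : e0 tX = 0 := by simp [e0_coeff, tX]
@[simp] theorem e0_tY : e0 tY = 0 := by simp [e0_coeff, tY]
@[simp] theorem e0_C (a : PowerSeries ℝ) : e0 (C a) = PowerSeries.constantCoeff a := by simp [e0_coeff]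

theorem tX_mem : tX ∈ II := Ideal.subset_span (by simp)
theorem tY_mem : tY ∈ II := Ideal.subset_span (by simp)

theorem mem_II {b : BB} : b ∈ II ↔ e0 b = 0 := by
  constructor
  · intro h
    have : II ≤ RingHom.ker e0 := by
      rw [II, Ideal.span_le]
      rintro x (rfl | rfl)
      · exact e0_tX
      · exact e0_tY
    exact this h
  · intro h
    rw [e0_coeff] at h
    obtain ⟨d, hd⟩ := PowerSeries.X_dvd_iff.2 h
    rw [← divX_mul_X_add b, hd, C_mul]
    exact add_mem (Ideal.mul_mem_left _ _ tY_mem) (Ideal.mul_mem_right _ _ tX_mem)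

theorem ipow_succ {R : Type*} [CommRing R] (I : Ideal R) (k : ℕ) : I ^ (k + 1) = I ^ k * I := pow_succ _ _
theorem ipow_add {R : Type*} [CommRing R] (I : Ideal R) (k l : ℕ) : I ^ (k + l) = I ^ k * I ^ l := pow_add _ _ _
theorem IIs (k : ℕ) : II ^ (k + 1) = II ^ k * II := ipow_succ II k
theorem IIa (k l : ℕ) : II ^ (k + l) = II ^ k * II ^ l := ipow_add II k l
theorem II1 : II ^ 1 = II := pow_one _

theorem mem_IIpow {b : BB} {k : ℕ} : b ∈ II ^ k ↔ ∀ j, PowerSeries.X ^ (k - j) ∣ b.coeff j := by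
  constructor
  · induction k generalizing b with
    | zero => intro _ j; simp
    | succ k ih =>
      intro h
      rw [IIs] at h
      refine Submodule.mul_induction_on h ?_ ?_
      · intro m hm n hn j
        have hm := ih hm
        rw [mem_II, e0_coeff] at hn
        obtain ⟨d, hd⟩ := PowerSeries.X_dvd_iff.2 hn
        rw [← divX_mul_X_add n, hd, C_mul, mul_add, coeff_add]
        apply dvd_add
        · rw [← mul_assoc]
          cases j with
          | zero => simp
          | succ j =>
            rw [coeff_mul_X, coeff_mul]
            apply Finset.dvd_sum
            intro x hx
            have hx := Finset.HasAntidiagonal.mem_antidiagonal.1 hx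
            exact Dvd.dvd.mul_right ((pow_dvd_pow _ (by omega)).trans (hm x.1)) _
        · rw [← C_mul, coeff_mul_C]
          obtain ⟨e, he⟩ := hm j
          rw [he]
          refine (pow_dvd_pow _ (by omega : k + 1 - j ≤ (k - j) + 1)).trans ⟨e * d, by ring⟩
      · intro x y hx hy j
        rw [coeff_add]; exact dvd_add (hx j) (hy j)
  · intro h
    rw [b.as_sum_range_C_mul_X_pow]
    apply sum_mem
    intro j _
    obtain ⟨d, hd⟩ := h j
    rw [hd, C_mul, map_pow]
    have h1 : (C PowerSeries.X : BB) ^ (k - j) * X ^ j ∈ II ^ (k - j + j) := by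
      rw [IIa]
      exact Ideal.mul_mem_mul (Ideal.pow_mem_pow tX_mem _) (Ideal.pow_mem_pow tY_mem _)
    have h2 := Ideal.pow_le_pow_right (I := II) (by omega : k ≤ k - j + j) h1
    have := Ideal.mul_mem_left _ (C d) h2
    convert this using 1
    ring

/-- adically closed -/
def Clo (T : Subsemiring BB) : Prop := ∀ b, (∀ N, ∃ τ ∈ T, b - τ ∈ II ^ N) → b ∈ T

theorem rr_mem {T : Subsemiring BB} (hT : IsPre T) {r : ℝ} (h : 0 ≤ r) : rr r ∈ T := by
  have := hT (rr (Real.sqrt r))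
  rwa [← map_pow, Real.sq_sqrt h] at this

theorem rr_mul_inv {r : ℝ} (h : r ≠ 0) : rr r * rr r⁻¹ = 1 := by
  rw [← map_mul, mul_inv_cancel₀ h, map_one]

theorem unit_mem {T : Subsemiring BB} (hT : IsPre T) (hC : Clo T) {b : BB} (hb : 0 < e0 b) : b ∈ T := by
  have key : ∀ N : ℕ, ∃ s, e0 s = Real.sqrt (e0 b) ∧ b - s ^ 2 ∈ II ^ (N + 1) := by
    intro N
    induction N with
    | zero =>
      refine ⟨rr (Real.sqrt (e0 b)), by simp, ?_⟩
      rw [zero_add, II1, mem_II]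
      simp [Real.sq_sqrt hb.le]
    | succ N ih =>
      obtain ⟨s, hs, h⟩ := ih
      have hs0 : e0 s ≠ 0 := by rw [hs]; exact (Real.sqrt_pos.2 hb).ne'
      refine ⟨s + (b - s ^ 2) * rr (2 * e0 s)⁻¹, ?_, ?_⟩
      · have : b - s ^ 2 ∈ II := Ideal.pow_le_self (by omega) h
        rw [mem_II] at this
        rw [map_add, map_mul, this, hs]; ring
      · set k := rr (2 * e0 s)⁻¹ with hk
        have e : b - (s + (b - s ^ 2) * k) ^ 2
            = (b - s ^ 2) * (1 - 2 * s * k) - (b - s ^ 2) * (b - s ^ 2) * k ^ 2 := by ring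
        rw [e]
        apply sub_mem
        · rw [IIs (N+1)]
          refine Ideal.mul_mem_mul h ?_
          rw [mem_II, hk]
          simp only [map_sub, map_one, map_mul, map_ofNat, e0_rr]
          field_simp
          ring
        · apply Ideal.mul_mem_right
          refine Ideal.pow_le_pow_right (by omega : N + 1 + 1 ≤ (N + 1) + (N + 1)) ?_
          rw [IIa]
          exact Ideal.mul_mem_mul h h
  apply hC
  intro N
  obtain ⟨s, -, h⟩ := key N
  exact ⟨s ^ 2, hT s, Ideal.pow_le_pow_right (by omega) h⟩

theorem cancel_mem {T : Subsemiring BB} (hT : IsPre T) (hC : Clo T) {h b : BB} (hh : 0 < e0 h)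
    (hb : h * b ∈ T) : b ∈ T := by
  have key : ∀ N : ℕ, ∃ k, e0 k = (e0 h)⁻¹ ∧ 1 - h * k ∈ II ^ (N + 1) := by
    intro N
    induction N with
    | zero =>
      refine ⟨rr (e0 h)⁻¹, by simp, ?_⟩
      rw [zero_add, II1, mem_II]
      simp [mul_inv_cancel₀ hh.ne']
    | succ N ih =>
      obtain ⟨k, hk, h1⟩ := ih
      refine ⟨k + k * (1 - h * k), ?_, ?_⟩
      · have : 1 - h * k ∈ II := Ideal.pow_le_self (by omega) h1
        rw [mem_II] at this
        rw [map_add, map_mul, this, hk]; ring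
      · have e : 1 - h * (k + k * (1 - h * k)) = (1 - h * k) * (1 - h * k) := by ring
        rw [e]
        refine Ideal.pow_le_pow_right (by omega : N + 1 + 1 ≤ (N + 1) + (N + 1)) ?_
        rw [IIa]
        exact Ideal.mul_mem_mul h1 h1
  apply hC
  intro N
  obtain ⟨k, hk, h1⟩ := key N
  refine ⟨k * (h * b), mul_mem (unit_mem hT hC (by rw [hk]; positivity)) hb, ?_⟩
  have : b - k * (h * b) = (1 - h * k) * b := by ring
  rw [this]
  exact Ideal.mul_mem_right _ _ (Ideal.pow_le_pow_right (by omega) h1)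

/-- the closure of a subsemiring -/
def hull (T : Subsemiring BB) : Subsemiring BB where
  carrier := {b | ∀ N, ∃ τ ∈ T, b - τ ∈ II ^ N}
  mul_mem' := by
    intro a b ha hb N
    obtain ⟨s, hs, h1⟩ := ha N
    obtain ⟨t, ht, h2⟩ := hb N
    refine ⟨s * t, mul_mem hs ht, ?_⟩
    have : a * b - s * t = (a - s) * b + (b - t) * s := by ring
    rw [this]
    exact add_mem (Ideal.mul_mem_right _ _ h1) (Ideal.mul_mem_right _ _ h2)
  one_mem' N := ⟨1, one_mem _, by simp⟩
  add_mem' := by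
    intro a b ha hb N
    obtain ⟨s, hs, h1⟩ := ha N
    obtain ⟨t, ht, h2⟩ := hb N
    refine ⟨s + t, add_mem hs ht, ?_⟩
    have : a + b - (s + t) = (a - s) + (b - t) := by ring
    rw [this]
    exact add_mem h1 h2
  zero_mem' N := ⟨0, zero_mem _, by simp⟩

theorem mem_hull {T : Subsemiring BB} {b : BB} : b ∈ hull T ↔ ∀ N, ∃ τ ∈ T, b - τ ∈ II ^ N := Iff.rfl

theorem le_hull (T : Subsemiring BB) : T ≤ hull T := fun b hb N => ⟨b, hb, by simp⟩

theorem hull_clo (T : Subsemiring BB) : Clo (hull T) := by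
  intro b hb N
  obtain ⟨s, hs, h1⟩ := hb N
  obtain ⟨t, ht, h2⟩ := hs N
  exact ⟨t, ht, by have := add_mem h1 h2; simpa using this⟩

theorem hull_pre {T : Subsemiring BB} (hT : IsPre T) : IsPre (hull T) := fun a => le_hull T (hT a)

end PS
end

section
set_option linter.all false
set_option maxHeartbeats 400000

namespace PS
open Polynomial

/-- homogenised evaluation -/
noncomputable def HM (v c : BB) (ψ : ℝ[X]) (n : ℕ) : BB :=
  MvPolynomial.eval₂ rr ![v, c] (ψ.homogenize n)

theorem HM_eq (v c : BB) (ψ : ℝ[X]) (n : ℕ) :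
    HM v c ψ n = ∑ j ∈ Finset.range (n + 1), rr (ψ.coeff j) * c ^ (n - j) * v ^ j := by
  rw [HM, homogenize, Finset.Nat.sum_antidiagonal_eq_sum_range_succ_mk, MvPolynomial.eval₂_sum]
  refine Finset.sum_congr rfl fun j _ => ?_
  rw [MvPolynomial.eval₂_monomial, mul_assoc]
  congr 1
  rw [Finsupp.prod_fintype _ _ (by simp)]
  simp [Fin.prod_univ_two, mul_comm]

theorem HM_mul (v c : BB) (p q : ℝ[X]) {m n : ℕ} (hm : natDegree p ≤ m) (hn : natDegree q ≤ n) :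
    HM v c (p * q) (m + n) = HM v c p m * HM v c q n := by
  rw [HM, homogenize_mul p q hm hn, MvPolynomial.eval₂_mul]; rfl

theorem const_sign (p : ℝ[X]) (h : ∀ x ∈ Set.Icc (0:ℝ) 1, p.eval x ≠ 0) :
    (∀ x ∈ Set.Icc (0:ℝ) 1, 0 < p.eval x) ∨ (∀ x ∈ Set.Icc (0:ℝ) 1, 0 < (-p).eval x) := by
  have key : ∀ a ∈ Set.Icc (0:ℝ) 1, ∀ b ∈ Set.Icc (0:ℝ) 1, p.eval a < 0 → 0 < p.eval b → False := by
    intro a ha b hb h1 h2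
    obtain ⟨x, hx, hx0⟩ := isPreconnected_Icc.intermediate_value ha hb p.continuous.continuousOn
      (show (0:ℝ) ∈ Set.Icc _ _ from ⟨h1.le, h2.le⟩)
    exact h x hx hx0
  by_cases h0 : 0 < p.eval 0
  · left
    intro x hx
    by_contra h1
    exact key x hx 0 (by simp) (lt_of_le_of_ne (not_lt.1 h1) (h x hx)) h0
  · right
    intro x hx
    rw [eval_neg, neg_pos]
    by_contra h1
    exact key 0 (by simp) x hx (lt_of_le_of_ne (not_lt.1 h0) (h 0 (by simp)))
      (lt_of_le_of_ne (not_lt.1 h1) (h x hx).symm)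

theorem HM_deg1 {T : Subsemiring BB} (hT : IsPre T) {v w : BB} (hv : v ∈ T) (hw : w ∈ T) (p : ℝ[X])
    (h : ∀ x ∈ Set.Icc (0:ℝ) 1, 0 < p.eval x) (hd : p.natDegree = 1) : HM v (v + w) p 1 ∈ T := by
  rw [HM_eq]
  have e := h 0 (by simp)
  have e' := h 1 (by simp)
  rw [eval_eq_sum_range, hd] at e e'
  simp [Finset.sum_range_succ] at e e' ⊢
  have : rr (p.coeff 0) * (v + w) + rr (p.coeff 1) * v
    = rr (p.coeff 0) * w + rr (p.coeff 0 + p.coeff 1) * v := by rw [map_add]; ring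
  rw [this]
  exact add_mem (mul_mem (rr_mem hT e.le) hw) (mul_mem (rr_mem hT e'.le) hv)

theorem HM_deg2 {T : Subsemiring BB} (hT : IsPre T) {v c : BB} (p : ℝ[X]) 
    (h : ∀ x, p.eval x ≠ 0) (h0 : 0 < p.eval 0) (hd : p.natDegree = 2) : HM v c p 2 ∈ T := by
  rw [HM_eq]
  have ev : ∀ x, p.eval x = p.coeff 0 + p.coeff 1 * x + p.coeff 2 * x ^ 2 := fun x => by
    rw [eval_eq_sum_range, hd]; simp [Finset.sum_range_succ]
  simp [Finset.sum_range_succ]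
  have ha0 : p.coeff 2 ≠ 0 := by
    have : p.leadingCoeff ≠ 0 := by
      rw [Ne, leadingCoeff_eq_zero]; rintro rfl; simp at hd
    rwa [leadingCoeff, hd] at this
  generalize p.coeff 0 = d at *
  generalize p.coeff 1 = b at *
  generalize p.coeff 2 = a at *
  have hdisc : b ^ 2 < 4 * a * d := by
    by_contra hcon
    push Not at hcon
    have := h ((-b + Real.sqrt (b ^ 2 - 4 * a * d)) / (2 * a))
    apply this
    rw [ev]
    have hs := Real.sq_sqrt (show 0 ≤ b ^ 2 - 4 * a * d by linarith)
    set s := Real.sqrt (b ^ 2 - 4 * a * d)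
    field_simp
    linear_combination hs
  have hd0 : 0 < d := by rw [ev] at h0; simpa using h0
  have ha : 0 < a := by
    by_contra hcon
    nlinarith [sq_nonneg b]
  have : rr d * c ^ 2 + rr b * c * v + rr a * v ^ 2
      = rr (4 * a)⁻¹ * (((2 * rr a) * v + rr b * c) ^ 2 + rr (4 * a * d - b ^ 2) * c ^ 2) := by
    have e1 : rr (4 * a)⁻¹ * (4 * rr a) = 1 := by
      have := rr_mul_inv (show 4 * a ≠ 0 by positivity)
      rw [map_mul, map_ofNat] at this
      rw [mul_comm]; exact this
    simp only [map_sub, map_mul, map_pow, map_ofNat] at e1 ⊢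
    linear_combination (-(rr d * c ^ 2 + rr b * c * v + rr a * v ^ 2)) * e1
  rw [this]
  exact mul_mem (rr_mem hT (by positivity)) (add_mem (hT _) (mul_mem (rr_mem hT (by linarith)) (hT _)))

theorem hom_mem {T : Subsemiring BB} (hT : IsPre T) {v w : BB} (hv : v ∈ T) (hw : w ∈ T) :
    ∀ (d : ℕ) (ψ : ℝ[X]), ψ.natDegree ≤ d → (∀ x ∈ Set.Icc (0:ℝ) 1, 0 < ψ.eval x) →
      ∀ n, ψ.natDegree ≤ n → HM v (v + w) ψ n ∈ T := by
  have hc : v + w ∈ T := add_mem hv hw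
  intro d
  induction d with
  | zero =>
    intro ψ hd hpos n hn
    obtain ⟨r, rfl⟩ := natDegree_eq_zero.1 (Nat.le_zero.1 hd)
    have hr := hpos 0 (by simp)
    rw [eval_C] at hr
    rw [HM, homogenize_C]
    simp
    exact mul_mem (rr_mem hT hr.le) (pow_mem hc n)
  | succ d ih =>
    intro ψ hd hpos n hn
    by_cases h0 : ψ.natDegree = 0
    · exact ih ψ (by omega) hpos n hn
    have hnu : ¬ IsUnit ψ := fun hu => h0 (natDegree_eq_zero_of_isUnit hu)
    have hne : ψ ≠ 0 := by rintro rfl; simp at h0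
    obtain ⟨p, hp, hdvd⟩ := WfDvdMonoid.exists_irreducible_factor hnu hne
    obtain ⟨χ, rfl⟩ := hdvd
    have hp0 : ∀ x ∈ Set.Icc (0:ℝ) 1, p.eval x ≠ 0 := fun x hx h => by
      have := hpos x hx
      rw [eval_mul, h, zero_mul] at this
      exact lt_irrefl _ this
    wlog hps : ∀ x ∈ Set.Icc (0:ℝ) 1, 0 < p.eval x generalizing p χ
    · have h2 := (const_sign p hp0).resolve_left hps
      have e : p * χ = (-p) * (-χ) := by ring
      rw [e]
      rw [e] at hd hpos hn h0 hnu hne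
      exact this (-p) (((Associated.refl p).neg_right).irreducible hp) (-χ) hd hpos hn h0 hnu hne (fun x hx => (h2 x hx).ne') h2
    have hχ : ∀ x ∈ Set.Icc (0:ℝ) 1, 0 < χ.eval x := fun x hx => by
      have := hpos x hx
      rw [eval_mul] at this
      exact (pos_iff_pos_of_mul_pos this).1 (hps x hx)
    have hχ0 : χ ≠ 0 := right_ne_zero_of_mul hne
    have hdm := natDegree_mul hp.ne_zero hχ0
    have hpd : 0 < p.natDegree := hp.natDegree_pos
    have hle : p.natDegree ≤ 2 := hp.natDegree_le_two
    have hpm : HM v (v + w) p p.natDegree ∈ T := by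
      by_cases h1 : p.natDegree = 1
      · rw [h1]; exact HM_deg1 hT hv hw p hps h1
      · have h2 : p.natDegree = 2 := by omega
        rw [h2]
        refine HM_deg2 hT p ?_ (hps 0 (by simp)) h2
        intro x hx
        have := degree_eq_one_of_irreducible_of_root hp hx
        exact h1 (natDegree_eq_of_degree_eq_some this)
    have hnn : n = p.natDegree + (n - p.natDegree) := by omega
    rw [hnn, HM_mul _ _ _ _ le_rfl (by omega)]
    exact mul_mem hpm (ih χ (by omega) hχ _ (by omega))

theorem pow_sub_mem {T : Subsemiring BB} {v w : BB} (hv : v ∈ T) (hw : w ∈ T) (j : ℕ) :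
    (v + w) ^ j - v ^ j ∈ T := by
  rw [← Commute.mul_geom_sum₂ (Commute.all _ _)]
  refine mul_mem (by simpa using hw) (sum_mem fun i _ => mul_mem (pow_mem (add_mem hv hw) _) (pow_mem hv _))

theorem hom_unit {T : Subsemiring BB} (hT : IsPre T) (hC : Clo T) {v w : BB} (hv : v ∈ T) (hw : w ∈ T)
    (φ : ℝ[X]) (hφ : ∀ x ∈ Set.Icc (0:ℝ) 1, 0 < φ.eval x) (n : ℕ) (hn : φ.natDegree ≤ n)
    (a : ℕ → BB) (ha : ∀ j, e0 (a j) = φ.coeff j) :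
    ∑ j ∈ Finset.range (n + 1), a j * (v + w) ^ (n - j) * v ^ j ∈ T := by
  obtain ⟨x0, hx0, hmin⟩ := isCompact_Icc.exists_isMinOn (Set.nonempty_Icc.2 (zero_le_one (α := ℝ)))
    φ.continuous.continuousOn
  set ε := φ.eval x0 / 2 with hε
  have hε0 : 0 < ε := by have := hφ x0 hx0; positivity
  have hψ : ∀ x ∈ Set.Icc (0:ℝ) 1, 0 < (φ - C ε).eval x := fun x hx => by
    have h1 : φ.eval x0 ≤ φ.eval x := hmin hx
    rw [eval_sub, eval_C]
    linarith
  have hψd : (φ - C ε).natDegree ≤ n := (natDegree_sub_le _ _).trans (by simp [hn])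
  have h1 := hom_mem hT hv hw _ _ le_rfl hψ n hψd
  rw [HM_eq] at h1
  set c := v + w with hcdef
  have hc : c ∈ T := add_mem hv hw
  set δ := ε / (n + 1) with hδ
  have hδ0 : 0 < δ := by positivity
  have e1 : ∑ j ∈ Finset.range (n + 1), a j * c ^ (n - j) * v ^ j =
      ∑ j ∈ Finset.range (n + 1), rr ((φ - C ε).coeff j) * c ^ (n - j) * v ^ j
      + ∑ j ∈ Finset.range (n + 1), (rr δ * (c ^ (n - j) * (c ^ j - v ^ j))
        + (rr δ + (a j - rr (φ.coeff j))) * (c ^ (n - j) * v ^ j)) := by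
    have e2 : ∑ j ∈ Finset.range (n + 1), rr ((φ - C ε).coeff j) * c ^ (n - j) * v ^ j
        = ∑ j ∈ Finset.range (n + 1), rr (φ.coeff j) * c ^ (n - j) * v ^ j - rr ε * c ^ n := by
      rw [Finset.sum_range_succ' (n := n), Finset.sum_range_succ' (n := n)]
      have : ∀ j, (φ - C ε).coeff (j + 1) = φ.coeff (j + 1) := fun j => by
        simp [coeff_C]
      simp only [this, coeff_sub, coeff_C_zero, map_sub, pow_zero, Nat.sub_zero]
      ring
    have e3 : ∀ j ∈ Finset.range (n + 1), (rr δ * (c ^ (n - j) * (c ^ j - v ^ j))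
        + (rr δ + (a j - rr (φ.coeff j))) * (c ^ (n - j) * v ^ j)) = rr δ * c ^ n + (a j * c ^ (n - j) * v ^ j
          - rr (φ.coeff j) * c ^ (n - j) * v ^ j) := by
      intro j hj
      have hj : j ≤ n := by have := Finset.mem_range.1 hj; omega
      have : c ^ (n - j) * c ^ j = c ^ n := by rw [← pow_add, Nat.sub_add_cancel hj]
      linear_combination (rr δ) * this
    rw [e2, Finset.sum_congr rfl e3, Finset.sum_add_distrib, Finset.sum_sub_distrib]
    have e4 : ∑ j ∈ Finset.range (n + 1), rr δ * c ^ n = rr ε * c ^ n := by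
      rw [Finset.sum_const, Finset.card_range, nsmul_eq_mul, ← mul_assoc]
      congr 1
      have : ((n + 1 : ℕ) : BB) = rr ((n + 1 : ℕ) : ℝ) := by simp
      rw [this, ← map_mul, hδ]; congr 1; push_cast; field_simp
    rw [e4]; ring
  rw [e1]
  refine add_mem h1 (sum_mem fun j _ => add_mem ?_ ?_)
  · exact mul_mem (rr_mem hT hδ0.le) (mul_mem (pow_mem hc _) (pow_sub_mem hv hw j))
  · refine mul_mem (unit_mem hT hC ?_) (mul_mem (pow_mem hc _) (pow_mem hv _))
    rw [map_add, map_sub, e0_rr, e0_rr, ha]; linarith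

end PS
end

section
set_option linter.all false
set_option maxHeartbeats 400000
namespace PS
open Polynomial

/-- positivity on the sandwich region -/
def PosA (M : ℕ) (f : BB) : Prop := ∀ (F : Type) [Field F] [LinearOrder F] [IsStrictOrderedRing F]
  (θ : BB →+* F), θ tX ≠ 0 → 0 ≤ θ tY → θ tY ≤ θ tX ^ M → 0 < θ f

/-- Y ↦ X^M Y -/
noncomputable def bet (M : ℕ) (f : BB) : BB := f.comp (C (PowerSeries.X ^ M) * X)

theorem bet_coeff (M : ℕ) (f : BB) (j : ℕ) : (bet M f).coeff j = f.coeff j * PowerSeries.X ^ (M * j) := by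
  unfold bet
  rw [comp_C_mul_X_coeff, ← pow_mul]

theorem bet_inj (M : ℕ) (f : BB) (h : bet M f = 0) : f = 0 := by
  ext1 j
  have := congrArg (fun q => q.coeff j) h
  simp only [bet_coeff, coeff_zero] at this
  rcases mul_eq_zero.1 this with h | h
  · simpa using h
  · exact absurd h (pow_ne_zero _ PowerSeries.X_ne_zero)

theorem pull_tX (b : BB) (hb : b ≠ 0) : ∃ (l : ℕ) (F : BB), b = tX ^ l * F ∧ redX F ≠ 0 := by
  obtain ⟨n, a, h1, h2⟩ := WfDvdMonoid.max_power_factor' hb (x := tX) (by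
    intro h
    have := h.map redX
    simp [redX, tX] at this)
  refine ⟨n, a, h2, fun h => h1 ?_⟩
  obtain ⟨c, hc⟩ := redX_eq_zero h
  exact ⟨c, hc⟩

theorem eval2_bet {F : Type*} [Field F] (α : PowerSeries ℝ →+* F) (M : ℕ) (f : BB) (z : F) :
    eval₂ α z (bet M f) = eval₂ α (α PowerSeries.X ^ M * z) f := by
  unfold bet
  rw [eval₂_comp, eval₂_mul, eval₂_C, eval₂_X, map_pow]

theorem hom_eval2 {F : Type*} [CommRing F] (θ : BB →+* F) (f : BB) :
    θ f = eval₂ (θ.comp C) (θ tY) f := by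
  have : θ = eval₂RingHom (θ.comp C) (θ tY) := by
    apply Polynomial.ringHom_ext
    · intro a; simp
    · simp [tY]
  exact congrArg (fun (k : BB →+* F) => k f) this

theorem const_eval (F : BB) (r : ℝ) : PowerSeries.constantCoeff (F.eval (PowerSeries.C r)) = (redX F).eval r := by
  unfold redX
  simp [← Polynomial.eval₂_hom, eval_map]

/-- tests in the Laurent series field -/
theorem testA {M : ℕ} (hM : Even M) {f : BB} (hf : PosA M f) {l : ℕ} {F : BB} (hF : bet M f = tX ^ l * F)
    (α : PowerSeries ℝ →+* LL) (hα : α PowerSeries.X ≠ 0) (r : ℝ) (h0 : 0 ≤ r) (h1 : r ≤ 1) :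
    0 < α PowerSeries.X ^ l * α (F.eval (PowerSeries.C r)) := by
  have hr0 : 0 ≤ rc α r := by
    rcases h0.eq_or_lt with rfl | h
    · simp [rc]
    · exact (rc_pos α h).le
  have hr1 : rc α r ≤ 1 := by
    rcases h1.eq_or_lt with rfl | h
    · simp [rc]
    · have := (rc_lt α h).le
      simpa [rc] using this
  have := hf LL (eval₂RingHom α (α PowerSeries.X ^ M * rc α r)) (by simpa [tX] using hα)
    (by simp [tY]; exact mul_nonneg (hM.pow_nonneg _) hr0)
    (by simp [tY, tX]; exact mul_le_of_le_one_right (hM.pow_nonneg _) hr1)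
  rw [coe_eval₂RingHom, ← eval2_bet, hF, eval₂_mul, eval₂_pow] at this
  rw [← Polynomial.eval₂_at_apply]
  simpa [tX, rc] using this

theorem testA_nonneg {M : ℕ} (hM : Even M) {f : BB} (hf : PosA M f) {l : ℕ} {F : BB} (hF : bet M f = tX ^ l * F)
    (r : ℝ) (h0 : 0 ≤ r) (h1 : r ≤ 1) : 0 ≤ (redX F).eval r := by
  by_contra hn
  push Not at hn
  have := testA hM hf hF psLL psLL_X_pos.ne' r h0 h1
  have h2 := (pos_iff_pos_of_mul_pos this).1 (pow_pos psLL_X_pos l)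
  have h3 := ps_pos psLL (a := - F.eval (PowerSeries.C r)) (by rw [map_neg, const_eval]; linarith)
  rw [map_neg] at h3
  linarith

theorem exists_nonroot (φ : ℝ[X]) (h : φ ≠ 0) : ∃ r : ℝ, 0 < r ∧ r < 1 ∧ φ.eval r ≠ 0 := by
  have : (Set.Ioo (0:ℝ) 1 \ {x | φ.IsRoot x}).Infinite :=
    (Set.Ioo_infinite one_pos).diff (Polynomial.finite_setOf_isRoot h)
  obtain ⟨r, hr, hr2⟩ := this.nonempty
  exact ⟨r, hr.1, hr.2, hr2⟩

theorem testA_even {M : ℕ} (hM : Even M) {f : BB} (hf : PosA M f) {l : ℕ} {F : BB} (hF : bet M f = tX ^ l * F)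
    (hφ : redX F ≠ 0) : Even l := by
  obtain ⟨r, h0, h1, h2⟩ := exists_nonroot _ hφ
  have h3 := testA_nonneg hM hf hF r h0.le h1.le
  set α : PowerSeries ℝ →+* LL := psLL.comp (PowerSeries.rescale (-1)) with hα
  have hX : α PowerSeries.X = - psLL PowerSeries.X := by
    simp [hα, PowerSeries.rescale_X]
  have h5 : α PowerSeries.X < 0 := by rw [hX]; have := psLL_X_pos; linarith
  have h4 := testA hM hf hF α h5.ne r h0.le h1.le
  have h6 := ps_pos α (a := F.eval (PowerSeries.C r)) (by rw [const_eval]; exact lt_of_le_of_ne h3 (Ne.symm h2))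
  by_contra ho
  rw [Nat.not_even_iff_odd] at ho
  have := ho.pow_neg h5
  have := mul_neg_of_neg_of_pos this h6
  exact lt_asymm h4 this

theorem split1 {M : ℕ} (hM : Even M) {f : BB} (hf : PosA M f) {l : ℕ} {F : BB} (hF : bet M f = tX ^ l * F)
    (hφ : redX F ≠ 0) (z0 : ℝ) (hz0 : 0 ≤ z0) (hz1 : z0 < 1) (hroot : (redX F).eval z0 = 0) :
    ∃ f1 f2 : BB, f = f1 * f2 ∧ f2.natDegree < f.natDegree ∧
      (∀ (F : Type) [Field F] [LinearOrder F] [IsStrictOrderedRing F]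
        (θ : BB →+* F), θ tX ≠ 0 → 0 ≤ θ tY → 0 ≤ θ f1) := by
  set cz : PowerSeries ℝ := PowerSeries.C z0 with hcz
  have hred : redX (F.comp (X + C cz)) = (redX F).comp (X + C z0) := by
    simp [redX, Polynomial.map_comp, hcz]
  obtain ⟨G1, G2, hG, hG1, hG1r, hG2⟩ := cluster (F.comp (X + C cz)) (by
    rw [hred]
    intro h
    apply hφ
    have := congrArg (fun q => q.comp (X - C z0)) h
    simpa [comp_assoc] using this)
  set r := G1.natDegree with hr
  have hval : ∀ x, (redX F).eval (x + z0) = x ^ r * (redX G2).eval x := by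
    intro x
    have h1 : ((redX F).comp (X + C z0)).eval x = (redX G1 * redX G2).eval x := by
      rw [← hred, hG, map_mul]
    rw [hG1r] at h1
    simpa using h1
  have hr1 : 1 ≤ r := by
    by_contra hn
    have : r = 0 := by omega
    have h2 := hval 0
    rw [zero_add, hroot, this, pow_zero, one_mul] at h2
    exact hG2 h2.symm
  have hnn := testA_nonneg hM hf hF
  have hleven := testA_even hM hf hF hφ
  have hcont : Continuous (fun x => (redX G2).eval x) := (redX G2).continuous
  have hG2pos : 0 < (redX G2).eval 0 := by
    by_contra hn
    have hlt : (redX G2).eval 0 < 0 := lt_of_le_of_ne (not_lt.1 hn) hG2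
    have hev : ∀ᶠ x in nhds (0:ℝ), (redX G2).eval x < 0 := hcont.continuousAt.eventually_lt continuousAt_const hlt
    have hev2 : ∀ᶠ x in nhds (0:ℝ), x < 1 - z0 := eventually_lt_nhds (by linarith)
    obtain ⟨x, ⟨h1, h2⟩, h3⟩ := (((hev.and hev2).filter_mono nhdsWithin_le_nhds).and
      (self_mem_nhdsWithin : Set.Ioi (0:ℝ) ∈ nhdsWithin 0 (Set.Ioi 0))).exists
    have h3' : (0:ℝ) < x := h3
    have := hnn (x + z0) (by linarith) (by linarith)
    rw [hval] at this
    have := mul_neg_of_pos_of_neg (pow_pos h3' r) h1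
    linarith
  have hreven : 0 < z0 → Even r := by
    intro hz
    by_contra ho
    rw [Nat.not_even_iff_odd] at ho
    have hev : ∀ᶠ x in nhds (0:ℝ), 0 < (redX G2).eval x := continuousAt_const.eventually_lt hcont.continuousAt hG2pos
    have hev2 : ∀ᶠ x in nhds (0:ℝ), -z0 < x := eventually_gt_nhds (by linarith)
    obtain ⟨x, ⟨h1, h2⟩, h3⟩ := (((hev.and hev2).filter_mono nhdsWithin_le_nhds).and
      (self_mem_nhdsWithin : Set.Iio (0:ℝ) ∈ nhdsWithin 0 (Set.Iio 0))).exists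
    have h3' : x < (0:ℝ) := h3
    have := hnn (x + z0) (by linarith) (by linarith)
    rw [hval] at this
    have := mul_neg_of_neg_of_pos (ho.pow_neg h3') h1
    linarith
  set F1 := G1.comp (X - C cz) with hF1
  set F2 := G2.comp (X - C cz) with hF2
  have hFF : F = F1 * F2 := by
    rw [hF1, hF2, ← mul_comp, ← hG, comp_assoc]; simp
  have hF1m : F1.Monic := hG1.comp (monic_X_sub_C _) (by simp)
  have hF1d : F1.natDegree = r := by rw [hF1, natDegree_comp]; simp [hr]
  set s : PowerSeries ℝ := PowerSeries.X ^ M with hs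
  set f1 := F1.scaleRoots s with hf1
  have hf1m : f1.Monic := by rw [hf1, monic_scaleRoots_iff]; exact hF1m
  have hf1d : f1.natDegree = r := by rw [hf1, natDegree_scaleRoots, hF1d]
  have hbf1 : bet M f1 = C s ^ r * F1 := by
    have := scaleRoots_eval₂_mul (p := F1) (C : PowerSeries ℝ →+* BB) X s
    rw [hF1d, eval₂_C_X] at this
    exact this
  have hdiv := modByMonic_add_div f f1
  have hrem : f %ₘ f1 = 0 := by
    apply bet_inj M
    have h1 : bet M f = bet M (f %ₘ f1) + bet M f1 * bet M (f /ₘ f1) := by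
      conv_lhs => rw [← hdiv]
      simp [bet]
    have h2 : F1 ∣ bet M (f %ₘ f1) := by
      refine ⟨tX ^ l * F2 - C s ^ r * bet M (f /ₘ f1), ?_⟩
      rw [hF, hbf1, hFF] at h1
      linear_combination -h1
    by_contra hne
    have h3 := natDegree_le_of_dvd h2 hne
    have h4 : (bet M (f %ₘ f1)).natDegree ≤ (f %ₘ f1).natDegree := by
      refine natDegree_le_iff_coeff_eq_zero.2 fun j hj => ?_
      rw [bet_coeff, coeff_eq_zero_of_natDegree_lt hj, zero_mul]
    have h5 := natDegree_modByMonic_lt f hf1m (by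
      intro h; rw [h] at hf1d; simp at hf1d; omega)
    omega
  have hff : f = f1 * (f /ₘ f1) := by
    rw [hrem, zero_add] at hdiv; exact hdiv.symm
  have hf0 : f ≠ 0 := by
    rintro rfl
    apply hφ
    have : tX ^ l * F = 0 := by rw [← hF]; simp [bet]
    rcases mul_eq_zero.1 this with h | h
    · exact absurd h (pow_ne_zero _ tX_ne)
    · simp [h]
  refine ⟨f1, f /ₘ f1, hff, ?_, ?_⟩
  · have h2 : f /ₘ f1 ≠ 0 := by intro h; rw [h, mul_zero] at hff; exact hf0 hff
    have := natDegree_mul hf1m.ne_zero h2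
    rw [← hff] at this
    omega
  · intro 𝔽 _ _ _ θ hX hY
    set α := θ.comp (C : PowerSeries ℝ →+* BB) with hα
    have hαX : α PowerSeries.X = θ tX := rfl
    have hMpos : 0 < θ tX ^ M := hM.pow_pos hX
    set z := θ tY / θ tX ^ M with hz
    set w := z - rc α z0 with hw
    have hYz : θ tY = α PowerSeries.X ^ M * z := by
      rw [hαX, hz]; field_simp
    have hzn : 0 ≤ z := div_nonneg hY hMpos.le
    have e1 : ∀ G : BB, eval₂ α z (G.comp (X - C cz)) = eval₂ α w G := by
      intro G
      rw [eval₂_comp]; simp [hw, rc, hcz]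
    have e2 : θ f1 = (θ tX ^ M) ^ r * eval₂ α w G1 := by
      rw [hom_eval2 θ f1, hYz, ← eval2_bet, hbf1, eval₂_mul, hF1, e1, eval₂_pow, eval₂_C, hs, map_pow, hαX]
    have e3 : θ f = θ tX ^ l * (eval₂ α w G1 * eval₂ α w G2) := by
      rw [hom_eval2 θ f, hYz, ← eval2_bet, hF, hFF, eval₂_mul, eval₂_mul, hF1, hF2, e1, e1, eval₂_pow, show eval₂ α z tX = θ tX from eval₂_C _ _]
    rw [e2]
    refine mul_nonneg (pow_pos hMpos r).le ?_
    rcases dich α G1 hG1 hG1r w with h | h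
    · apply h
      rcases hz0.eq_or_lt with h0 | h0
      · rw [hw, ← h0]
        simp [rc]
        exact pow_nonneg hzn _
      · exact (hreven h0).pow_nonneg _
    · have h1 := h (1 - z0) (by linarith)
      have h2 := le_abs_self w
      have h3 : rc α (1 - z0) = 1 - rc α z0 := by simp [rc]
      have h4 : z ≤ 1 := by rw [h3] at h1; linarith
      have h5 := hf 𝔽 θ hX hY (by rw [hYz, hαX]; exact mul_le_of_le_one_right hMpos.le h4)
      rw [e3] at h5
      have h6 := (pos_iff_pos_of_mul_pos h5).1 (hleven.pow_pos hX)
      exact ((pos_iff_pos_of_mul_pos h6).2 (eval_infi α h G2 hG2pos)).le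

end PS
end

section
set_option linter.all false
set_option maxHeartbeats 400000
namespace PS
open Polynomial

/-- reflection Y ↦ X^M - Y -/
noncomputable def rho (M : ℕ) : BB →+* BB := Polynomial.compRingHom (C (PowerSeries.X ^ M) - X)

theorem rho_apply (M : ℕ) (f : BB) : rho M f = f.comp (C (PowerSeries.X ^ M) - X) := rfl
theorem rho_rho (M : ℕ) (f : BB) : rho M (rho M f) = f := by
  rw [rho_apply, rho_apply, comp_assoc]; simp
theorem rho_tX (M : ℕ) : rho M tX = tX := by rw [rho_apply]; simp [tX]
theorem rho_tY (M : ℕ) : rho M tY = tX ^ M - tY := by rw [rho_apply]; simp [tX, tY]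
theorem rho_deg (M : ℕ) (f : BB) : (rho M f).natDegree = f.natDegree := by
  rw [rho_apply, natDegree_comp]
  rw [natDegree_sub_eq_right_of_natDegree_lt (by simp [-map_pow])]; simp

theorem rho_pos {M : ℕ} {f : BB} (hf : PosA M f) : PosA M (rho M f) := by
  intro F _ _ _ θ h1 h2 h3
  exact hf F (θ.comp (rho M)) (by simpa [rho_tX] using h1) (by simpa [rho_tY] using h3)
    (by simpa [rho_tY, rho_tX] using h2)

theorem rho_bet {M : ℕ} {f : BB} {l : ℕ} {F : BB} (hF : bet M f = tX ^ l * F) :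
    bet M (rho M f) = tX ^ l * F.comp (1 - X) := by
  have : bet M (rho M f) = (bet M f).comp (1 - X) := by
    unfold bet
    rw [rho_apply, comp_assoc, comp_assoc]
    congr 1
    simp only [sub_comp, C_comp, X_comp, mul_comp]
    ring
  rw [this, hF, mul_comp]
  simp [tX]

theorem split_any {M : ℕ} (hM : Even M) {f : BB} (hf : PosA M f) {l : ℕ} {F : BB} (hF : bet M f = tX ^ l * F)
    (hφ : redX F ≠ 0) (z0 : ℝ) (hz0 : 0 ≤ z0) (hz1 : z0 ≤ 1) (hroot : (redX F).eval z0 = 0)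
    {T : Subsemiring BB} (hT : IsPre T) (hY : tY ∈ T) (hW : tX ^ M - tY ∈ T) :
    ∃ f1 f2 : BB, f = f1 * f2 ∧ f2.natDegree < f.natDegree ∧ f1 ∈ T ∧ PosA M f2 := by
  rcases hz1.lt_or_eq with h1 | rfl
  · obtain ⟨f1, f2, h2, h3, h4⟩ := split1 hM hf hF hφ z0 hz0 h1 hroot
    refine ⟨f1, f2, h2, h3, thm1 f1 (fun F _ _ _ θ => h4 F θ) T hT hY, ?_⟩
    intro F _ _ _ θ g1 g2 g3
    have h5 := hf F θ g1 g2 g3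
    rw [h2, map_mul] at h5
    exact pos_of_mul_pos_right h5 (h4 F θ g1 g2)
  · have hred : redX (F.comp (1 - X)) = (redX F).comp (1 - X) := by
      simp [redX, Polynomial.map_comp]
    obtain ⟨f1, f2, h2, h3, h4⟩ := split1 hM (rho_pos hf) (rho_bet hF) (by
      rw [hred]
      intro h
      apply hφ
      have := congrArg (fun q => q.comp (1 - X)) h
      simpa [comp_assoc] using this) 0 le_rfl one_pos (by rw [hred]; simpa using hroot)
    have e : f = rho M f1 * rho M f2 := by
      rw [← map_mul, ← h2, rho_rho]
    refine ⟨rho M f1, rho M f2, e, by rw [rho_deg] at h3 ⊢; exact h3, ?_, ?_⟩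
    · have := thm1 f1 (fun F _ _ _ θ => h4 F θ) (T.comap (rho M)) (fun a => by
        rw [Subsemiring.mem_comap, map_pow]; exact hT _) (by rw [Subsemiring.mem_comap, rho_tY]; exact hW)
      exact this
    · intro F _ _ _ θ g1 g2 g3
      have h5 := hf F θ g1 g2 g3
      rw [e, map_mul] at h5
      refine pos_of_mul_pos_right h5 ?_
      exact h4 F (θ.comp (rho M)) (by simpa [rho_tX] using g1) (by simpa [rho_tY] using g3)

theorem baseA {M : ℕ} (hM : Even M) (hM1 : 1 ≤ M) {f : BB} {l : ℕ} (hl : Even l) {F : BB}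
    (hF : bet M f = tX ^ l * F) (hpos : ∀ x ∈ Set.Icc (0:ℝ) 1, 0 < (redX F).eval x)
    {T : Subsemiring BB} (hT : IsPre T) (hC : Clo T) (hY : tY ∈ T) (hW : tX ^ M - tY ∈ T) : f ∈ T := by
  have hco : ∀ j, f.coeff j * PowerSeries.X ^ (M * j) = PowerSeries.X ^ l * F.coeff j := by
    intro j
    rw [← bet_coeff, hF, tX, ← C_pow, coeff_C_mul]
  set n := l / M with hn
  have hnl : M * n ≤ l := Nat.mul_div_le l M
  have hX0 : (PowerSeries.X : PowerSeries ℝ) ≠ 0 := PowerSeries.X_ne_zero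
  have hlow : ∀ j ≤ n, f.coeff j = PowerSeries.X ^ (l - M * n) * (PowerSeries.X ^ M) ^ (n - j) * F.coeff j := by
    intro j hj
    have h1 := hco j
    have h2 : l = M * j + ((l - M * n) + M * (n - j)) := by
      have : M * n = M * j + M * (n - j) := by rw [← Nat.mul_add]; congr 1; omega
      omega
    apply mul_right_cancel₀ (pow_ne_zero (M * j) hX0)
    rw [h1]
    conv_lhs => rw [h2, pow_add, pow_add, pow_mul _ M (n - j)]
    ring
  have hgt : ∀ j, n < j → l < M * j := by
    intro j hj
    have := Nat.lt_mul_div_succ l (show 0 < M by omega)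
    calc l < M * (l / M + 1) := this
      _ ≤ M * j := Nat.mul_le_mul_left _ hj
  have hhigh : ∀ j, n < j → F.coeff j = PowerSeries.X ^ (M * j - l) * f.coeff j := by
    intro j hj
    have h1 := hco j
    have h2 : M * j = l + (M * j - l) := by have := hgt j hj; omega
    apply mul_left_cancel₀ (pow_ne_zero l hX0)
    rw [← h1]
    conv_lhs => rw [h2, pow_add]
    ring
  have hdeg : (redX F).natDegree ≤ n := by
    refine natDegree_le_iff_coeff_eq_zero.2 fun j hj => ?_
    have : M * j - l ≠ 0 := by have := hgt j hj; omega
    simp [redX, hhigh j hj, this]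
  set v := tY with hv
  set w := tX ^ M - tY with hw
  have hvw : v + w = tX ^ M := by rw [hv, hw]; ring
  have hch : ∀ j, ∃ c : ℝ, 0 ≤ c ∧ 0 < c + PowerSeries.constantCoeff (f.coeff j) := fun j =>
    ⟨|PowerSeries.constantCoeff (f.coeff j)| + 1, by positivity, by
      have := neg_abs_le (PowerSeries.constantCoeff (f.coeff j)); linarith⟩
  choose c hc0 hc1 using hch
  set D := max f.natDegree n + 1 with hD
  set hi := Finset.Ico (n + 1) D with hhi
  have hfsum : f = ∑ j ∈ Finset.range D, C (f.coeff j) * tY ^ j := by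
    conv_lhs => rw [f.as_sum_range' D (by omega)]
    refine Finset.sum_congr rfl fun j _ => ?_
    rw [← C_mul_X_pow_eq_monomial]; rfl
  rw [← Finset.sum_range_add_sum_Ico _ (show n + 1 ≤ D by omega)] at hfsum
  set a : ℕ → BB := fun j => C (F.coeff j) - if j = 0 then ∑ i ∈ hi, rr (c i) * tX ^ (M * i - l) else 0 with ha
  have hsum := hom_unit hT hC hY hW (redX F) hpos n hdeg a (by
    intro j
    have h0 : e0 (∑ i ∈ hi, rr (c i) * tX ^ (M * i - l)) = 0 := by
      rw [map_sum]
      refine Finset.sum_eq_zero fun i hi' => ?_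
      have := hgt i (by rw [hhi, Finset.mem_Ico] at hi'; omega)
      rw [map_mul, map_pow, e0_tX, zero_pow (by omega), mul_zero]
    have h1 : e0 (C (F.coeff j)) = (redX F).coeff j := by simp [redX]
    by_cases hj : j = 0
    · simp only [ha, hj, if_true, map_sub, h0, sub_zero]; rw [← hj]; exact h1
    · simp only [ha, hj, if_false, sub_zero]; exact h1)
  have hsq : tX ^ (l - M * n) ∈ T := by
    have : Even (l - M * n) := by
      apply (Nat.even_sub hnl).2
      simp [hl, hM]
    obtain ⟨k, hk⟩ := this
    rw [hk, ← two_mul, mul_comm 2 k, pow_mul]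
    exact hT _
  have key : f = (∑ j ∈ hi, ((rr (c j) + C (f.coeff j)) * v ^ j + rr (c j) * ((v + w) ^ j - v ^ j)))
      + tX ^ (l - M * n) * ∑ j ∈ Finset.range (n + 1), a j * (v + w) ^ (n - j) * v ^ j := by
    have e1 : ∑ j ∈ Finset.range (n + 1), a j * (v + w) ^ (n - j) * v ^ j =
        ∑ j ∈ Finset.range (n + 1), C (F.coeff j) * (v + w) ^ (n - j) * v ^ j
          - (∑ i ∈ hi, rr (c i) * tX ^ (M * i - l)) * (v + w) ^ n := by
      have : ∀ j, a j * (v + w) ^ (n - j) * v ^ j = C (F.coeff j) * (v + w) ^ (n - j) * v ^ j -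
          if j = 0 then (∑ i ∈ hi, rr (c i) * tX ^ (M * i - l)) * (v + w) ^ n else 0 := by
        intro j
        by_cases hj : j = 0
        · subst hj; simp [ha, sub_mul]
        · simp [ha, hj]
      simp only [this, Finset.sum_sub_distrib]
      congr 1
      rw [Finset.sum_ite_eq']; simp
    have e2 : tX ^ (l - M * n) * ((∑ i ∈ hi, rr (c i) * tX ^ (M * i - l)) * (v + w) ^ n) =
        ∑ i ∈ hi, rr (c i) * (v + w) ^ i := by
      rw [hvw, Finset.sum_mul, Finset.mul_sum]
      refine Finset.sum_congr rfl fun i hi' => ?_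
      have h3 := hgt i (by rw [hhi, Finset.mem_Ico] at hi'; omega)
      have : M * i = (l - M * n) + (M * i - l) + M * n := by omega
      rw [← pow_mul, ← pow_mul]
      conv_rhs => rw [this, pow_add, pow_add]
      ring
    have e3 : tX ^ (l - M * n) * ∑ j ∈ Finset.range (n + 1), C (F.coeff j) * (v + w) ^ (n - j) * v ^ j
        = ∑ j ∈ Finset.range (n + 1), C (f.coeff j) * tY ^ j := by
      rw [Finset.mul_sum]
      refine Finset.sum_congr rfl fun j hj => ?_
      rw [hlow j (by simpa [Nat.lt_succ_iff] using hj), hvw, hv]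
      simp only [tX, C_mul, C_pow]
      ring
    rw [e1, mul_sub, e2, e3]
    conv_lhs => rw [hfsum]
    have e4 : ∑ j ∈ hi, ((rr (c j) + C (f.coeff j)) * v ^ j + rr (c j) * ((v + w) ^ j - v ^ j))
      = ∑ j ∈ hi, C (f.coeff j) * tY ^ j + ∑ i ∈ hi, rr (c i) * (v + w) ^ i := by
      rw [← Finset.sum_add_distrib]
      refine Finset.sum_congr rfl fun j _ => ?_
      rw [hv]; ring
    rw [e4]
    ring
  rw [key]
  refine T.add_mem (T.sum_mem fun j _ => T.add_mem (T.mul_mem ?_ (pow_mem hY j))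
    (T.mul_mem (rr_mem hT (hc0 j)) (pow_sub_mem hY hW j))) (T.mul_mem hsq hsum)
  apply unit_mem hT hC
  rw [map_add, e0_rr, e0_C]
  exact hc1 j

theorem sandA {M : ℕ} (hM : Even M) (hM1 : 1 ≤ M) {T : Subsemiring BB} (hT : IsPre T) (hC : Clo T)
    (hY : tY ∈ T) (hW : tX ^ M - tY ∈ T) : ∀ (n : ℕ) (f : BB), f.natDegree < n → PosA M f → f ∈ T := by
  intro n
  induction n with
  | zero => intro f h; omega
  | succ n ih =>
    intro f hn hf
    have hf0 : f ≠ 0 := by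
      rintro rfl
      have := hf LL (eval₂RingHom psLL 0) (by simpa [tX] using psLL_X_pos.ne') (by simp [tY])
        (by simp [tY, tX, psLL_X_pos.le])
      simp at this
    obtain ⟨l, F, hF, hφ⟩ := pull_tX (bet M f) (fun h => hf0 (bet_inj M f h))
    by_cases hroot : ∃ z0, 0 ≤ z0 ∧ z0 ≤ 1 ∧ (redX F).eval z0 = 0
    · obtain ⟨z0, h0, h1, h2⟩ := hroot
      obtain ⟨f1, f2, e, h3, h4, h5⟩ := split_any hM hf hF hφ z0 h0 h1 h2 hT hY hW
      rw [e]
      exact T.mul_mem h4 (ih f2 (by omega) h5)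
    · push Not at hroot
      refine baseA hM hM1 (testA_even hM hf hF hφ) hF (fun x hx => ?_) hT hC hY hW
      exact lt_of_le_of_ne (testA_nonneg hM hf hF x hx.1 hx.2) (Ne.symm (hroot x hx.1 hx.2))

end PS
end

section
set_option linter.all false
set_option maxHeartbeats 400000
namespace PS
open Polynomial

/-- positivity on the half sandwich region -/
def PosB (M : ℕ) (f : BB) : Prop := ∀ (F : Type) [Field F] [LinearOrder F] [IsStrictOrderedRing F]
  (θ : BB →+* F), 0 < θ tX → 0 ≤ θ tY → θ tY ≤ θ tX ^ M → 0 < θ f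

/-- X ↦ X² on power series -/
noncomputable def sq0 : PowerSeries ℝ →+* PowerSeries ℝ := (PowerSeries.expand 2 two_ne_zero).toRingHom
/-- X ↦ X² -/
noncomputable def sqX : BB →+* BB := Polynomial.mapRingHom sq0
/-- even part -/
noncomputable def ev0 : PowerSeries ℝ →+ PowerSeries ℝ where
  toFun a := PowerSeries.mk fun n => PowerSeries.coeff (2 * n) a
  map_zero' := by ext; simp
  map_add' a b := by ext; simp

theorem ev0_coeff (a : PowerSeries ℝ) (n : ℕ) : PowerSeries.coeff n (ev0 a) = PowerSeries.coeff (2 * n) a := by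
  simp [ev0]

theorem sq0_coeff (a : PowerSeries ℝ) (n : ℕ) : PowerSeries.coeff (2 * n) (sq0 a) = PowerSeries.coeff n a :=
  PowerSeries.coeff_expand_mul 2 two_ne_zero a n
theorem sq0_coeff_odd (a : PowerSeries ℝ) (n : ℕ) : PowerSeries.coeff (2 * n + 1) (sq0 a) = 0 :=
  PowerSeries.coeff_expand_of_not_dvd 2 two_ne_zero a (by omega)
theorem sq0_X : sq0 PowerSeries.X = PowerSeries.X ^ 2 := PowerSeries.expand_X 2 two_ne_zero

noncomputable def evX : BB →+ BB where
  toFun b := b.sum fun n a => monomial n (ev0 a)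
  map_zero' := by simp
  map_add' a b := by
    rw [sum_add_index]
    · simp
    · intros; simp

theorem evX_coeff (b : BB) (n : ℕ) : (evX b).coeff n = ev0 (b.coeff n) := by
  induction b using Polynomial.induction_on' with
  | add p q hp hq => rw [map_add, coeff_add, hp, hq, coeff_add, map_add]
  | monomial m a =>
    change (sum (monomial m a) fun n a => monomial n (ev0 a)).coeff n = _
    rw [sum_monomial_index _ _ (by simp), coeff_monomial, coeff_monomial]
    split <;> simp

theorem sqX_coeff (b : BB) (n : ℕ) : (sqX b).coeff n = sq0 (b.coeff n) := by
  simp [sqX]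

theorem evX_eq (u w : BB) : evX (sqX u + tX * sqX w) = u := by
  ext1 n
  rw [evX_coeff, coeff_add, tX, coeff_C_mul, sqX_coeff, sqX_coeff]
  ext k
  rw [ev0_coeff, map_add, sq0_coeff]
  cases k with
  | zero => simp
  | succ k =>
    rw [show 2 * (k + 1) = (2 * k + 1) + 1 by ring, PowerSeries.coeff_succ_X_mul, sq0_coeff_odd, add_zero]

theorem sqX_rep (b : BB) : ∃ u w, b = sqX u + tX * sqX w := by
  induction b using Polynomial.induction_on' with
  | add p q hp hq =>
    obtain ⟨u, w, rfl⟩ := hp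
    obtain ⟨u', w', rfl⟩ := hq
    exact ⟨u + u', w + w', by simp only [map_add]; ring⟩
  | monomial m a =>
    refine ⟨monomial m (ev0 a), monomial m (PowerSeries.mk fun n => PowerSeries.coeff (2 * n + 1) a), ?_⟩
    have : a = sq0 (ev0 a) + PowerSeries.X * sq0 (PowerSeries.mk fun n => PowerSeries.coeff (2 * n + 1) a) := by
      ext n
      rcases Nat.even_or_odd' n with ⟨k, rfl | rfl⟩
      · rw [map_add, sq0_coeff, ev0_coeff]
        cases k with
        | zero => simp
        | succ k =>
          rw [show 2 * (k + 1) = (2 * k + 1) + 1 by ring, PowerSeries.coeff_succ_X_mul, sq0_coeff_odd, add_zero]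
      · rw [map_add, sq0_coeff_odd, PowerSeries.coeff_succ_X_mul, sq0_coeff]; simp
    conv_lhs => rw [this]
    simp [sqX, tX, C_mul_monomial]

theorem evX_II {b : BB} {N : ℕ} (h : b ∈ II ^ (2 * N)) : evX b ∈ II ^ N := by
  rw [mem_IIpow] at h ⊢
  intro j
  rw [evX_coeff, PowerSeries.X_pow_dvd_iff]
  intro m hm
  rw [ev0_coeff]
  exact PowerSeries.X_pow_dvd_iff.1 (h j) _ (by omega)

theorem sandB {M : ℕ} (hM1 : 1 ≤ M) {T : Subsemiring BB} (hT : IsPre T) (hC : Clo T)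
    (hX : tX ∈ T) (hY : tY ∈ T) (hW : tX ^ M - tY ∈ T) (f : BB) (hf : PosB M f) : f ∈ T := by
  set S : Set BB := {tY, tX ^ M - tY} with hS
  set T0 : Subsemiring BB := Subsemiring.closure (sqX '' S ∪ {a | ∃ c, a = c ^ 2}) with hT0
  have hpre : IsPre T0 := fun a => Subsemiring.subset_closure (Or.inr ⟨a, rfl⟩)
  have sX : sqX tX = tX ^ 2 := by simp [sqX, tX, sq0_X]
  have sY : sqX tY = tY := by simp [sqX, tY]
  have h1 : sqX f ∈ hull T0 := by
    refine sandA (M := 2 * M) (by simp) (by omega) (hull_pre hpre) (hull_clo _)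
      (le_hull _ (Subsemiring.subset_closure (Or.inl ⟨tY, by simp [hS], sY⟩)))
      (le_hull _ (Subsemiring.subset_closure (Or.inl ⟨tX ^ M - tY, by simp [hS], by
        rw [map_sub, map_pow, sX, sY, pow_mul]⟩))) _ (sqX f) (Nat.lt_succ_self _) ?_
    intro F _ _ _ θ g1 g2 g3
    exact hf F (θ.comp sqX) (by simp [sX]; positivity) (by simpa [sY] using g2)
      (by simpa [sY, sX, pow_mul] using g3)
  apply hC
  intro N
  obtain ⟨τ, hτ, h2⟩ := h1 (2 * N)
  refine ⟨evX τ, ?_, ?_⟩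
  · refine parity sqX tX tX sX.symm sqX_rep evX evX_eq T hT hX S ?_ τ hτ
    rintro x (rfl | rfl)
    · exact hY
    · exact hW
  · have := evX_II h2
    rw [map_sub] at this
    have h3 := evX_eq f 0
    rw [map_zero, mul_zero, add_zero] at h3
    rwa [h3] at this

end PS
end

section
set_option linter.all false
set_option maxHeartbeats 400000
namespace PS
open Polynomial

/-- the ring hom X ↦ 0, Y ↦ y -/
noncomputable def thy (y : LL) : BB →+* LL :=
  eval₂RingHom ((psLL.comp PowerSeries.C).comp PowerSeries.constantCoeff) y

theorem thy_red (y : LL) (b : BB) : thy y b = eval₂ (psLL.comp PowerSeries.C) y (redX b) := by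
  unfold thy redX
  rw [coe_eval₂RingHom, coe_mapRingHom, eval₂_map]

theorem thy_tX (y : LL) : thy y tX = 0 := by simp [thy, tX]
theorem thy_tY (y : LL) : thy y tY = y := by simp [thy, tY]
theorem thy_C (y : LL) : (thy y).comp C = (psLL.comp PowerSeries.C).comp PowerSeries.constantCoeff := by
  ext; simp [thy]

theorem thy_infi (y : LL) (h : |y| = psLL PowerSeries.X) : Infi ((thy y).comp C) y := by
  intro ε hε
  rw [h]
  have := ps_pos psLL (a := PowerSeries.C ε - PowerSeries.X) (by simpa using hε)
  rw [map_sub] at this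
  have e : rc ((thy y).comp C) ε = psLL (PowerSeries.C ε) := by simp [rc, thy_C]
  rw [e]
  linarith

theorem infi_thm_aux (f : BB) (hf : 0 < thy (psLL PowerSeries.X) f) :
    ∃ F1 F2 : BB, f = F1 * F2 ∧ F1.Monic ∧ redX F1 = X ^ F1.natDegree ∧ 0 < (redX F2).eval 0 := by
  have h0 : redX f ≠ 0 := by
    intro h
    rw [thy_red, h] at hf
    simp at hf
  obtain ⟨F1, F2, h1, h2, h3, h4⟩ := cluster f h0
  refine ⟨F1, F2, h1, h2, h3, ?_⟩
  by_contra hn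
  have hlt : (redX F2).eval 0 < 0 := lt_of_le_of_ne (not_lt.1 hn) h4
  have h5 := eval_infi _ (thy_infi (psLL PowerSeries.X) (abs_of_pos psLL_X_pos)) (-F2) (by
    rw [map_neg, eval_neg]; linarith)
  have h6 : thy (psLL PowerSeries.X) (-F2) = eval₂ ((thy (psLL PowerSeries.X)).comp C) (psLL PowerSeries.X) (-F2) := by
    conv_lhs => rw [hom_eval2, thy_tY]
  rw [← h6, map_neg] at h5
  have h7 : 0 < thy (psLL PowerSeries.X) F1 := by
    rw [thy_red, h3]; simp only [eval₂_pow, eval₂_X]; exact pow_pos psLL_X_pos _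
  rw [h1, map_mul] at hf
  have := (pos_iff_pos_of_mul_pos hf).1 h7
  linarith

theorem type1 {T : Subsemiring BB} (hT : IsPre T) (hC : Clo T) (hY : tY ∈ T) (f : BB)
    (hf : ∀ (F : Type) [Field F] [LinearOrder F] [IsStrictOrderedRing F] (θ : BB →+* F),
      Infi (θ.comp C) (θ tY) → 0 ≤ θ tY → (θ tX ≠ 0 ∨ θ tY ≠ 0) → 0 < θ f) : f ∈ T := by
  obtain ⟨F1, F2, h1, h2, h3, h4⟩ := infi_thm_aux f (hf LL (thy (psLL PowerSeries.X))
    (by rw [thy_tY]; exact thy_infi _ (abs_of_pos psLL_X_pos)) (by rw [thy_tY]; exact psLL_X_pos.le)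
    (Or.inr (by rw [thy_tY]; exact psLL_X_pos.ne')))
  rw [h1]
  refine T.mul_mem (thm1 F1 ?_ T hT hY) (unit_mem hT hC h4)
  intro F _ _ _ θ hX hY
  have e : ∀ G, θ G = eval₂ (θ.comp C) (θ tY) G := hom_eval2 θ
  rw [e F1]
  rcases dich (θ.comp C) F1 h2 h3 (θ tY) with h | h
  · exact h (pow_nonneg hY _)
  · have h5 := hf F θ h hY (Or.inl hX)
    have h6 := eval_infi _ h F2 h4
    rw [h1, map_mul, e F1, e F2] at h5
    exact ((pos_iff_pos_of_mul_pos h5).2 h6).le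

theorem type0 {T : Subsemiring BB} (hT : IsPre T) (hC : Clo T) (f : BB)
    (hf : ∀ (F : Type) [Field F] [LinearOrder F] [IsStrictOrderedRing F] (θ : BB →+* F),
      Infi (θ.comp C) (θ tY) → (θ tX ≠ 0 ∨ θ tY ≠ 0) → 0 < θ f) : f ∈ T := by
  obtain ⟨F1, F2, h1, h2, h3, h4⟩ := infi_thm_aux f (hf LL (thy (psLL PowerSeries.X))
    (by rw [thy_tY]; exact thy_infi _ (abs_of_pos psLL_X_pos))
    (Or.inr (by rw [thy_tY]; exact psLL_X_pos.ne')))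
  have hr : Even F1.natDegree := by
    by_contra ho
    rw [Nat.not_even_iff_odd] at ho
    have hy : |-psLL PowerSeries.X| = psLL PowerSeries.X := by rw [abs_neg, abs_of_pos psLL_X_pos]
    have h5 := hf LL (thy (-psLL PowerSeries.X))
      (by rw [thy_tY]; exact thy_infi _ hy)
      (Or.inr (by rw [thy_tY]; exact neg_ne_zero.2 psLL_X_pos.ne'))
    have h6 := eval_infi _ (thy_infi _ hy) F2 h4
    have h7 : thy (-psLL PowerSeries.X) F2 = eval₂ ((thy (-psLL PowerSeries.X)).comp C) (-psLL PowerSeries.X) F2 := by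
      conv_lhs => rw [hom_eval2, thy_tY]
    rw [← h7] at h6
    have h8 : thy (-psLL PowerSeries.X) F1 < 0 := by
      rw [thy_red, h3]; simp only [eval₂_pow, eval₂_X]
      exact ho.pow_neg (neg_lt_zero.2 psLL_X_pos)
    rw [h1, map_mul] at h5
    have := mul_neg_of_neg_of_pos h8 h6
    exact lt_asymm h5 this
  rw [h1]
  refine T.mul_mem ((thm0 F1 ?_).mem hT) (unit_mem hT hC h4)
  intro F _ _ _ θ hX
  have e : ∀ G, θ G = eval₂ (θ.comp C) (θ tY) G := hom_eval2 θ
  rw [e F1]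
  rcases dich (θ.comp C) F1 h2 h3 (θ tY) with h | h
  · exact h (hr.pow_nonneg _)
  · have h5 := hf F θ h (Or.inl hX)
    have h6 := eval_infi _ h F2 h4
    rw [h1, map_mul, e F1, e F2] at h5
    exact ((pos_iff_pos_of_mul_pos h5).2 h6).le

theorem deg_aux {T : Subsemiring BB} (hT : IsPre T) (hC : Clo T) (hY : tY ∈ T) (hY2 : -tY ∈ T) (f : BB)
    (hf : ∀ (F : Type) [Field F] [LinearOrder F] [IsStrictOrderedRing F] (θ : BB →+* F),
      0 < θ tX → θ tY = 0 → 0 < θ f)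
    (hX : tX ∈ T ∨ ∀ (F : Type) [Field F] [LinearOrder F] [IsStrictOrderedRing F] (θ : BB →+* F),
      θ tX < 0 → θ tY = 0 → 0 < θ f) : f ∈ T := by
  have hYq : ∀ q, tY * q ∈ T := by
    intro q
    have : tY * q = tY * (rr (1/2) * (q + 1)) ^ 2 + (-tY) * (rr (1/2) * (q - 1)) ^ 2 := by
      have e : rr (1/2) ^ 2 * 4 = 1 := by
        rw [← map_pow, show (4:BB) = rr 4 from (map_ofNat rr 4).symm, ← map_mul, ← map_one rr]; congr 1; norm_num
      linear_combination (- tY * q) * e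
    rw [this]
    exact T.add_mem (T.mul_mem hY (hT _)) (T.mul_mem hY2 (hT _))
  have hdec : f = tY * divX f + C (f.coeff 0) := by
    conv_lhs => rw [← X_mul_divX_add f]
    rfl
  have hθ : ∀ (α : PowerSeries ℝ →+* LL), (eval₂RingHom α 0) f = α (f.coeff 0) := by
    intro α
    rw [hdec]; simp [tY]
  have h1 := hf LL (eval₂RingHom psLL 0) (by simpa [tX] using psLL_X_pos) (by simp [tY])
  rw [hθ] at h1
  have hne : f.coeff 0 ≠ 0 := by intro h; rw [h, map_zero] at h1; exact lt_irrefl _ h1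
  obtain ⟨l, u, hu, hlu⟩ : ∃ (l : ℕ) (u : PowerSeries ℝ), PowerSeries.constantCoeff u ≠ 0 ∧ f.coeff 0 = PowerSeries.X ^ l * u := by
    obtain ⟨n, a, h1, h2⟩ := WfDvdMonoid.max_power_factor hne (PowerSeries.X_prime (R := ℝ)).irreducible
    exact ⟨n, a, fun h => h1 (PowerSeries.X_dvd_iff.2 h), h2⟩
  have hupos : 0 < PowerSeries.constantCoeff u := by
    by_contra hn
    have hlt := lt_of_le_of_ne (not_lt.1 hn) hu
    have h3 := ps_pos psLL (a := -u) (by rw [map_neg]; linarith)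
    rw [hlu, map_mul, map_pow] at h1
    have := (pos_iff_pos_of_mul_pos h1).1 (pow_pos psLL_X_pos l)
    rw [map_neg] at h3
    linarith
  have hXl : tX ^ l ∈ T := by
    rcases hX with h | h
    · exact pow_mem h l
    · set α : PowerSeries ℝ →+* LL := psLL.comp (PowerSeries.rescale (-1)) with hα
      have hX : α PowerSeries.X = - psLL PowerSeries.X := by
        simp [hα, PowerSeries.rescale_X]
      have h5 : α PowerSeries.X < 0 := by rw [hX]; have := psLL_X_pos; linarith
      have h6 := h LL (eval₂RingHom α 0) (by simpa [tX] using h5) (by simp [tY])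
      rw [hθ, hlu, map_mul, map_pow] at h6
      have h7 := ps_pos α hupos
      have : Even l := by
        by_contra ho
        rw [Nat.not_even_iff_odd] at ho
        exact lt_asymm h6 (mul_neg_of_neg_of_pos (ho.pow_neg h5) h7)
      obtain ⟨k, hk⟩ := this
      rw [hk, ← two_mul, mul_comm 2 k, pow_mul]
      exact hT _
  rw [hdec, hlu, C_mul, C_pow]
  exact T.add_mem (hYq _) (T.mul_mem hXl (unit_mem hT hC (by rw [e0_C]; exact hupos)))

end PS
end

section
set_option linter.all false
set_option maxHeartbeats 400000
namespace PS
open Polynomial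

/-- base frame -/
noncomputable def fr0 (p e1 e2 : Fin 2 → ℝ) : A2 →+* BB :=
  MvPolynomial.eval₂Hom rr (fun i => rr (p i) + rr (e1 i) * tX + rr (e2 i) * tY)

/-- Y ↦ ψ + u Y -/
noncomputable def sub (ψ u : PowerSeries ℝ) : BB →+* BB := Polynomial.compRingHom (C ψ + C u * X)

noncomputable def fr (p e1 e2 : Fin 2 → ℝ) (ψ u : PowerSeries ℝ) : A2 →+* BB := (sub ψ u).comp (fr0 p e1 e2)

theorem sub_C (ψ u a : PowerSeries ℝ) : sub ψ u (C a) = C a := by simp [sub]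
theorem sub_tX (ψ u : PowerSeries ℝ) : sub ψ u tX = tX := sub_C _ _ _
theorem sub_rr (ψ u : PowerSeries ℝ) (r : ℝ) : sub ψ u (rr r) = rr r := sub_C _ _ _
theorem sub_tY (ψ u : PowerSeries ℝ) : sub ψ u tY = C ψ + C u * tY := by simp [sub, tY]

theorem e0_sub (ψ u : PowerSeries ℝ) (hψ : PowerSeries.constantCoeff ψ = 0) (b : BB) : e0 (sub ψ u b) = e0 b := by
  have : e0.comp (sub ψ u) = e0 := by
    apply Polynomial.ringHom_ext
    · intro a; simp [sub_C]
    · change e0 (sub ψ u tY) = e0 tY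
      rw [sub_tY]; simp [hψ]
  exact congrArg (fun k : BB →+* ℝ => k b) this

theorem fr0_cc (p e1 e2 : Fin 2 → ℝ) (r : ℝ) : fr0 p e1 e2 (cc r) = rr r := by simp [fr0, cc]
theorem fr_cc (p e1 e2 : Fin 2 → ℝ) (ψ u) (r : ℝ) : fr p e1 e2 ψ u (cc r) = rr r := by
  rw [fr, RingHom.comp_apply, fr0_cc, sub_rr]
theorem fr0_X (p e1 e2 : Fin 2 → ℝ) (i) : fr0 p e1 e2 (MvPolynomial.X i) = rr (p i) + rr (e1 i) * tX + rr (e2 i) * tY := by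
  simp [fr0]

theorem fr_one (p e1 e2 : Fin 2 → ℝ) : fr p e1 e2 0 1 = fr0 p e1 e2 := by
  have : sub 0 1 = RingHom.id BB := by
    apply Polynomial.ringHom_ext
    · intro a; simp [sub_C]
    · simp [sub]
  rw [fr, this, RingHom.id_comp]

theorem e0_fr0 (p e1 e2 : Fin 2 → ℝ) (f : A2) : e0 (fr0 p e1 e2 f) = ev p f := by
  have : e0.comp (fr0 p e1 e2) = (MvPolynomial.eval p) := by
    apply MvPolynomial.ringHom_ext
    · intro r; simp [fr0]
    · intro i; simp [fr0_X]
  exact congrArg (fun k : A2 →+* ℝ => k f) this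

/-- linear forms -/
noncomputable def lf1 (p e1 e2 : Fin 2 → ℝ) : A2 :=
  cc (e1 0 * e2 1 - e1 1 * e2 0)⁻¹ * (cc (e2 1) * (MvPolynomial.X 0 - cc (p 0)) - cc (e2 0) * (MvPolynomial.X 1 - cc (p 1)))
noncomputable def lf2 (p e1 e2 : Fin 2 → ℝ) : A2 :=
  cc (e1 0 * e2 1 - e1 1 * e2 0)⁻¹ * (cc (e1 0) * (MvPolynomial.X 1 - cc (p 1)) - cc (e1 1) * (MvPolynomial.X 0 - cc (p 0)))

section
variable {p e1 e2 : Fin 2 → ℝ} (hd : e1 0 * e2 1 - e1 1 * e2 0 ≠ 0)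

theorem fr0_lf1 (hd : e1 0 * e2 1 - e1 1 * e2 0 ≠ 0) : fr0 p e1 e2 (lf1 p e1 e2) = tX := by
  have h := rr_mul_inv hd
  simp only [lf1, map_mul, map_sub, fr0_cc, fr0_X] at *
  linear_combination tX * h
theorem fr0_lf2 (hd : e1 0 * e2 1 - e1 1 * e2 0 ≠ 0) : fr0 p e1 e2 (lf2 p e1 e2) = tY := by
  have h := rr_mul_inv hd
  simp only [lf2, map_mul, map_sub, fr0_cc, fr0_X] at *
  linear_combination tY * h

theorem lf_X0 (hd : e1 0 * e2 1 - e1 1 * e2 0 ≠ 0) : (MvPolynomial.X 0 : A2) = cc (p 0) + cc (e1 0) * lf1 p e1 e2 + cc (e2 0) * lf2 p e1 e2 := by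
  have h := cc_inv_mul hd
  simp only [lf1, lf2, cc, map_mul, map_sub] at *
  linear_combination (- (MvPolynomial.X 0 - MvPolynomial.C (p 0))) * h
theorem lf_X1 (hd : e1 0 * e2 1 - e1 1 * e2 0 ≠ 0) : (MvPolynomial.X 1 : A2) = cc (p 1) + cc (e1 1) * lf1 p e1 e2 + cc (e2 1) * lf2 p e1 e2 := by
  have h := cc_inv_mul hd
  simp only [lf1, lf2, cc, map_mul, map_sub] at *
  linear_combination (- (MvPolynomial.X 1 - MvPolynomial.C (p 1))) * h
end

theorem lf1_mem (p e1 e2 : Fin 2 → ℝ) : lf1 p e1 e2 ∈ mm p :=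
  Ideal.mul_mem_left _ _ (sub_mem (Ideal.mul_mem_left _ _ (Ideal.subset_span (by simp))) (Ideal.mul_mem_left _ _ (Ideal.subset_span (by simp))))
theorem lf2_mem (p e1 e2 : Fin 2 → ℝ) : lf2 p e1 e2 ∈ mm p :=
  Ideal.mul_mem_left _ _ (sub_mem (Ideal.mul_mem_left _ _ (Ideal.subset_span (by simp))) (Ideal.mul_mem_left _ _ (Ideal.subset_span (by simp))))

theorem trunc_dvd (h : PowerSeries ℝ) (N : ℕ) : ∃ k : PowerSeries ℝ, h = ((PowerSeries.trunc N h : ℝ[X]) : PowerSeries ℝ) + PowerSeries.X ^ N * k := by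
  have : (PowerSeries.X : PowerSeries ℝ) ^ N ∣ h - ((PowerSeries.trunc N h : ℝ[X]) : PowerSeries ℝ) := by
    rw [PowerSeries.X_pow_dvd_iff]
    intro m hm
    rw [map_sub, Polynomial.coeff_coe, PowerSeries.coeff_trunc, if_pos hm, sub_self]
  obtain ⟨k, hk⟩ := this
  exact ⟨k, by rw [← hk]; ring⟩

theorem C_coe (P : ℝ[X]) : (C (P : PowerSeries ℝ) : BB) = eval₂ rr tX P := by
  induction P using Polynomial.induction_on' with
  | add a b ha hb => simp [ha, hb]
  | monomial n a => 
    rw [Polynomial.coe_monomial, eval₂_monomial, tX, ← C_pow, PowerSeries.monomial_eq_mk]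
    rw [rr, RingHom.comp_apply, ← C_mul]
    congr 1
    ext k
    simp [PowerSeries.coeff_X_pow, PowerSeries.coeff_mk, Pi.single_apply, eq_comm]

section
variable {p e1 e2 : Fin 2 → ℝ} (hd : e1 0 * e2 1 - e1 1 * e2 0 ≠ 0) {ψ u : PowerSeries ℝ}
  (hψ : PowerSeries.constantCoeff ψ = 0) (hu : PowerSeries.constantCoeff u ≠ 0)

theorem fr_lf1 (hd : e1 0 * e2 1 - e1 1 * e2 0 ≠ 0) : fr p e1 e2 ψ u (lf1 p e1 e2) = tX := by
  rw [fr, RingHom.comp_apply, fr0_lf1 hd, sub_tX]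
theorem fr_lf2 (hd : e1 0 * e2 1 - e1 1 * e2 0 ≠ 0) : fr p e1 e2 ψ u (lf2 p e1 e2) = C ψ + C u * tY := by
  rw [fr, RingHom.comp_apply, fr0_lf2 hd, sub_tY]

theorem fr_approx (hd : e1 0 * e2 1 - e1 1 * e2 0 ≠ 0) (hψ : PowerSeries.constantCoeff ψ = 0) (hu : PowerSeries.constantCoeff u ≠ 0) (b : BB) (N : ℕ) : ∃ a, b - fr p e1 e2 ψ u a ∈ II ^ N := by
  have hadd : ∀ b b', (∃ a, b - fr p e1 e2 ψ u a ∈ II ^ N) → (∃ a, b' - fr p e1 e2 ψ u a ∈ II ^ N) →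
      ∃ a, (b + b') - fr p e1 e2 ψ u a ∈ II ^ N := by
    rintro b b' ⟨a, ha⟩ ⟨a', ha'⟩
    refine ⟨a + a', ?_⟩
    have := add_mem ha ha'
    convert this using 1
    rw [map_add]; ring
  have hmul : ∀ b b', (∃ a, b - fr p e1 e2 ψ u a ∈ II ^ N) → (∃ a, b' - fr p e1 e2 ψ u a ∈ II ^ N) →
      ∃ a, (b * b') - fr p e1 e2 ψ u a ∈ II ^ N := by
    rintro b b' ⟨a, ha⟩ ⟨a', ha'⟩
    refine ⟨a * a', ?_⟩
    have := add_mem (Ideal.mul_mem_left _ b' ha) (Ideal.mul_mem_left _ (fr p e1 e2 ψ u a) ha')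
    convert this using 1
    rw [map_mul]; ring
  have hC : ∀ h : PowerSeries ℝ, ∃ a, C h - fr p e1 e2 ψ u a ∈ II ^ N := by
    intro h
    obtain ⟨k, hk⟩ := trunc_dvd h N
    refine ⟨eval₂ MvPolynomial.C (lf1 p e1 e2) (PowerSeries.trunc N h), ?_⟩
    have e : fr p e1 e2 ψ u (eval₂ MvPolynomial.C (lf1 p e1 e2) (PowerSeries.trunc N h)) = eval₂ rr tX (PowerSeries.trunc N h) := by
      rw [Polynomial.hom_eval₂, fr_lf1 hd]
      congr 1
      ext1 r
      exact fr_cc p e1 e2 ψ u r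
    rw [e, ← C_coe]
    have e2 : (C h : BB) - C ((PowerSeries.trunc N h : ℝ[X]) : PowerSeries ℝ) = tX ^ N * C k := by
      rw [← C_sub, tX, ← C_pow, ← C_mul]
      congr 1
      linear_combination hk
    rw [e2]
    exact Ideal.mul_mem_right _ _ (Ideal.pow_mem_pow tX_mem N)
  have hY : ∃ a, tY - fr p e1 e2 ψ u a ∈ II ^ N := by
    have huu : u * u⁻¹ = 1 := PowerSeries.mul_inv_cancel u hu
    have : tY = C u⁻¹ * ((C ψ + C u * tY) + C (-ψ)) := by
      have : (C u * C u⁻¹ : BB) = 1 := by rw [← C_mul, huu, C_1]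
      rw [C_neg]
      linear_combination (-tY) * this
    rw [this]
    exact hmul _ _ (hC _) (hadd _ _ ⟨lf2 p e1 e2, by rw [fr_lf2 hd, sub_self]; exact zero_mem _⟩ (hC _))
  induction b using Polynomial.induction_on with
  | C a => exact hC a
  | add a b ha hb => exact hadd _ _ ha hb
  | monomial n a ih =>
    rw [pow_succ, ← mul_assoc]
    exact hmul _ _ ih hY

/-- evaluation of a power series at ℓ mod m^N -/
noncomputable def kap0 (p : Fin 2 → ℝ) (l : A2) (hl : l ∈ mm p) (N : ℕ) : PowerSeries ℝ →+* A2 ⧸ (mm p ^ N) :=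
  have key : ∀ a b : ℝ[X], (∀ d < N, a.coeff d = b.coeff d) →
      Ideal.Quotient.mk (mm p ^ N) (eval₂ MvPolynomial.C l a) = Ideal.Quotient.mk (mm p ^ N) (eval₂ MvPolynomial.C l b) := by
    intro a b h
    rw [Ideal.Quotient.mk_eq_mk_iff_sub_mem, ← eval₂_sub]
    obtain ⟨c, hc⟩ : X ^ N ∣ a - b := by
      rw [X_pow_dvd_iff]
      intro d hd
      rw [coeff_sub, h d hd, sub_self]
    rw [hc, eval₂_mul, eval₂_pow, eval₂_X]
    exact Ideal.mul_mem_right _ _ (Ideal.pow_mem_pow hl N)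
  { toFun := fun h => Ideal.Quotient.mk _ (eval₂ MvPolynomial.C l (PowerSeries.trunc N h))
    map_zero' := by simp
    map_add' := fun a b => by simp [eval₂_add]
    map_one' := by
      rw [key (PowerSeries.trunc N 1) 1 (fun d hd => by
        rw [PowerSeries.coeff_trunc, if_pos hd, ← Polynomial.coe_one, Polynomial.coeff_coe])]
      simp
    map_mul' := fun a b => by
      rw [← map_mul, ← eval₂_mul]
      apply key
      intro d hd
      rw [← PowerSeries.trunc_trunc_mul_trunc, PowerSeries.coeff_trunc, if_pos hd, ← Polynomial.coe_mul,
        Polynomial.coeff_coe] }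

theorem kap0_coe (p : Fin 2 → ℝ) (l : A2) (hl : l ∈ mm p) (N : ℕ) (P : ℝ[X]) :
    kap0 p l hl N P = Ideal.Quotient.mk (mm p ^ N) (eval₂ MvPolynomial.C l P) := by
  change Ideal.Quotient.mk (mm p ^ N) (eval₂ MvPolynomial.C l (PowerSeries.trunc N P)) = _
  rw [Ideal.Quotient.mk_eq_mk_iff_sub_mem, ← eval₂_sub]
  obtain ⟨c, hc⟩ : X ^ N ∣ PowerSeries.trunc N (P : PowerSeries ℝ) - P := by
    rw [X_pow_dvd_iff]
    intro d hd
    rw [coeff_sub, PowerSeries.coeff_trunc, if_pos hd, Polynomial.coeff_coe, sub_self]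
  rw [hc, eval₂_mul, eval₂_pow, eval₂_X]
  exact Ideal.mul_mem_right _ _ (Ideal.pow_mem_pow hl N)

theorem fr_back (hd : e1 0 * e2 1 - e1 1 * e2 0 ≠ 0) (hψ : PowerSeries.constantCoeff ψ = 0) (hu : PowerSeries.constantCoeff u ≠ 0) (q : A2) (N : ℕ) (hq : fr p e1 e2 ψ u q ∈ II ^ N) : q ∈ mm p ^ N := by
  set k0 := kap0 p (lf1 p e1 e2) (lf1_mem p e1 e2) N with hk0
  set π := Ideal.Quotient.mk (mm p ^ N) with hπ
  set κ : BB →+* A2 ⧸ (mm p ^ N) := eval₂RingHom k0 (k0 u⁻¹ * (π (lf2 p e1 e2) - k0 ψ)) with hκ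
  have kC : ∀ a, κ (C a) = k0 a := fun a => by simp [hκ]
  have kX : κ tX = π (lf1 p e1 e2) := by
    rw [tX, kC]
    have := kap0_coe p (lf1 p e1 e2) (lf1_mem p e1 e2) N X
    rw [Polynomial.coe_X, eval₂_X] at this
    exact this
  have kr : ∀ r, κ (rr r) = π (cc r) := fun r => by
    rw [rr, RingHom.comp_apply, kC]
    have := kap0_coe p (lf1 p e1 e2) (lf1_mem p e1 e2) N (C r)
    rw [Polynomial.coe_C, eval₂_C] at this
    exact this
  have kY : κ tY = k0 u⁻¹ * (π (lf2 p e1 e2) - k0 ψ) := by simp [hκ, tY]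
  have k2 : κ (C ψ + C u * tY) = π (lf2 p e1 e2) := by
    rw [map_add, map_mul, kC, kC, kY]
    have : k0 u * k0 u⁻¹ = 1 := by rw [← map_mul, PowerSeries.mul_inv_cancel u hu, map_one]
    linear_combination (π (lf2 p e1 e2) - k0 ψ) * this
  have hcomp : κ.comp (fr p e1 e2 ψ u) = π := by
    have hX : ∀ i, fr p e1 e2 ψ u (MvPolynomial.X i) = rr (p i) + rr (e1 i) * tX + rr (e2 i) * (C ψ + C u * tY) := by
      intro i
      rw [fr, RingHom.comp_apply, fr0_X, map_add, map_add, map_mul, map_mul, sub_rr, sub_rr, sub_rr, sub_tX, sub_tY]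
    apply MvPolynomial.ringHom_ext
    · intro r
      rw [RingHom.comp_apply, show (MvPolynomial.C r : A2) = cc r from rfl, fr_cc, kr]
    · intro i
      rw [RingHom.comp_apply, hX, map_add, map_add, map_mul, map_mul, kr, kr, kr, kX, k2]
      fin_cases i
      · conv_rhs => rw [show (MvPolynomial.X ((fun i => i) (⟨0, by norm_num⟩ : Fin 2)) : A2) = MvPolynomial.X 0 from rfl, lf_X0 (p := p) hd]
        simp
      · conv_rhs => rw [show (MvPolynomial.X ((fun i => i) (⟨1, by norm_num⟩ : Fin 2)) : A2) = MvPolynomial.X 1 from rfl, lf_X1 (p := p) hd]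
        simp
  have hII : II ≤ ((mm p).map π).comap κ := by
    rw [II, Ideal.span_le]
    rintro x (rfl | rfl)
    · change κ tX ∈ (mm p).map π
      rw [kX]; exact Ideal.mem_map_of_mem _ (lf1_mem p e1 e2)
    · change κ tY ∈ (mm p).map π
      rw [kY]
      refine Ideal.mul_mem_left _ _ (sub_mem (Ideal.mem_map_of_mem _ (lf2_mem p e1 e2)) ?_)
      obtain ⟨c, hc⟩ := PowerSeries.X_dvd_iff.2 hψ
      rw [hc, map_mul]
      refine Ideal.mul_mem_right _ _ ?_
      rw [← kC, show (C PowerSeries.X : BB) = tX from rfl, kX]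
      exact Ideal.mem_map_of_mem _ (lf1_mem p e1 e2)
  have h1 : fr p e1 e2 ψ u q ∈ (((mm p).map π) ^ N).comap κ :=
    Ideal.le_comap_pow _ N (Ideal.pow_right_mono hII N hq)
  rw [Ideal.mem_comap, ← RingHom.comp_apply, hcomp, ← Ideal.map_pow, hπ, Ideal.map_quotient_self,
    Ideal.mem_bot, Ideal.Quotient.eq_zero_iff_mem] at h1
  exact h1

end
end PS
end

section
set_option linter.all false
set_option maxHeartbeats 400000
namespace PS
open Polynomial

/-- local membership -/
def Loc {s : ℕ} (g : Fin s → A2) (p : Fin 2 → ℝ) (f : A2) : Prop := ∀ N, ∃ τ ∈ TT g, f - τ ∈ mm p ^ N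
/-- local positivity -/
def LP (p : Fin 2 → ℝ) (f : A2) (G : Finset A2) : Prop :=
  ∃ U ∈ nhds p, ∀ q ∈ U, q ≠ p → (∀ h ∈ G, 0 ≤ ev q h) → 0 < ev q f
/-- density -/
def Dens (p : Fin 2 → ℝ) (G : Finset A2) : Prop :=
  ∀ h : A2, h ≠ 0 → ∀ U ∈ nhds p, ∃ q ∈ U, ev q h ≠ 0 ∧ ∀ a ∈ G, 0 ≤ ev q a

noncomputable def TL {s : ℕ} (g : Fin s → A2) (ι : A2 →+* BB) : Subsemiring BB := hull ((TT g).map ι)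

theorem TL_clo {s : ℕ} (g : Fin s → A2) (ι : A2 →+* BB) : Clo (TL g ι) := hull_clo _

theorem TL_mem {s : ℕ} (g : Fin s → A2) (ι : A2 →+* BB) {a : A2} (ha : a ∈ TT g) : ι a ∈ TL g ι :=
  le_hull _ (Subsemiring.mem_map.2 ⟨a, ha, rfl⟩)

theorem al_near {F : Type} [Field F] [LinearOrder F] [IsStrictOrderedRing F] (θ : A2 →+* F) (p : Fin 2 → ℝ)
    (hinf : ∀ ε : ℝ, 0 < ε → 0 < θ (cc ε - dd p)) (U : Set (Fin 2 → ℝ)) (hU : U ∈ nhds p) (S : Finset A2) :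
    ∃ q ∈ U, ∀ P ∈ S, SignType.sign (ev q P) = SignType.sign (θ P) := by
  classical
  obtain ⟨δ, hδ, hB⟩ := Metric.mem_nhds_iff.1 hU
  obtain ⟨q, hq⟩ := artin_lang θ (insert (cc (δ ^ 2) - dd p) S)
  refine ⟨q, hB ?_, fun P hP => hq P (Finset.mem_insert_of_mem hP)⟩
  have h1 := sign_eq_pos (hq _ (Finset.mem_insert_self _ _)) (hinf (δ ^ 2) (by positivity))
  have h2 : (q 0 - p 0) ^ 2 + (q 1 - p 1) ^ 2 < δ ^ 2 := by
    have : ev q (dd p) = (q 0 - p 0) ^ 2 + (q 1 - p 1) ^ 2 := ev_dd _ _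
    have h3 : ev q (cc (δ ^ 2) - dd p) = δ ^ 2 - ev q (dd p) := by simp [ev, cc]
    change 0 < ev q (cc (δ ^ 2) - dd p) at h1
    rw [h3, this] at h1
    linarith
  rw [Metric.mem_ball, dist_pi_lt_iff hδ]
  intro i
  rw [Real.dist_eq]
  apply abs_lt_of_sq_lt_sq _ hδ.le
  fin_cases i
  · simp; nlinarith [sq_nonneg (q 1 - p 1)]
  · simp; nlinarith [sq_nonneg (q 0 - p 0)]

section
variable {p e1 e2 : Fin 2 → ℝ} (hd : e1 0 * e2 1 - e1 1 * e2 0 ≠ 0) {ψ u : PowerSeries ℝ}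
  (hψ : PowerSeries.constantCoeff ψ = 0) (hu : PowerSeries.constantCoeff u ≠ 0)

theorem e0_fr (hψ : PowerSeries.constantCoeff ψ = 0) (f : A2) : e0 (fr p e1 e2 ψ u f) = ev p f := by
  rw [fr, RingHom.comp_apply, e0_sub _ _ hψ, e0_fr0]

theorem TL_pre (hd : e1 0 * e2 1 - e1 1 * e2 0 ≠ 0) (hψ : PowerSeries.constantCoeff ψ = 0) (hu : PowerSeries.constantCoeff u ≠ 0) {s : ℕ} (g : Fin s → A2) : IsPre (TL g (fr p e1 e2 ψ u)) := by
  intro b N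
  obtain ⟨a, ha⟩ := fr_approx hd hψ hu b N (p := p)
  refine ⟨fr p e1 e2 ψ u (a ^ 2), Subsemiring.mem_map.2 ⟨a ^ 2, TT_pre g a, rfl⟩, ?_⟩
  have := Ideal.mul_mem_right (b + fr p e1 e2 ψ u a) _ ha
  convert this using 1
  rw [map_pow]; ring

theorem TL_loc (hd : e1 0 * e2 1 - e1 1 * e2 0 ≠ 0) (hψ : PowerSeries.constantCoeff ψ = 0) (hu : PowerSeries.constantCoeff u ≠ 0) {s : ℕ} (g : Fin s → A2) {f : A2} (h : fr p e1 e2 ψ u f ∈ TL g (fr p e1 e2 ψ u)) : Loc g p f := by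
  intro N
  obtain ⟨τ, hτ, h1⟩ := h N
  obtain ⟨a, ha, rfl⟩ := Subsemiring.mem_map.1 hτ
  refine ⟨a, ha, fr_back hd hψ hu _ _ ?_⟩
  rwa [map_sub]

theorem fr_inf (hψ : PowerSeries.constantCoeff ψ = 0) {F : Type} [Field F] [LinearOrder F] [IsStrictOrderedRing F] (θ : BB →+* F)
    (hI : Infi (θ.comp C) (θ tY)) (ε : ℝ) (hε : 0 < ε) : 0 < θ (fr p e1 e2 ψ u (cc ε - dd p)) := by
  rw [hom_eval2 θ]
  apply eval_infi _ hI
  rw [← e0_eq, e0_fr hψ]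
  have : ev p (cc ε - dd p) = ε - ev p (dd p) := by simp [ev, cc]
  rw [this, ev_dd]; simpa using hε

theorem fr_ne (hd : e1 0 * e2 1 - e1 1 * e2 0 ≠ 0) (hψ : PowerSeries.constantCoeff ψ = 0) (hu : PowerSeries.constantCoeff u ≠ 0) {F : Type} [Field F] [LinearOrder F] [IsStrictOrderedRing F] (θ : BB →+* F)
    (hn : θ tX ≠ 0 ∨ θ tY ≠ 0) : θ (fr p e1 e2 ψ u (dd p)) ≠ 0 := by
  intro h
  have h0 : θ (fr p e1 e2 ψ u (MvPolynomial.X 0 - cc (p 0))) = 0 ∧ θ (fr p e1 e2 ψ u (MvPolynomial.X 1 - cc (p 1))) = 0 := by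
    rw [dd, map_add, map_add, map_pow, map_pow, map_pow, map_pow] at h
    constructor <;> nlinarith [sq_nonneg (θ (fr p e1 e2 ψ u (MvPolynomial.X 0 - cc (p 0)))), sq_nonneg (θ (fr p e1 e2 ψ u (MvPolynomial.X 1 - cc (p 1))))]
  have h1 : θ tX = 0 := by
    rw [← fr_lf1 hd (p := p) (ψ := ψ) (u := u), lf1, map_mul, map_mul, map_sub, map_sub, map_mul, map_mul, map_mul, map_mul, h0.1, h0.2]
    simp
  have h2 : θ (C ψ + C u * tY) = 0 := by
    rw [← fr_lf2 hd (p := p) (ψ := ψ) (u := u), lf2, map_mul, map_mul, map_sub, map_sub, map_mul, map_mul, map_mul, map_mul, h0.1, h0.2]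
    simp
  obtain ⟨c, hc⟩ := PowerSeries.X_dvd_iff.2 hψ
  have h3 : θ (C ψ) = 0 := by
    rw [hc, C_mul, map_mul, show (C PowerSeries.X : BB) = tX from rfl, h1, zero_mul]
  have h4 : θ (C u) ≠ 0 := by
    intro h5
    have : (C u * C u⁻¹ : BB) = 1 := by rw [← C_mul, PowerSeries.mul_inv_cancel u hu, C_1]
    have := congrArg θ this
    rw [map_mul, h5, zero_mul, map_one] at this
    exact zero_ne_one this
  rw [map_add, h3, zero_add, map_mul] at h2
  rcases mul_eq_zero.1 h2 with h5 | h5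
  · exact h4 h5
  · exact hn.elim (fun h => h h1) (fun h => h h5)

theorem frame_pos (hd : e1 0 * e2 1 - e1 1 * e2 0 ≠ 0) (hψ : PowerSeries.constantCoeff ψ = 0) (hu : PowerSeries.constantCoeff u ≠ 0) {F : Type} [Field F] [LinearOrder F] [IsStrictOrderedRing F] (θ : BB →+* F)
    (hI : Infi (θ.comp C) (θ tY)) (hn : θ tX ≠ 0 ∨ θ tY ≠ 0) {f : A2} {G : Finset A2} (hf : LP p f G)
    (hG : ∀ a ∈ G, 0 ≤ θ (fr p e1 e2 ψ u a)) : 0 < θ (fr p e1 e2 ψ u f) := by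
  classical
  obtain ⟨U, hU, h⟩ := hf
  obtain ⟨q, hq, h1⟩ := al_near (θ.comp (fr p e1 e2 ψ u)) p (fr_inf hψ θ hI) U hU (insert f (insert (dd p) G))
  have h2 := h q hq (by
    rintro rfl
    have h3 := h1 (dd q) (by simp)
    rw [ev_dd] at h3
    have h5 := sign_eq_zero' h3.symm (by simp)
    exact fr_ne hd hψ hu θ hn h5) (fun a ha => sign_eq_nonneg (h1 a (by simp [ha])) (hG a ha))
  exact sign_eq_pos (h1 f (by simp)).symm h2

theorem infi_sand {F : Type} [Field F] [LinearOrder F] [IsStrictOrderedRing F] (θ : BB →+* F) {M : ℕ} (hM : 1 ≤ M)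
    (h0 : 0 ≤ θ tY) (h1 : θ tY ≤ θ tX ^ M) : Infi (θ.comp C) (θ tY) := by
  intro ε hε
  have := ps_abs_lt (θ.comp C) (a := PowerSeries.X ^ M) (N := ε) (by simp [show M ≠ 0 by omega, hε])
  rw [map_pow, show (θ.comp C) PowerSeries.X = θ tX from rfl] at this
  rw [abs_of_nonneg h0]
  exact lt_of_le_of_lt (h1.trans (le_abs_self _)) this

theorem fr_inj (hd : e1 0 * e2 1 - e1 1 * e2 0 ≠ 0) (hψ : PowerSeries.constantCoeff ψ = 0) (hu : PowerSeries.constantCoeff u ≠ 0) {h : A2} (hh : fr p e1 e2 ψ u h = 0) : h = 0 := by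
  have h1 : h ∈ ⨅ i : ℕ, mm p ^ i := by
    rw [Ideal.mem_iInf]
    intro i
    exact fr_back hd hψ hu h i (by rw [hh]; exact zero_mem _)
  rw [Ideal.iInf_pow_eq_bot_of_isDomain] at h1
  · exact h1
  · intro ht
    have : (1 : A2) ∈ mm p := by rw [ht]; trivial
    have := mm_ev this
    simp [ev] at this

theorem frame_dens (hd : e1 0 * e2 1 - e1 1 * e2 0 ≠ 0) (hψ : PowerSeries.constantCoeff ψ = 0) (hu : PowerSeries.constantCoeff u ≠ 0) {M : ℕ} (hM : 1 ≤ M) {G : Finset A2}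
    (hG : ∀ (F : Type) [Field F] [LinearOrder F] [IsStrictOrderedRing F] (θ : BB →+* F), 0 < θ tX → 0 ≤ θ tY →
      θ tY ≤ θ tX ^ M → ∀ a ∈ G, 0 ≤ θ (fr p e1 e2 ψ u a)) : Dens p G := by
  classical
  intro h hh U hU
  obtain ⟨l, F, hF, hφ⟩ := pull_tX (bet M (fr p e1 e2 ψ u h)) (fun h1 => hh (fr_inj hd hψ hu (bet_inj M _ h1)))
  obtain ⟨r, h0, h1, h2⟩ := exists_nonroot _ hφ
  have hXM : 0 < psLL PowerSeries.X ^ M := pow_pos psLL_X_pos M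
  set θ : BB →+* LL := eval₂RingHom psLL (psLL PowerSeries.X ^ M * rc psLL r) with hθ
  have tx : θ tX = psLL PowerSeries.X := by simp [hθ, tX]
  have ty : θ tY = psLL PowerSeries.X ^ M * rc psLL r := by simp [hθ, tY]
  have hr0 := rc_pos psLL h0
  have hr1 : rc psLL r ≤ 1 := by
    have := (rc_lt psLL h1).le
    simpa [rc] using this
  have g1 : 0 < θ tX := by rw [tx]; exact psLL_X_pos
  have g2 : 0 ≤ θ tY := by rw [ty]; exact (mul_pos hXM hr0).le
  have g3 : θ tY ≤ θ tX ^ M := by rw [tx, ty]; exact mul_le_of_le_one_right hXM.le hr1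
  have hne : θ (fr p e1 e2 ψ u h) ≠ 0 := by
    rw [hθ, coe_eval₂RingHom, ← eval2_bet, hF, eval₂_mul, eval₂_pow, rc, Polynomial.eval₂_at_apply psLL (p := F)]
    refine mul_ne_zero (pow_ne_zero _ ?_) ?_
    · rw [tX, eval₂_C]; exact psLL_X_pos.ne'
    · intro h3
      have h4 : F.eval (PowerSeries.C r) = 0 := psLL_inj (by rw [h3, map_zero])
      apply h2
      rw [← const_eval, h4, map_zero]
  obtain ⟨q, hq, h5⟩ := al_near (θ.comp (fr p e1 e2 ψ u)) p (fr_inf hψ θ (infi_sand θ hM g2 g3)) U hU (insert h G)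
  refine ⟨q, hq, ?_, fun a ha => sign_eq_nonneg (h5 a (by simp [ha])) (hG LL θ g1 g2 g3 a ha)⟩
  intro h6
  exact hne (sign_eq_zero' (h5 h (by simp)).symm h6)

end

end PS
end

section
set_option linter.all false
set_option maxHeartbeats 400000
namespace PS
open Polynomial

noncomputable def cX (b : BB) : ℝ := PowerSeries.coeff 1 (b.coeff 0)
noncomputable def cY (b : BB) : ℝ := PowerSeries.constantCoeff (b.coeff 1)

theorem ps_coeff_one_mul (a b : PowerSeries ℝ) : PowerSeries.coeff 1 (a * b) =
    PowerSeries.coeff 1 a * PowerSeries.constantCoeff b + PowerSeries.constantCoeff a * PowerSeries.coeff 1 b := by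
  rw [PowerSeries.coeff_mul]
  rw [show Finset.HasAntidiagonal.antidiagonal (1:ℕ) = {((0:ℕ),(1:ℕ)), (1,0)} from rfl]
  simp; ring

theorem cX_mul (a b : BB) : cX (a * b) = cX a * e0 b + e0 a * cX b := by
  simp only [cX, e0_coeff, mul_coeff_zero, ps_coeff_one_mul]
theorem cY_mul (a b : BB) : cY (a * b) = cY a * e0 b + e0 a * cY b := by
  simp only [cY, e0_coeff, mul_coeff_one, map_add, map_mul]; ring
theorem cX_add (a b : BB) : cX (a + b) = cX a + cX b := by simp [cX]
theorem cY_add (a b : BB) : cY (a + b) = cY a + cY b := by simp [cY]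
theorem cX_sub (a b : BB) : cX (a - b) = cX a - cX b := by simp [cX]
theorem cY_sub (a b : BB) : cY (a - b) = cY a - cY b := by simp [cY]
theorem cX_C (a : PowerSeries ℝ) : cX (C a) = PowerSeries.coeff 1 a := by simp [cX]
theorem cY_C (a : PowerSeries ℝ) : cY (C a) = 0 := by simp [cY, coeff_C]
theorem cX_rr (r : ℝ) : cX (rr r) = 0 := by simp [cX, rr, PowerSeries.coeff_C]
theorem cY_rr (r : ℝ) : cY (rr r) = 0 := cY_C _
theorem cX_tX : cX tX = 1 := by simp [cX, tX, PowerSeries.coeff_one_X]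
theorem cX_tY : cX tY = 0 := by simp [cX, tY]
theorem cY_tX : cY tX = 0 := cY_C _
theorem cY_tY : cY tY = 1 := by simp [cY, tY]

theorem cX_fr0 (p e1 e2 : Fin 2 → ℝ) (f : A2) : cX (fr0 p e1 e2 f) =
    ev p (MvPolynomial.pderiv 0 f) * e1 0 + ev p (MvPolynomial.pderiv 1 f) * e1 1 := by
  induction f using MvPolynomial.induction_on with
  | C r => rw [show (MvPolynomial.C r : A2) = cc r from rfl, fr0_cc, cX_rr]; simp [cc, ev]
  | add a b ha hb => rw [map_add, cX_add, ha, hb]; simp [ev]; ring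
  | mul_X a i ha =>
    rw [map_mul, cX_mul, ha, e0_fr0, fr0_X, cX_add, cX_add, cX_mul, cX_mul, cX_rr, cX_tX, cX_tY]
    simp only [MvPolynomial.pderiv_mul, MvPolynomial.pderiv_X, cX_rr]
    fin_cases i <;> simp [ev, cX_rr, e0_fr0] <;> ring

theorem cY_fr0 (p e1 e2 : Fin 2 → ℝ) (f : A2) : cY (fr0 p e1 e2 f) =
    ev p (MvPolynomial.pderiv 0 f) * e2 0 + ev p (MvPolynomial.pderiv 1 f) * e2 1 := by
  induction f using MvPolynomial.induction_on with
  | C r => rw [show (MvPolynomial.C r : A2) = cc r from rfl, fr0_cc, cY_rr]; simp [cc, ev]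
  | add a b ha hb => rw [map_add, cY_add, ha, hb]; simp [ev]; ring
  | mul_X a i ha =>
    rw [map_mul, cY_mul, ha, e0_fr0, fr0_X, cY_add, cY_add, cY_mul, cY_mul, cY_rr, cY_tX, cY_tY]
    simp only [MvPolynomial.pderiv_mul, MvPolynomial.pderiv_X, cY_rr]
    fin_cases i <;> simp [ev, cY_rr, e0_fr0] <;> ring

theorem nf (b : BB) (h0 : e0 b = 0) (h1 : cY b ≠ 0) : ∃ (ψ : PowerSeries ℝ) (h : BB), b = (tY - C ψ) * h ∧
    PowerSeries.constantCoeff ψ = 0 ∧ e0 h = cY b ∧ cX b = -(PowerSeries.coeff 1 ψ) * cY b := by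
  have hr : redX b ≠ 0 := by
    intro h
    apply h1
    have := congrArg (fun P : ℝ[X] => P.coeff 1) h
    simpa [redX, cY] using this
  obtain ⟨F1, F2, hb, hm, hx, h2⟩ := cluster b hr
  rw [← e0_eq] at h2
  have h3 : e0 F1 = 0 := by
    have : e0 F1 * e0 F2 = 0 := by rw [← map_mul, ← hb, h0]
    exact (mul_eq_zero.1 this).resolve_right h2
  have h4 : cY b = cY F1 * e0 F2 := by rw [hb, cY_mul, h3]; ring
  have h5 : cY F1 = (redX F1).coeff 1 := by simp [redX, cY]
  have h6 : F1.natDegree = 1 := by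
    by_contra hne
    apply h1
    rw [h4, h5, hx, coeff_X_pow, if_neg (fun h => hne h.symm), zero_mul]
  have h7 := hm.eq_X_add_C h6
  have h8 : cY F1 = 1 := by rw [h5, hx, h6]; simp
  refine ⟨-(F1.coeff 0), F2, ?_, ?_, ?_, ?_⟩
  · rw [hb]; nth_rewrite 1 [h7]; simp [tY]
  · rw [map_neg, ← e0_coeff, h3, neg_zero]
  · rw [h4, h8, one_mul]
  · rw [hb, cX_mul, cY_mul, h3, h8]; simp [cX]

theorem cX_subst {ψ u : PowerSeries ℝ} (h0 : PowerSeries.constantCoeff ψ = 0) (h1 : PowerSeries.coeff 1 ψ = 0) (b : BB) :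
    cX (sub ψ u b) = cX b := by
  induction b using Polynomial.induction_on with
  | C a => rw [sub_C]
  | add a b ha hb => rw [map_add, cX_add, cX_add, ha, hb]
  | monomial n a h =>
    rw [pow_succ, ← mul_assoc, map_mul, cX_mul, cX_mul, h, e0_sub _ _ h0, ← tY, sub_tY, cX_add, cX_mul, cX_tY, cX_C, cX_C, h1]
    simp [h0, cX_mul, cX_tY]

end PS
end

section
set_option linter.all false
set_option maxHeartbeats 400000
namespace PS
open Polynomial

noncomputable def gr (p : Fin 2 → ℝ) (i : Fin 2) (f : A2) : ℝ := ev p (MvPolynomial.pderiv i f)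

theorem nf_fr0 (p e1 e2 : Fin 2 → ℝ) (a : A2) (ha : ev p a = 0) (h : gr p 0 a * e2 0 + gr p 1 a * e2 1 ≠ 0) :
    ∃ (ψ : PowerSeries ℝ) (h : BB), fr0 p e1 e2 a = (tY - C ψ) * h ∧ PowerSeries.constantCoeff ψ = 0 ∧
      e0 h = gr p 0 a * e2 0 + gr p 1 a * e2 1 ∧
      gr p 0 a * e1 0 + gr p 1 a * e1 1 = -(PowerSeries.coeff 1 ψ) * (gr p 0 a * e2 0 + gr p 1 a * e2 1) := by
  have := nf (fr0 p e1 e2 a) (by rw [e0_fr0, ha]) (by rw [cY_fr0]; exact h)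
  rwa [cY_fr0, cX_fr0] at this

theorem pos_e0 {F : Type} [Field F] [LinearOrder F] [IsStrictOrderedRing F] (θ : BB →+* F)
    (hI : Infi (θ.comp C) (θ tY)) {b : BB} (hb : 0 < e0 b) : 0 < θ b := by
  rw [hom_eval2 θ]; exact eval_infi _ hI _ (by rw [← e0_eq]; exact hb)

theorem loc0 {s : ℕ} (g : Fin s → A2) (p : Fin 2 → ℝ) (f : A2) (hf : LP p f ∅) : Loc g p f := by
  have hd : (![1,0] : Fin 2 → ℝ) 0 * (![0,1] : Fin 2 → ℝ) 1 - (![1,0] : Fin 2 → ℝ) 1 * (![0,1] : Fin 2 → ℝ) 0 ≠ 0 := by simp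
  have hψ : PowerSeries.constantCoeff (0 : PowerSeries ℝ) = 0 := by simp
  have hu : PowerSeries.constantCoeff (1 : PowerSeries ℝ) ≠ 0 := by simp
  refine TL_loc hd hψ hu g (type0 (TL_pre hd hψ hu g) (TL_clo _ _) _ ?_)
  intro F _ _ _ θ hI hn
  exact frame_pos hd hψ hu θ hI hn hf (by simp)

theorem dens0 (p : Fin 2 → ℝ) : Dens p ∅ := by
  have hd : (![1,0] : Fin 2 → ℝ) 0 * (![0,1] : Fin 2 → ℝ) 1 - (![1,0] : Fin 2 → ℝ) 1 * (![0,1] : Fin 2 → ℝ) 0 ≠ 0 := by simp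
  have hψ : PowerSeries.constantCoeff (0 : PowerSeries ℝ) = 0 := by simp
  have hu : PowerSeries.constantCoeff (1 : PowerSeries ℝ) ≠ 0 := by simp
  exact frame_dens hd hψ hu (M := 1) le_rfl (by simp)

theorem sq_grad_pos {p : Fin 2 → ℝ} {a : A2} (hg : gr p 0 a ≠ 0 ∨ gr p 1 a ≠ 0) :
    0 < gr p 0 a * gr p 0 a + gr p 1 a * gr p 1 a := by
  rcases hg with h | h
  · have := mul_self_pos.2 h; nlinarith [mul_self_nonneg (gr p 1 a)]
  · have := mul_self_pos.2 h; nlinarith [mul_self_nonneg (gr p 0 a)]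

theorem loc1 {s : ℕ} (g : Fin s → A2) (p : Fin 2 → ℝ) (a : A2) (ha : a ∈ TT g) (ha0 : ev p a = 0)
    (hg : gr p 0 a ≠ 0 ∨ gr p 1 a ≠ 0) : (∀ f, LP p f {a} → Loc g p f) ∧ Dens p {a} := by
  have hpos := sq_grad_pos hg
  obtain ⟨ψ, h, h1, hψ, h3, -⟩ := nf_fr0 p ![gr p 1 a, -gr p 0 a] ![gr p 0 a, gr p 1 a] a ha0 (by simpa using hpos.ne')
  have hd : (![gr p 1 a, -gr p 0 a] : Fin 2 → ℝ) 0 * (![gr p 0 a, gr p 1 a] : Fin 2 → ℝ) 1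
    - (![gr p 1 a, -gr p 0 a] : Fin 2 → ℝ) 1 * (![gr p 0 a, gr p 1 a] : Fin 2 → ℝ) 0 ≠ 0 := by
    simp; intro h; linarith
  have hu : PowerSeries.constantCoeff (1 : PowerSeries ℝ) ≠ 0 := by simp
  set e1 : Fin 2 → ℝ := ![gr p 1 a, -gr p 0 a]
  set e2 : Fin 2 → ℝ := ![gr p 0 a, gr p 1 a]
  have h3' : 0 < e0 (sub ψ 1 h) := by
    rw [e0_sub _ _ hψ, h3]; simpa [e2] using hpos
  have hι : fr p e1 e2 ψ 1 a = sub ψ 1 h * tY := by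
    rw [fr, RingHom.comp_apply, h1, map_mul, map_sub, sub_tY, sub_C]
    rw [C_1]; ring
  have hY : tY ∈ TL g (fr p e1 e2 ψ 1) := by
    apply cancel_mem (TL_pre hd hψ hu g) (TL_clo _ _) h3'
    rw [← hι]; exact TL_mem _ _ ha
  have hs : ∀ (F : Type) [Field F] [LinearOrder F] [IsStrictOrderedRing F] (θ : BB →+* F), Infi (θ.comp C) (θ tY) →
      0 ≤ θ tY → ∀ b ∈ ({a} : Finset A2), 0 ≤ θ (fr p e1 e2 ψ 1 b) := by
    intro F _ _ _ θ hI h0 b hb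
    rw [Finset.mem_singleton.1 hb, hι, map_mul]
    exact mul_nonneg (pos_e0 θ hI h3').le h0
  constructor
  · intro f hf
    refine TL_loc hd hψ hu g (type1 (TL_pre hd hψ hu g) (TL_clo _ _) hY _ ?_)
    intro F _ _ _ θ hI h0 hn
    exact frame_pos hd hψ hu θ hI hn hf (hs F θ hI h0)
  · exact frame_dens hd hψ hu (M := 1) le_rfl (fun F _ _ _ θ t1 t2 t3 => hs F θ (infi_sand θ le_rfl t2 t3) t2)

theorem sand_core {s : ℕ} (g : Fin s → A2) {p e1 e2 : Fin 2 → ℝ} (hd : e1 0 * e2 1 - e1 1 * e2 0 ≠ 0)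
    {a b : A2} {ψ φ u : PowerSeries ℝ} {h k : BB} {M : ℕ}
    (ha : a ∈ TT g) (hb : b ∈ TT g)
    (h1 : fr0 p e1 e2 a = (tY - C ψ) * h) (h2 : fr0 p e1 e2 b = (tY - C φ) * k)
    (hψ : PowerSeries.constantCoeff ψ = 0) (hh : 0 < e0 h) (hk : e0 k < 0)
    (hu : φ - ψ = PowerSeries.X ^ M * u) (hu0 : 0 < PowerSeries.constantCoeff u) :
    tY ∈ TL g (fr p e1 e2 ψ u) ∧ tX ^ M - tY ∈ TL g (fr p e1 e2 ψ u) ∧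
    ∀ (F : Type) [Field F] [LinearOrder F] [IsStrictOrderedRing F] (θ : BB →+* F), Infi (θ.comp C) (θ tY) →
      (0 ≤ θ tY → 0 ≤ θ (fr p e1 e2 ψ u a)) ∧ (θ tY ≤ θ tX ^ M → 0 ≤ θ (fr p e1 e2 ψ u b)) := by
  have hh' : 0 < e0 (C u * sub ψ u h) := by
    rw [map_mul, e0_sub _ _ hψ, e0_C]; exact mul_pos hu0 hh
  have hk' : 0 < e0 (C u * (- sub ψ u k)) := by
    rw [map_mul, map_neg, e0_sub _ _ hψ, e0_C]; exact mul_pos hu0 (neg_pos.2 hk)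
  have hιa : fr p e1 e2 ψ u a = (C u * sub ψ u h) * tY := by
    rw [fr, RingHom.comp_apply, h1, map_mul, map_sub, sub_tY, sub_C]
    ring
  have hιb : fr p e1 e2 ψ u b = (C u * (- sub ψ u k)) * (tX ^ M - tY) := by
    rw [fr, RingHom.comp_apply, h2, map_mul, map_sub, sub_tY, sub_C]
    have : (C φ - C ψ : BB) = tX ^ M * C u := by rw [← C_sub, hu, C_mul, C_pow]; rfl
    linear_combination (- sub ψ u k) * this
  refine ⟨?_, ?_, ?_⟩
  · apply cancel_mem (TL_pre hd hψ hu0.ne' g) (TL_clo _ _) hh'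
    rw [← hιa]; exact TL_mem _ _ ha
  · apply cancel_mem (TL_pre hd hψ hu0.ne' g) (TL_clo _ _) hk'
    rw [← hιb]; exact TL_mem _ _ hb
  · intro F _ _ _ θ hI
    refine ⟨fun t => ?_, fun t => ?_⟩
    · rw [hιa, map_mul]; exact mul_nonneg (pos_e0 θ hI hh').le t
    · rw [hιb, map_mul, map_sub, map_pow]; exact mul_nonneg (pos_e0 θ hI hk').le (sub_nonneg.2 t)

theorem loc2 {s : ℕ} (g : Fin s → A2) (p : Fin 2 → ℝ) (a b : A2) (ha : a ∈ TT g) (hb : b ∈ TT g)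
    (ha0 : ev p a = 0) (hb0 : ev p b = 0)
    (hg : gr p 0 a * gr p 1 b - gr p 1 a * gr p 0 b ≠ 0) : (∀ f, LP p f {a, b} → Loc g p f) ∧ Dens p {a, b} := by
  classical
  set D := gr p 0 a * gr p 1 b - gr p 1 a * gr p 0 b with hD
  set e1 : Fin 2 → ℝ := ![(gr p 1 b - gr p 1 a) / D, (gr p 0 a - gr p 0 b) / D] with he1
  set e2 : Fin 2 → ℝ := ![(gr p 1 b + gr p 1 a) / D, (- gr p 0 a - gr p 0 b) / D] with he2
  have a1 : gr p 0 a * e1 0 + gr p 1 a * e1 1 = 1 := by simp [he1]; field_simp; rw [hD]; ring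
  have b1 : gr p 0 b * e1 0 + gr p 1 b * e1 1 = 1 := by simp [he1]; field_simp; rw [hD]; ring
  have a2 : gr p 0 a * e2 0 + gr p 1 a * e2 1 = 1 := by simp [he2]; field_simp; rw [hD]; ring
  have b2 : gr p 0 b * e2 0 + gr p 1 b * e2 1 = -1 := by simp [he2]; field_simp; rw [hD]; ring
  have hd : e1 0 * e2 1 - e1 1 * e2 0 ≠ 0 := by
    intro h
    have : D * (e1 0 * e2 1 - e1 1 * e2 0) = -2 := by
      have : D * (e1 0 * e2 1 - e1 1 * e2 0) = (gr p 0 a * e1 0 + gr p 1 a * e1 1) * (gr p 0 b * e2 0 + gr p 1 b * e2 1)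
        - (gr p 0 a * e2 0 + gr p 1 a * e2 1) * (gr p 0 b * e1 0 + gr p 1 b * e1 1) := by rw [hD]; ring
      rw [this, a1, b1, a2, b2]; norm_num
    rw [h, mul_zero] at this; norm_num at this
  obtain ⟨ψ, h, h1, hψ, h3, h4⟩ := nf_fr0 p e1 e2 a ha0 (by rw [a2]; norm_num)
  obtain ⟨φ, k, k1, hφ, k3, k4⟩ := nf_fr0 p e1 e2 b hb0 (by rw [b2]; norm_num)
  rw [a2] at h3 h4; rw [b2] at k3 k4; rw [a1] at h4; rw [b1] at k4
  obtain ⟨u, hu⟩ := PowerSeries.X_dvd_iff.2 (show PowerSeries.constantCoeff (φ - ψ) = 0 by rw [map_sub, hψ, hφ, sub_zero])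
  have hu0 : PowerSeries.constantCoeff u = 2 := by
    have := congrArg (PowerSeries.coeff 1) hu
    rw [ps_coeff_one_mul, map_sub] at this
    simp [PowerSeries.coeff_one_X] at this
    linarith
  obtain ⟨t1, t2, t3⟩ := sand_core g hd ha hb h1 k1 hψ (by rw [h3]; norm_num) (by rw [k3]; norm_num)
    (M := 1) (u := u) (by rw [pow_one]; exact hu) (by rw [hu0]; norm_num)
  have hun : PowerSeries.constantCoeff u ≠ 0 := by rw [hu0]; norm_num
  have hs : ∀ (F : Type) [Field F] [LinearOrder F] [IsStrictOrderedRing F] (θ : BB →+* F), 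
      0 ≤ θ tY → θ tY ≤ θ tX ^ 1 → ∀ c ∈ ({a, b} : Finset A2), 0 ≤ θ (fr p e1 e2 ψ u c) := by
    intro F _ _ _ θ g1 g2 c hc
    obtain ⟨y1, y2⟩ := t3 F θ (infi_sand θ le_rfl g1 g2)
    rw [Finset.mem_insert, Finset.mem_singleton] at hc
    rcases hc with rfl | rfl
    · exact y1 g1
    · exact y2 g2
  constructor
  · intro f hf
    refine TL_loc hd hψ hun g (sandB le_rfl (TL_pre hd hψ hun g) (TL_clo _ _) ?_ t1 t2 _ ?_)
    · have := add_mem t1 t2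
      rwa [pow_one, add_sub_cancel] at this
    · intro F _ _ _ θ g0 g1 g2
      exact frame_pos hd hψ hun θ (infi_sand θ le_rfl g1 g2) (Or.inl g0.ne') hf (hs F θ g1 g2)
  · exact frame_dens hd hψ hun (M := 1) le_rfl (fun F _ _ _ θ _ g1 g2 => hs F θ g1 g2)

end PS
end

section
set_option linter.all false
set_option maxHeartbeats 400000
namespace PS
open Polynomial

theorem tframe (p : Fin 2 → ℝ) (a b c : A2) (ha0 : ev p a = 0) (hb0 : ev p b = 0)
    (hga : gr p 0 a ≠ 0 ∨ gr p 1 a ≠ 0) (hgb : gr p 0 b ≠ 0 ∨ gr p 1 b ≠ 0)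
    (hD : gr p 0 a * gr p 1 b - gr p 1 a * gr p 0 b = 0) :
    ∃ (e1 e2 : Fin 2 → ℝ) (ψ φ : PowerSeries ℝ) (h k : BB), e1 0 * e2 1 - e1 1 * e2 0 ≠ 0 ∧
      fr0 p e1 e2 a = (tY - C ψ) * h ∧ fr0 p e1 e2 b = (tY - C φ) * k ∧
      PowerSeries.constantCoeff ψ = 0 ∧ PowerSeries.coeff 1 ψ = 0 ∧
      PowerSeries.constantCoeff φ = 0 ∧ PowerSeries.coeff 1 φ = 0 ∧ 0 < e0 h ∧ e0 k ≠ 0 ∧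
      (gr p 0 a * gr p 1 c - gr p 1 a * gr p 0 c ≠ 0 → 0 < cX (fr0 p e1 e2 c)) := by
  have pa := sq_grad_pos hga
  have pb := sq_grad_pos hgb
  obtain ⟨σ, hσ, hc⟩ : ∃ σ : ℝ, σ ^ 2 = 1 ∧ (gr p 0 a * gr p 1 c - gr p 1 a * gr p 0 c ≠ 0 →
      0 < -σ * (gr p 0 a * gr p 1 c - gr p 1 a * gr p 0 c)) := by
    rcases lt_or_ge 0 (gr p 0 a * gr p 1 c - gr p 1 a * gr p 0 c) with h | h
    · exact ⟨-1, by norm_num, fun _ => by linarith⟩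
    · exact ⟨1, by norm_num, fun hn => by have := lt_of_le_of_ne h hn; linarith⟩
  set e1 : Fin 2 → ℝ := ![σ * gr p 1 a, -σ * gr p 0 a] with he1
  set e2 : Fin 2 → ℝ := ![gr p 0 a, gr p 1 a] with he2
  have hσ0 : σ ≠ 0 := by rintro rfl; norm_num at hσ
  have x1 : e1 0 = σ * gr p 1 a := rfl
  have x2 : e1 1 = -σ * gr p 0 a := rfl
  have x3 : e2 0 = gr p 0 a := rfl
  have x4 : e2 1 = gr p 1 a := rfl
  have hd : e1 0 * e2 1 - e1 1 * e2 0 ≠ 0 := by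
    have : e1 0 * e2 1 - e1 1 * e2 0 = σ * (gr p 0 a * gr p 0 a + gr p 1 a * gr p 1 a) := by
      rw [x1, x2, x3, x4]; ring
    rw [this]; exact mul_ne_zero hσ0 pa.ne'
  have y1 : 0 < gr p 0 a * e2 0 + gr p 1 a * e2 1 := pa
  have y2 : gr p 0 b * e2 0 + gr p 1 b * e2 1 ≠ 0 := by
    rw [x3, x4]
    intro h
    have : (gr p 0 b * gr p 0 a + gr p 1 b * gr p 1 a) ^ 2 + (gr p 0 a * gr p 1 b - gr p 1 a * gr p 0 b) ^ 2 =
      (gr p 0 a * gr p 0 a + gr p 1 a * gr p 1 a) * (gr p 0 b * gr p 0 b + gr p 1 b * gr p 1 b) := by ring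
    rw [h, hD] at this
    have := mul_pos pa pb
    linarith
  obtain ⟨ψ, h, h1, hψ, h3, h4⟩ := nf_fr0 p e1 e2 a ha0 y1.ne'
  obtain ⟨φ, k, k1, hφ, k3, k4⟩ := nf_fr0 p e1 e2 b hb0 y2
  refine ⟨e1, e2, ψ, φ, h, k, hd, h1, k1, hψ, ?_, hφ, ?_, by rw [h3]; exact y1, by rw [k3]; exact y2, ?_⟩
  · have : gr p 0 a * e1 0 + gr p 1 a * e1 1 = 0 := by rw [x1, x2]; ring
    rw [this] at h4
    have := (mul_eq_zero.1 h4.symm).resolve_right y1.ne'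
    linarith
  · have : gr p 0 b * e1 0 + gr p 1 b * e1 1 = 0 := by rw [x1, x2]; linear_combination -σ * hD
    rw [this] at k4
    have := (mul_eq_zero.1 k4.symm).resolve_right y2
    linarith
  · intro hn
    rw [cX_fr0]
    have : ev p (MvPolynomial.pderiv 0 c) * e1 0 + ev p (MvPolynomial.pderiv 1 c) * e1 1 =
      -σ * (gr p 0 a * gr p 1 c - gr p 1 a * gr p 0 c) := by rw [x1, x2]; simp only [gr]; ring
    rw [this]; exact hc hn

section
variable {F : Type} [Field F] [LinearOrder F] [IsStrictOrderedRing F] (α : PowerSeries ℝ →+* F)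

theorem curve_infi {ψ : PowerSeries ℝ} (hψ : PowerSeries.constantCoeff ψ = 0) :
    Infi ((eval₂RingHom α (α ψ)).comp C) (eval₂RingHom α (α ψ) tY) := by
  intro ε hε
  have e1 : (eval₂RingHom α (α ψ)).comp C = α := by ext; simp
  have e2 : eval₂RingHom α (α ψ) tY = α ψ := by simp [tY]
  rw [e1, e2]
  exact ps_abs_lt α (by rw [hψ]; simpa using hε)

theorem curve_near {p e1 e2 : Fin 2 → ℝ} {ψ : PowerSeries ℝ} (hψ : PowerSeries.constantCoeff ψ = 0)
    (U : Set (Fin 2 → ℝ)) (hU : U ∈ nhds p) (S : Finset A2) :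
    ∃ q ∈ U, ∀ P ∈ S, SignType.sign (ev q P) = SignType.sign (eval₂RingHom α (α ψ) (fr0 p e1 e2 P)) := by
  have := al_near ((eval₂RingHom α (α ψ)).comp (fr p e1 e2 0 1)) p
    (fr_inf (by simp) _ (curve_infi α hψ)) U hU S
  rwa [fr_one] at this

theorem curve_c {ψ : PowerSeries ℝ} (h0 : PowerSeries.constantCoeff ψ = 0) (h1 : PowerSeries.coeff 1 ψ = 0)
    (hα : 0 < α PowerSeries.X) {B : BB} (hB : e0 B = 0) (hB1 : 0 < cX B) : 0 < eval₂RingHom α (α ψ) B := by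
  have e : (eval₂RingHom α 0).comp (sub ψ 1) = eval₂RingHom α (α ψ) := by
    apply Polynomial.ringHom_ext
    · intro a; simp [sub_C]
    · simp [sub]
  rw [← e, RingHom.comp_apply]
  set B' := sub ψ 1 B with hB'
  have f0 : e0 B' = 0 := by rw [hB', e0_sub _ _ h0, hB]
  have f1 : 0 < cX B' := by rw [hB', cX_subst h0 h1]; exact hB1
  rw [coe_eval₂RingHom, eval₂_at_zero]
  rw [e0_coeff] at f0
  obtain ⟨d, hd⟩ := PowerSeries.X_dvd_iff.2 f0
  rw [cX, hd, ps_coeff_one_mul] at f1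
  simp [PowerSeries.coeff_one_X] at f1
  rw [hd, map_mul]
  exact mul_pos hα (ps_pos α f1)

theorem nocross {p e1 e2 : Fin 2 → ℝ} {a b c : A2} {ψ φ : PowerSeries ℝ} {h k : BB}
    (hψ : PowerSeries.constantCoeff ψ = 0)
    (h1 : fr0 p e1 e2 a = (tY - C ψ) * h) (h2 : fr0 p e1 e2 b = (tY - C φ) * k)
    (hc : 0 ≤ eval₂RingHom α (α ψ) (fr0 p e1 e2 c))
    {U : Set (Fin 2 → ℝ)} (hU : U ∈ nhds p) (hq : ∀ q ∈ U, 0 ≤ ev q c → ev q a = 0 → 0 ≤ ev q b) :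
    (0 < e0 k → α φ ≤ α ψ) ∧ (e0 k < 0 → α ψ ≤ α φ) := by
  classical
  obtain ⟨q, hqU, hs⟩ := curve_near α hψ (e1 := e1) (e2 := e2) U hU {a, b, c}
  have z : eval₂RingHom α (α ψ) (fr0 p e1 e2 a) = 0 := by rw [h1]; simp [tY]
  have g1 := hq q hqU (sign_eq_nonneg (hs c (by simp)) hc) (sign_eq_zero' (hs a (by simp)) z)
  have g2 := sign_eq_nonneg (hs b (by simp)).symm g1
  have g3 : 0 ≤ (α ψ - α φ) * eval₂RingHom α (α ψ) k := by
    rw [h2, map_mul] at g2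
    simpa [tY] using g2
  constructor
  · intro hk
    have := pos_e0 _ (curve_infi α hψ) hk
    exact sub_nonneg.1 (nonneg_of_mul_nonneg_left g3 this)
  · intro hk
    have := pos_e0 _ (curve_infi α hψ) (b := -k) (by rw [map_neg]; linarith)
    rw [map_neg] at this
    nlinarith

end

theorem not_same {p e1 e2 : Fin 2 → ℝ} (hd : e1 0 * e2 1 - e1 1 * e2 0 ≠ 0) {a b : A2} {ψ : PowerSeries ℝ} {h k : BB}
    (hψ : PowerSeries.constantCoeff ψ = 0)
    (h1 : fr0 p e1 e2 a = (tY - C ψ) * h) (h2 : fr0 p e1 e2 b = (tY - C ψ) * k)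
    (ha : Irreducible a) (hb : Irreducible b) (hab : ¬ Associated a b) : False := by
  classical
  have hfin := (finite_common a b ha hb hab).subset (Set.diff_subset (t := {p}))
  have hU : ({q : Fin 2 → ℝ | ev q a = 0 ∧ ev q b = 0} \ {p})ᶜ ∈ nhds p :=
    hfin.isClosed.isOpen_compl.mem_nhds (by simp)
  obtain ⟨q, hqU, hs⟩ := curve_near psLL hψ (e1 := e1) (e2 := e2) _ hU {a, b, dd p}
  have z1 := sign_eq_zero' (hs a (by simp)) (by rw [h1]; simp [tY])
  have z2 := sign_eq_zero' (hs b (by simp)) (by rw [h2]; simp [tY])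
  apply hqU
  refine ⟨⟨z1, z2⟩, ?_⟩
  rintro rfl
  have z3 := sign_eq_zero' (hs (dd q) (by simp)).symm (by rw [ev_dd]; simp)
  have := fr_ne hd (p := q) (ψ := 0) (u := 1) (by simp) (by simp) (eval₂RingHom psLL (psLL ψ))
    (Or.inl (by simp [tX]; exact psLL_X_pos.ne'))
  rw [fr_one] at this
  exact this z3

theorem ps_factor {a : PowerSeries ℝ} (ha : a ≠ 0) : ∃ (M : ℕ) (u : PowerSeries ℝ), a = PowerSeries.X ^ M * u ∧
    PowerSeries.constantCoeff u ≠ 0 := by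
  obtain ⟨n, u, h1, h2⟩ := WfDvdMonoid.max_power_factor' ha (PowerSeries.X_prime.not_unit)
  exact ⟨n, u, h2, fun h => h1 (PowerSeries.X_dvd_iff.2 h)⟩

/-- the neg-X substitution -/
noncomputable def psNeg : PowerSeries ℝ →+* LL := psLL.comp (PowerSeries.rescale (-1))

theorem psNeg_X : psNeg PowerSeries.X = - psLL PowerSeries.X := by
  simp [psNeg, PowerSeries.rescale_X]

theorem tang {p e1 e2 : Fin 2 → ℝ} (hd : e1 0 * e2 1 - e1 1 * e2 0 ≠ 0) {a b c : A2} {ψ φ : PowerSeries ℝ} {h k : BB}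
    (hψ : PowerSeries.constantCoeff ψ = 0) (hψ1 : PowerSeries.coeff 1 ψ = 0)
    (hφ : PowerSeries.constantCoeff φ = 0) (hφ1 : PowerSeries.coeff 1 φ = 0)
    (h1 : fr0 p e1 e2 a = (tY - C ψ) * h) (h2 : fr0 p e1 e2 b = (tY - C φ) * k)
    (hh : 0 < e0 h) (hk : e0 k ≠ 0)
    (ha : Irreducible a) (hb : Irreducible b) (hab : ¬ Associated a b)
    {U : Set (Fin 2 → ℝ)} (hU : U ∈ nhds p) (hq : ∀ q ∈ U, 0 ≤ ev q c → ev q a = 0 → 0 ≤ ev q b)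
    (hq2 : ∀ q ∈ U, 0 ≤ ev q c → ev q b = 0 → 0 ≤ ev q a)
    (hc : 0 ≤ eval₂RingHom psLL (psLL ψ) (fr0 p e1 e2 c)) (hc2 : 0 ≤ eval₂RingHom psLL (psLL φ) (fr0 p e1 e2 c)) :
    e0 k < 0 ∧ ∃ (M : ℕ) (u : PowerSeries ℝ), φ - ψ = PowerSeries.X ^ M * u ∧ 0 < PowerSeries.constantCoeff u ∧ 2 ≤ M ∧
      (c = 1 → Even M) := by
  obtain ⟨n1, n2⟩ := nocross psLL hψ h1 h2 hc hU hq
  obtain ⟨n3, n4⟩ := nocross psLL hφ h2 h1 hc2 hU hq2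
  have hne : ψ ≠ φ := by
    rintro rfl
    exact not_same hd hψ h1 h2 ha hb hab
  have hk0 : e0 k < 0 := by
    by_contra hcon
    have hk' : 0 < e0 k := lt_of_le_of_ne (not_lt.1 hcon) hk.symm
    exact hne (psLL_inj (le_antisymm (n3 hh) (n1 hk')))
  refine ⟨hk0, ?_⟩
  obtain ⟨M, u, hu, hu0⟩ := ps_factor (sub_ne_zero.2 hne.symm)
  have hupos : 0 < PowerSeries.constantCoeff u := by
    by_contra hcon
    have hlt := lt_of_le_of_ne (not_lt.1 hcon) hu0
    have := ps_pos psLL (a := -u) (by rw [map_neg]; linarith)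
    have h3 : 0 ≤ psLL (φ - ψ) := by rw [map_sub]; exact sub_nonneg.2 (n2 hk0)
    rw [hu, map_mul, map_pow] at h3
    rw [map_neg] at this
    have h4 := pow_pos psLL_X_pos M
    have := nonneg_of_mul_nonneg_right h3 h4
    linarith
  refine ⟨M, u, hu, hupos, ?_, ?_⟩
  · by_contra hM
    interval_cases M
    · have := congrArg PowerSeries.constantCoeff hu
      rw [map_sub, hψ, hφ] at this
      simp at this; exact hu0 this.symm
    · have := congrArg (PowerSeries.coeff 1) hu
      rw [pow_one, ps_coeff_one_mul, map_sub, hψ1, hφ1] at this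
      simp [PowerSeries.coeff_one_X] at this; exact hu0 this.symm
  · rintro rfl
    by_contra hM
    rw [Nat.not_even_iff_odd] at hM
    have h3 : 0 ≤ psNeg (φ - ψ) := by
      rw [map_sub]; exact sub_nonneg.2 ((nocross psNeg hψ h1 h2 (by simp) hU hq).2 hk0)
    rw [hu, map_mul, map_pow] at h3
    have hx : psNeg PowerSeries.X < 0 := by rw [psNeg_X]; exact neg_neg_of_pos psLL_X_pos
    have h4 := hM.pow_neg hx
    have h5 := ps_pos psNeg hupos
    exact absurd h3 (not_le.2 (mul_neg_of_neg_of_pos h4 h5))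

end PS
end

section
set_option linter.all false
set_option maxHeartbeats 400000
namespace PS
open Polynomial

theorem loc3n {s : ℕ} (g : Fin s → A2) (p : Fin 2 → ℝ) (a b : A2) (ha : a ∈ TT g) (hb : b ∈ TT g)
    (ha0 : ev p a = 0) (hb0 : ev p b = 0)
    (hga : gr p 0 a ≠ 0 ∨ gr p 1 a ≠ 0) (hgb : gr p 0 b ≠ 0 ∨ gr p 1 b ≠ 0)
    (hD : gr p 0 a * gr p 1 b - gr p 1 a * gr p 0 b = 0)
    (ia : Irreducible a) (ib : Irreducible b) (hab : ¬ Associated a b)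
    {U : Set (Fin 2 → ℝ)} (hU : U ∈ nhds p) (hq : ∀ q ∈ U, ev q a = 0 → 0 ≤ ev q b)
    (hq2 : ∀ q ∈ U, ev q b = 0 → 0 ≤ ev q a) : (∀ f, LP p f {a, b} → Loc g p f) ∧ Dens p {a, b} := by
  obtain ⟨e1, e2, ψ, φ, h, k, hd, h1, h2, hψ, hψ1, hφ, hφ1, hh, hk, -⟩ := tframe p a b 1 ha0 hb0 hga hgb hD
  obtain ⟨hk0, M, u, hu, hu0, hM2, hMe⟩ := tang hd (c := 1) hψ hψ1 hφ hφ1 h1 h2 hh hk ia ib hab hU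
    (fun q hqq _ => hq q hqq) (fun q hqq _ => hq2 q hqq) (by simp) (by simp)
  have hMe := hMe rfl
  have hM1 : 1 ≤ M := by omega
  obtain ⟨t1, t2, t3⟩ := sand_core g hd ha hb h1 h2 hψ hh hk0 hu hu0
  have hun := hu0.ne'
  have hs : ∀ (F : Type) [Field F] [LinearOrder F] [IsStrictOrderedRing F] (θ : BB →+* F), 
      0 ≤ θ tY → θ tY ≤ θ tX ^ M → ∀ c ∈ ({a, b} : Finset A2), 0 ≤ θ (fr p e1 e2 ψ u c) := by
    intro F _ _ _ θ g1 g2 c hc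
    obtain ⟨y1, y2⟩ := t3 F θ (infi_sand θ hM1 g1 g2)
    rw [Finset.mem_insert, Finset.mem_singleton] at hc
    rcases hc with rfl | rfl
    · exact y1 g1
    · exact y2 g2
  constructor
  · intro f hf
    refine TL_loc hd hψ hun g (sandA hMe hM1 (TL_pre hd hψ hun g) (TL_clo _ _) t1 t2 _ _ (Nat.lt_succ_self _) ?_)
    intro F _ _ _ θ g0 g1 g2
    exact frame_pos hd hψ hun θ (infi_sand θ hM1 g1 g2) (Or.inl g0) hf (hs F θ g1 g2)
  · exact frame_dens hd hψ hun hM1 (fun F _ _ _ θ _ g1 g2 => hs F θ g1 g2)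

theorem split0 (B : BB) (hB : e0 B = 0) : ∃ (d : PowerSeries ℝ) (q : BB), B = tX * C d + tY * q ∧
    PowerSeries.constantCoeff d = cX B := by
  rw [e0_coeff] at hB
  obtain ⟨d, hd⟩ := PowerSeries.X_dvd_iff.2 hB
  refine ⟨d, B.divX, ?_, ?_⟩
  · have := Polynomial.divX_mul_X_add B
    rw [hd, C_mul] at this
    rw [tX, tY]
    linear_combination -this
  · rw [cX, hd, ps_coeff_one_mul]; simp [PowerSeries.coeff_one_X]

theorem loc4n {s : ℕ} (g : Fin s → A2) (p : Fin 2 → ℝ) (a b c : A2) (ha : a ∈ TT g) (hb : b ∈ TT g) (hc : c ∈ TT g)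
    (ha0 : ev p a = 0) (hb0 : ev p b = 0) (hc0 : ev p c = 0)
    (hga : gr p 0 a ≠ 0 ∨ gr p 1 a ≠ 0) (hgb : gr p 0 b ≠ 0 ∨ gr p 1 b ≠ 0)
    (hD : gr p 0 a * gr p 1 b - gr p 1 a * gr p 0 b = 0)
    (hDc : gr p 0 a * gr p 1 c - gr p 1 a * gr p 0 c ≠ 0)
    (ia : Irreducible a) (ib : Irreducible b) (hab : ¬ Associated a b)
    {U : Set (Fin 2 → ℝ)} (hU : U ∈ nhds p) (hq : ∀ q ∈ U, 0 ≤ ev q c → ev q a = 0 → 0 ≤ ev q b)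
    (hq2 : ∀ q ∈ U, 0 ≤ ev q c → ev q b = 0 → 0 ≤ ev q a) :
    (∀ f, LP p f {a, b, c} → Loc g p f) ∧ Dens p {a, b, c} := by
  obtain ⟨e1, e2, ψ, φ, h, k, hd, h1, h2, hψ, hψ1, hφ, hφ1, hh, hk, hcX⟩ := tframe p a b c ha0 hb0 hga hgb hD
  have hcX := hcX hDc
  have he0 : e0 (fr0 p e1 e2 c) = 0 := by rw [e0_fr0, hc0]
  obtain ⟨hk0, M, u, hu, hu0, hM2, -⟩ := tang hd hψ hψ1 hφ hφ1 h1 h2 hh hk ia ib hab hU hq hq2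
    (curve_c psLL hψ hψ1 psLL_X_pos he0 hcX).le (curve_c psLL hφ hφ1 psLL_X_pos he0 hcX).le
  have hM1 : 1 ≤ M := by omega
  obtain ⟨t1, t2, t3⟩ := sand_core g hd ha hb h1 h2 hψ hh hk0 hu hu0
  have hun := hu0.ne'
  obtain ⟨d, q, hdq, hd0⟩ := split0 (fr p e1 e2 ψ u c) (by rw [e0_fr hψ, hc0])
  have hdpos : 0 < PowerSeries.constantCoeff d := by
    rw [hd0, fr, RingHom.comp_apply, cX_subst hψ hψ1]; exact hcX
  have hTp := TL_pre hd hψ hun g (p := p)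
  have hTc := TL_clo g (fr p e1 e2 ψ u)
  obtain ⟨m, rfl⟩ : ∃ m, M = m + 1 + 1 := ⟨M - 2, by omega⟩
  set N : ℝ := |e0 q| + 1 with hN
  have hN0 : 0 < N := by positivity
  have hX : tX ∈ TL g (fr p e1 e2 ψ u) := by
    apply cancel_mem hTp hTc (h := C d + rr N * tX ^ (m + 1))
    · rw [map_add, e0_C, map_mul, map_pow, e0_tX]; simpa using hdpos
    · have e : (C d + rr N * tX ^ (m + 1)) * tX = fr p e1 e2 ψ u c + tY * (rr N - q) + rr N * (tX ^ (m + 1 + 1) - tY) := by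
        rw [hdq]; ring
      rw [e]
      refine add_mem (add_mem (TL_mem _ _ hc) (mul_mem t1 (unit_mem hTp hTc ?_))) (mul_mem (rr_mem hTp hN0.le) t2)
      rw [map_sub, e0_rr, hN]; linarith [le_abs_self (e0 q)]
  have hs : ∀ (F : Type) [Field F] [LinearOrder F] [IsStrictOrderedRing F] (θ : BB →+* F), 0 < θ tX →
      0 ≤ θ tY → θ tY ≤ θ tX ^ (m + 1 + 1) → ∀ x ∈ ({a, b, c} : Finset A2), 0 ≤ θ (fr p e1 e2 ψ u x) := by
    intro F _ _ _ θ g0 g1 g2 x hx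
    have hI := infi_sand θ hM1 g1 g2
    obtain ⟨y1, y2⟩ := t3 F θ hI
    rw [Finset.mem_insert, Finset.mem_insert, Finset.mem_singleton] at hx
    rcases hx with rfl | rfl | rfl
    · exact y1 g1
    · exact y2 g2
    · have z1 : 0 < θ (rr N + q) := pos_e0 θ hI (by rw [map_add, e0_rr, hN]; linarith [neg_abs_le (e0 q)])
      have z2 : 0 < θ (C d - rr N * tX ^ (m + 1)) := pos_e0 θ hI (by
        rw [map_sub, e0_C, map_mul, map_pow, e0_tX]; simpa using hdpos)
      have z3 : 0 < θ (rr N) := pos_e0 θ hI (by rw [e0_rr]; exact hN0)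
      have e : fr p e1 e2 ψ u x = tX * (C d - rr N * tX ^ (m + 1)) + tY * (rr N + q) + rr N * (tX ^ (m + 1 + 1) - tY) := by
        rw [hdq]; ring
      rw [e, map_add, map_add, map_mul, map_mul, map_mul, map_sub _ (tX ^ (m + 1 + 1)), map_pow]
      have := mul_nonneg z3.le (sub_nonneg.2 g2)
      have := mul_nonneg g1 z1.le
      have := mul_pos g0 z2
      linarith
  constructor
  · intro f hf
    refine TL_loc hd hψ hun g (sandB hM1 hTp hTc hX t1 t2 _ ?_)
    intro F _ _ _ θ g0 g1 g2
    exact frame_pos hd hψ hun θ (infi_sand θ hM1 g1 g2) (Or.inl g0.ne') hf (hs F θ g0 g1 g2)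
  · exact frame_dens hd hψ hun hM1 (fun F _ _ _ θ g0 g1 g2 => hs F θ g0 g1 g2)

/-- degenerate case: `a` and `-a` both in the preordering -/
theorem locd {s : ℕ} (g : Fin s → A2) (p : Fin 2 → ℝ) (a b c : A2) (r : ℝ) (hr : r < 0) (ha : a ∈ TT g) (hb : b ∈ TT g)
    (hc : c ∈ TT g) (hba : b = cc r * a)
    (ha0 : ev p a = 0) (hc0 : c = 1 ∨ (ev p c = 0 ∧ gr p 0 a * gr p 1 c - gr p 1 a * gr p 0 c ≠ 0))
    (hga : gr p 0 a ≠ 0 ∨ gr p 1 a ≠ 0) (f : A2) (hf : LP p f {a, b, c}) : Loc g p f := by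
  obtain ⟨e1, e2, ψ, φ, h, k, hd, h1, h2, hψ, hψ1, hφ, hφ1, hh, hk, hcX⟩ := tframe p a a c ha0 ha0 hga hga (by ring)
  have hu : PowerSeries.constantCoeff (1 : PowerSeries ℝ) ≠ 0 := by simp
  have hTp := TL_pre hd hψ hu g (p := p)
  have hTc := TL_clo g (fr p e1 e2 ψ 1)
  have h3 : 0 < e0 (sub ψ 1 h) := by rw [e0_sub _ _ hψ]; exact hh
  have hι : fr p e1 e2 ψ 1 a = sub ψ 1 h * tY := by
    rw [fr, RingHom.comp_apply, h1, map_mul, map_sub, sub_tY, sub_C, C_1]; ring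
  have hY : tY ∈ TL g (fr p e1 e2 ψ 1) := by
    apply cancel_mem hTp hTc h3
    rw [← hι]; exact TL_mem _ _ ha
  have hιb : fr p e1 e2 ψ 1 b = (rr (-r) * sub ψ 1 h) * (-tY) := by
    rw [hba, map_mul, hι, fr_cc, map_neg]; ring
  have hY2 : -tY ∈ TL g (fr p e1 e2 ψ 1) := by
    apply cancel_mem hTp hTc (h := rr (-r) * sub ψ 1 h)
    · rw [map_mul, e0_rr]; exact mul_pos (by linarith) h3
    rw [← hιb]; exact TL_mem _ _ hb
  have hI : ∀ (F : Type) [Field F] [LinearOrder F] [IsStrictOrderedRing F] (θ : BB →+* F), θ tY = 0 →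
      Infi (θ.comp C) (θ tY) := by
    intro F _ _ _ θ h0 ε hε
    rw [h0, abs_zero]; exact rc_pos _ hε
  have key : ∀ (F : Type) [Field F] [LinearOrder F] [IsStrictOrderedRing F] (θ : BB →+* F), θ tX ≠ 0 → θ tY = 0 →
      0 ≤ θ (fr p e1 e2 ψ 1 c) → 0 < θ (fr p e1 e2 ψ 1 f) := by
    intro F _ _ _ θ h0 h4 h5
    refine frame_pos hd hψ hu θ (hI F θ h4) (Or.inl h0) hf ?_
    intro x hx
    rw [Finset.mem_insert, Finset.mem_insert, Finset.mem_singleton] at hx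
    rcases hx with rfl | rfl | rfl
    · rw [hι, map_mul, h4, mul_zero]
    · rw [hιb, map_mul, map_neg θ tY, h4, neg_zero, mul_zero]
    · exact h5
  refine TL_loc hd hψ hu g ?_
  rcases hc0 with rfl | ⟨hc0, hDc⟩
  · exact deg_aux hTp hTc hY hY2 _ (fun F _ _ _ θ h4 h5 => key F θ h4.ne' h5 (by simp))
      (Or.inr (fun F _ _ _ θ h4 h5 => key F θ h4.ne h5 (by simp)))
  · obtain ⟨d, q, hdq, hd0⟩ := split0 (fr p e1 e2 ψ 1 c) (by rw [e0_fr hψ, hc0])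
    have hdpos : 0 < e0 (C d) := by
      rw [e0_C, hd0, fr, RingHom.comp_apply, cX_subst hψ hψ1]; exact hcX hDc
    refine deg_aux hTp hTc hY hY2 _ (fun F _ _ _ θ h4 h5 => key F θ h4.ne' h5 ?_) (Or.inl ?_)
    · rw [hdq, map_add, map_mul, map_mul, h5, zero_mul, add_zero]
      exact (mul_pos h4 (pos_e0 θ (hI F θ h5) hdpos)).le
    · apply cancel_mem hTp hTc hdpos
      have e : C d * tX = fr p e1 e2 ψ 1 c + tY * (rr (|e0 q| + 1) - q) + (-tY) * rr (|e0 q| + 1) := by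
        rw [hdq]; ring
      rw [e]
      refine add_mem (add_mem (TL_mem _ _ hc) (mul_mem hY (unit_mem hTp hTc ?_))) (mul_mem hY2 (rr_mem hTp (by positivity)))
      rw [map_sub, e0_rr]; linarith [le_abs_self (e0 q)]

end PS
end

section
set_option linter.all false
set_option maxHeartbeats 400000
namespace PS
open Polynomial

def Bd {s : ℕ} (g : Fin s → A2) (p : Fin 2 → ℝ) : Prop :=
  (∃ i, ev p (g i) = 0 ∧ (gr p 0 (g i) ≠ 0 ∨ gr p 1 (g i) ≠ 0) ∧
        ∃ U ∈ nhds p, KK g ∩ U = {q | 0 ≤ ev q (g i)} ∩ U) ∨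
  (∃ i j, i ≠ j ∧ ev p (g i) = 0 ∧ ev p (g j) = 0 ∧
        (gr p 0 (g i) ≠ 0 ∨ gr p 1 (g i) ≠ 0) ∧ (gr p 0 (g j) ≠ 0 ∨ gr p 1 (g j) ≠ 0) ∧
        gr p 0 (g i) * gr p 1 (g j) - gr p 1 (g i) * gr p 0 (g j) ≠ 0 ∧
        ∃ U ∈ nhds p, KK g ∩ U = {q | 0 ≤ ev q (g i) ∧ 0 ≤ ev q (g j)} ∩ U) ∨
  (∃ i j, i ≠ j ∧ ev p (g i) = 0 ∧ ev p (g j) = 0 ∧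
        (gr p 0 (g i) ≠ 0 ∨ gr p 1 (g i) ≠ 0) ∧ (gr p 0 (g j) ≠ 0 ∨ gr p 1 (g j) ≠ 0) ∧
        gr p 0 (g i) * gr p 1 (g j) - gr p 1 (g i) * gr p 0 (g j) = 0 ∧
        ∃ U ∈ nhds p, KK g ∩ U = {q | 0 ≤ ev q (g i) ∧ 0 ≤ ev q (g j)} ∩ U ∧
          (∀ q ∈ U, ev q (g i) = 0 → 0 ≤ ev q (g j)) ∧
          (∀ q ∈ U, ev q (g j) = 0 → 0 ≤ ev q (g i))) ∨
  (∃ i j k, i ≠ j ∧ j ≠ k ∧ i ≠ k ∧ ev p (g i) = 0 ∧ ev p (g j) = 0 ∧ ev p (g k) = 0 ∧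
        (gr p 0 (g i) ≠ 0 ∨ gr p 1 (g i) ≠ 0) ∧ (gr p 0 (g j) ≠ 0 ∨ gr p 1 (g j) ≠ 0) ∧
        (gr p 0 (g k) ≠ 0 ∨ gr p 1 (g k) ≠ 0) ∧
        gr p 0 (g i) * gr p 1 (g j) - gr p 1 (g i) * gr p 0 (g j) = 0 ∧
        gr p 0 (g i) * gr p 1 (g k) - gr p 1 (g i) * gr p 0 (g k) ≠ 0 ∧
        ∃ U ∈ nhds p, KK g ∩ U = {q | 0 ≤ ev q (g i) ∧ 0 ≤ ev q (g j) ∧ 0 ≤ ev q (g k)} ∩ U ∧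
          (∀ q ∈ U, 0 ≤ ev q (g k) → ev q (g i) = 0 → 0 ≤ ev q (g j)) ∧
          (∀ q ∈ U, 0 ≤ ev q (g k) → ev q (g j) = 0 → 0 ≤ ev q (g i)))

def GoodPt {s : ℕ} (g : Fin s → A2) (p : Fin 2 → ℝ) : Prop :=
  ∀ f, (∃ U ∈ nhds p, ∀ q ∈ U, q ≠ p → q ∈ KK g → 0 < ev q f) → Loc g p f
def DensPt {s : ℕ} (g : Fin s → A2) (p : Fin 2 → ℝ) : Prop :=
  ∀ h : A2, h ≠ 0 → ∀ U ∈ nhds p, ∃ q ∈ U, q ∈ KK g ∧ ev q h ≠ 0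
def Degen {s : ℕ} (g : Fin s → A2) : Prop := ∃ i j, ∃ r : ℝ, r < 0 ∧ g j = cc r * g i

theorem good_of {s : ℕ} (g : Fin s → A2) (p : Fin 2 → ℝ) (G : Finset A2) (U : Set (Fin 2 → ℝ)) (hU : U ∈ nhds p)
    (hG : ∀ q ∈ U, (q ∈ KK g ↔ ∀ a ∈ G, 0 ≤ ev q a)) (h : ∀ f, LP p f G → Loc g p f) : GoodPt g p := by
  rintro f ⟨V, hV, hf⟩
  refine h f ⟨U ∩ V, Filter.inter_mem hU hV, ?_⟩
  rintro q ⟨h1, h2⟩ hne hq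
  exact hf q h2 hne ((hG q h1).2 hq)

theorem dens_of {s : ℕ} (g : Fin s → A2) (p : Fin 2 → ℝ) (G : Finset A2) (U : Set (Fin 2 → ℝ)) (hU : U ∈ nhds p)
    (hG : ∀ q ∈ U, (q ∈ KK g ↔ ∀ a ∈ G, 0 ≤ ev q a)) (h : Dens p G) : DensPt g p := by
  intro f hf V hV
  obtain ⟨q, ⟨h1, h2⟩, h3, h4⟩ := h f hf (U ∩ V) (Filter.inter_mem hU hV)
  exact ⟨q, h2, (hG q h1).2 h4, h3⟩

theorem both_of {s : ℕ} (g : Fin s → A2) (p : Fin 2 → ℝ) (G : Finset A2) (U : Set (Fin 2 → ℝ)) (hU : U ∈ nhds p)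
    (hG : ∀ q ∈ U, (q ∈ KK g ↔ ∀ a ∈ G, 0 ≤ ev q a)) (h : (∀ f, LP p f G → Loc g p f) ∧ Dens p G) :
    GoodPt g p ∧ (Degen g ∨ DensPt g p) :=
  ⟨good_of g p G U hU hG h.1, Or.inr (dens_of g p G U hU hG h.2)⟩

theorem assoc_const {a b : A2} (h : Associated a b) : ∃ r : ℝ, r ≠ 0 ∧ b = cc r * a := by
  obtain ⟨u, hu⟩ := h
  obtain ⟨r, hr, hru⟩ := MvPolynomial.isUnit_iff_eq_C_of_isReduced.1 u.isUnit
  exact ⟨r, hr.ne_zero, by rw [← hu, hru, mul_comm]⟩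

theorem loc_iff {s : ℕ} {g : Fin s → A2} {U S : Set (Fin 2 → ℝ)} (h : KK g ∩ U = S ∩ U) {q} (hq : q ∈ U) :
    q ∈ KK g ↔ q ∈ S := by
  constructor
  · intro h1
    have : q ∈ S ∩ U := h ▸ ⟨h1, hq⟩
    exact this.1
  · intro h1
    have : q ∈ KK g ∩ U := h ▸ ⟨h1, hq⟩
    exact this.1

theorem ev_cc_mul (q : Fin 2 → ℝ) (r : ℝ) (a : A2) : ev q (cc r * a) = r * ev q a := by simp [ev, cc]

theorem good_bd {s : ℕ} (g : Fin s → A2) (hirr : ∀ i, Irreducible (g i)) (p : Fin 2 → ℝ) (hp : Bd g p) :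
    GoodPt g p ∧ (Degen g ∨ DensPt g p) := by
  classical
  rcases hp with ⟨i, h0, hg, U, hU, hK⟩ | ⟨i, j, hij, h0, h1, hg0, hg1, hD, U, hU, hK⟩ |
    ⟨i, j, hij, h0, h1, hg0, hg1, hD, U, hU, hK, hq, hq2⟩ |
    ⟨i, j, k, hij, hjk, hik, h0, h1, h2, hg0, hg1, hg2, hD, hDc, U, hU, hK, hq, hq2⟩
  · refine both_of g p {g i} U hU (fun q hq => ?_) (loc1 g p _ (g_mem g i) h0 hg)
    rw [loc_iff hK hq]; simp
  · refine both_of g p {g i, g j} U hU (fun q hq => ?_) (loc2 g p _ _ (g_mem g i) (g_mem g j) h0 h1 hD)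
    rw [loc_iff hK hq]; simp
  · by_cases hab : Associated (g i) (g j)
    · obtain ⟨r, hr, hji⟩ := assoc_const hab
      rcases lt_or_gt_of_ne hr with hr | hr
      · refine ⟨good_of g p {g i, g j, 1} U hU (fun q hq => ?_) (fun f hf => locd g p (g i) (g j) 1 r hr (g_mem g i) (g_mem g j)
          (one_mem _) hji h0 (Or.inl rfl) hg0 f hf), Or.inl ⟨i, j, r, hr, hji⟩⟩
        rw [loc_iff hK hq]; simp [ev]
      · refine both_of g p {g i} U hU (fun q hq => ?_) (loc1 g p _ (g_mem g i) h0 hg0)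
        rw [loc_iff hK hq]
        simp only [Set.mem_setOf_eq, Finset.mem_singleton, forall_eq, hji, ev_cc_mul]
        exact ⟨fun h => h.1, fun h => ⟨h, mul_nonneg hr.le h⟩⟩
    · refine both_of g p {g i, g j} U hU (fun q hq => ?_) (loc3n g p _ _ (g_mem g i) (g_mem g j) h0 h1 hg0 hg1 hD
        (hirr i) (hirr j) hab hU hq hq2)
      rw [loc_iff hK hq]; simp
  · by_cases hab : Associated (g i) (g j)
    · obtain ⟨r, hr, hji⟩ := assoc_const hab
      rcases lt_or_gt_of_ne hr with hr | hr
      · refine ⟨good_of g p {g i, g j, g k} U hU (fun q hq => ?_) (fun f hf => locd g p (g i) (g j) (g k) r hr (g_mem g i) (g_mem g j)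
          (g_mem g k) hji h0 (Or.inr ⟨h2, hDc⟩) hg0 f hf), Or.inl ⟨i, j, r, hr, hji⟩⟩
        rw [loc_iff hK hq]; simp
      · refine both_of g p {g i, g k} U hU (fun q hq => ?_) (loc2 g p _ _ (g_mem g i) (g_mem g k) h0 h2 hDc)
        rw [loc_iff hK hq]
        simp only [Set.mem_setOf_eq, Finset.mem_singleton, Finset.mem_insert, forall_eq_or_imp, forall_eq, hji, ev_cc_mul]
        exact ⟨fun h => ⟨h.1, h.2.2⟩, fun h => ⟨h.1, mul_nonneg hr.le h.1, h.2⟩⟩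
    · refine both_of g p {g i, g j, g k} U hU (fun q hq => ?_) (loc4n g p _ _ _ (g_mem g i) (g_mem g j) (g_mem g k) h0 h1 h2 hg0 hg1 hD
        hDc (hirr i) (hirr j) hab hU hq hq2)
      rw [loc_iff hK hq]; simp

theorem good_int {s : ℕ} (g : Fin s → A2) (p : Fin 2 → ℝ) (hp : p ∈ interior (KK g)) : GoodPt g p ∧ DensPt g p := by
  have hU : KK g ∈ nhds p := mem_interior_iff_mem_nhds.1 hp
  have hG : ∀ q ∈ KK g, (q ∈ KK g ↔ ∀ a ∈ (∅ : Finset A2), 0 ≤ ev q a) := fun q hq => by simp [hq]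
  exact ⟨good_of g p ∅ _ hU hG (loc0 g p), dens_of g p ∅ _ hU hG (dens0 p)⟩

theorem good_all {s : ℕ} (g : Fin s → A2) (hirr : ∀ i, Irreducible (g i)) (hbd : ∀ p ∈ frontier (KK g), Bd g p)
    (p : Fin 2 → ℝ) (hp : p ∈ KK g) : GoodPt g p ∧ (Degen g ∨ DensPt g p) := by
  by_cases h : p ∈ interior (KK g)
  · exact ⟨(good_int g p h).1, Or.inr (good_int g p h).2⟩
  · exact good_bd g hirr p (hbd p ⟨subset_closure hp, h⟩)

/-- finitely many zeros -/
theorem fin_case {s : ℕ} (g : Fin s → A2) (hK : IsCompact (KK g)) (hgood : ∀ p ∈ KK g, GoodPt g p) (f : A2)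
    (hf : ∀ q ∈ KK g, 0 ≤ ev q f) (hfin : {q | q ∈ KK g ∧ ev q f = 0}.Finite) : f ∈ TT g := by
  classical
  set P : Finset (Fin 2 → ℝ) := hfin.toFinset with hP
  have hmem : ∀ q, q ∈ P ↔ q ∈ KK g ∧ ev q f = 0 := fun q => by simp [hP]
  obtain ⟨m, c, hc, hl⟩ := lojasiewicz g hK f (DD P 1) hf (fun q hq h0 => by
    have hq' := (hmem q).2 ⟨hq, h0⟩
    exact (ev_DD_eq_zero (by norm_num)).2 hq')
  by_cases hPe : P = ∅
  · refine schmudgen g hK f (fun q hq => lt_of_le_of_ne (hf q hq) (fun h => ?_))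
    have := (hmem q).2 ⟨hq, h.symm⟩
    rw [hPe] at this; simp at this
  obtain ⟨p0, hp0⟩ := Finset.nonempty_iff_ne_empty.2 hPe
  have hm : 2 * m ≠ 0 := by
    intro h
    have := hl p0 ((hmem p0).1 hp0).1
    rw [h, ((hmem p0).1 hp0).2] at this
    simp at this; linarith
  have hDD : ∀ q, ev q (DD P 1) ^ (2 * m) = ev q (DD P (2 * m)) := by
    intro q
    have : DD P (2 * m) = DD P 1 ^ (2 * m) := by simp [DD, Finset.prod_pow]
    rw [this]; simp [ev]
  have hnn : ∀ q, 0 ≤ ev q (DD P (2 * m)) := fun q => by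
    rw [← hDD, pow_mul]; positivity
  refine globalize g hK P (2 * m) hm f (c / 2) (by positivity) ?_ ?_
  · intro q hq
    have := hl q hq
    rw [hDD] at this
    nlinarith [hnn q]
  · intro p hp
    refine hgood p ((hmem p).1 hp).1 _ ?_ _
    refine ⟨((P.erase p : Finset (Fin 2 → ℝ)) : Set (Fin 2 → ℝ))ᶜ, (Finset.finite_toSet _).isClosed.isOpen_compl.mem_nhds (by simp), ?_⟩
    intro q hqU hqp hq
    have hqP : q ∉ P := fun h => hqU (by simp [h, hqp])
    have h1 := lt_of_le_of_ne (hnn q) (fun h => hqP ((ev_DD_eq_zero hm).1 h.symm))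
    have := hl q hq
    rw [hDD] at this
    have e : ev q (f - cc (c / 2) * DD P (2 * m)) = ev q f - c / 2 * ev q (DD P (2 * m)) := by simp [ev, cc]
    rw [e]; nlinarith

end PS
end

section
set_option linter.all false
set_option maxHeartbeats 400000
namespace PS
open Polynomial

theorem coeff_pd (i : Fin 2) (f : A2) (m : Fin 2 →₀ ℕ) :
    (MvPolynomial.pderiv i f).coeff m = f.coeff (m + Finsupp.single i 1) * (m i + 1) := by
  classical
  induction f using MvPolynomial.induction_on' with
  | monomial n r =>
    rw [MvPolynomial.pderiv_monomial, MvPolynomial.coeff_monomial, MvPolynomial.coeff_monomial]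
    by_cases h : n = m + Finsupp.single i 1
    · subst h; simp
    · rw [if_neg h, zero_mul]
      split_ifs with h2
      · by_cases h3 : n i = 0
        · simp [h3]
        · exfalso
          apply h
          rw [← h2]
          ext j
          by_cases hj : i = j
          · subst hj; simp; omega
          · simp [Finsupp.single_apply, hj]
      · rfl
  | add p q hp hq => simp [hp, hq]; ring

theorem grad_ne {h : A2} (hh : Irreducible h) : ∃ i, ¬ h ∣ MvPolynomial.pderiv i h := by
  classical
  by_contra hcon
  push Not at hcon
  have hd : h.totalDegree ≠ 0 := by
    intro h0
    rw [MvPolynomial.totalDegree_eq_zero_iff_eq_C] at h0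
    apply hh.not_isUnit
    have : h.coeff 0 ≠ 0 := by
      intro h1; rw [h1] at h0; exact hh.ne_zero (by rw [h0]; simp)
    rw [h0]
    exact (IsUnit.mk0 _ this).map MvPolynomial.C
  have hz : ∀ i, MvPolynomial.pderiv i h = 0 := by
    intro i
    by_contra hne
    obtain ⟨q, hq⟩ := hcon i
    have hq0 : q ≠ 0 := by rintro rfl; simp at hq; exact hne hq
    have h1 := MvPolynomial.totalDegree_mul_of_isDomain hh.ne_zero hq0
    rw [← hq] at h1
    have h2 : (MvPolynomial.pderiv i h).totalDegree < h.totalDegree := by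
      rw [MvPolynomial.totalDegree, Finset.sup_lt_iff (by simpa using Nat.pos_of_ne_zero hd)]
      intro m hm
      rw [MvPolynomial.mem_support_iff, coeff_pd] at hm
      have h3 := MvPolynomial.le_totalDegree (MvPolynomial.mem_support_iff.2 (left_ne_zero_of_mul hm))
      rw [Finsupp.sum_fintype _ _ (by simp)] at h3 ⊢
      simp [Finset.sum_add_distrib, Fin.sum_univ_two] at h3 ⊢
      omega
    omega
  apply hd
  rw [MvPolynomial.totalDegree_eq_zero_iff_eq_C]
  ext m
  rw [MvPolynomial.coeff_C]
  split_ifs with hm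
  · rw [hm]
  · obtain ⟨i, hi⟩ : ∃ i, m i ≠ 0 := by
      by_contra hc; push Not at hc; exact hm (by ext i; simp [hc i])
    have := coeff_pd i h (m - Finsupp.single i 1)
    rw [hz i, MvPolynomial.coeff_zero] at this
    have e : m - Finsupp.single i 1 + Finsupp.single i 1 = m := by
      ext j
      by_cases hj : i = j
      · subst hj; simp; omega
      · simp [Finsupp.single_apply, hj]
    rw [e] at this
    exact (mul_eq_zero.1 this.symm).resolve_right (by positivity)

theorem fin_common2 {h : A2} (hh : Irreducible h) (f : A2) (hf : f ≠ 0) (hd : ¬ h ∣ f) :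
    {q : Fin 2 → ℝ | ev q h = 0 ∧ ev q f = 0}.Finite := by
  induction f using WfDvdMonoid.induction_on_irreducible with
  | zero => exact absurd rfl hf
  | unit u hu =>
    convert Set.finite_empty
    ext q
    simp only [Set.mem_setOf_eq, Set.mem_empty_iff_false, iff_false, not_and]
    intro _ h0
    have := hu.map (MvPolynomial.eval q)
    rw [show MvPolynomial.eval q u = 0 from h0] at this
    exact not_isUnit_zero this
  | mul a i ha hi ih =>
    have h1 := ih ha (fun h2 => hd (h2.mul_left _))
    have h2 := finite_common h i hh hi (fun h3 => hd (h3.dvd.mul_right _))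
    refine (h1.union h2).subset ?_
    rintro q ⟨h3, h4⟩
    rw [ev, map_mul] at h4
    rcases mul_eq_zero.1 h4 with h5 | h5
    · exact Or.inr ⟨h3, h5⟩
    · exact Or.inl ⟨h3, h5⟩

theorem inf_factor (K : Set (Fin 2 → ℝ)) (f : A2) (hf : f ≠ 0) (hinf : ¬ {q | q ∈ K ∧ ev q f = 0}.Finite) :
    ∃ h, Irreducible h ∧ h ∣ f ∧ ¬ {q | q ∈ K ∧ ev q h = 0}.Finite := by
  induction f using WfDvdMonoid.induction_on_irreducible with
  | zero => exact absurd rfl hf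
  | unit u hu =>
    exfalso; apply hinf
    convert Set.finite_empty
    ext q
    simp only [Set.mem_setOf_eq, Set.mem_empty_iff_false, iff_false, not_and]
    intro _ h0
    have := hu.map (MvPolynomial.eval q)
    rw [show MvPolynomial.eval q u = 0 from h0] at this
    exact not_isUnit_zero this
  | mul a i ha hi ih =>
    by_cases h1 : {q | q ∈ K ∧ ev q i = 0}.Finite
    · have h2 : ¬ {q | q ∈ K ∧ ev q a = 0}.Finite := by
        intro h2
        apply hinf
        refine (h1.union h2).subset ?_
        rintro q ⟨h3, h4⟩
        rw [ev, map_mul] at h4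
        rcases mul_eq_zero.1 h4 with h5 | h5
        · exact Or.inl ⟨h3, h5⟩
        · exact Or.inr ⟨h3, h5⟩
      obtain ⟨h, g1, g2, g3⟩ := ih ha h2
      exact ⟨h, g1, g2.mul_left _, g3⟩
    · exact ⟨i, hi, dvd_mul_right _ _, h1⟩

theorem irr_deg {h : A2} (hh : Irreducible h) : h.totalDegree ≠ 0 := by
  intro h0
  rw [MvPolynomial.totalDegree_eq_zero_iff_eq_C] at h0
  apply hh.not_isUnit
  have : h.coeff 0 ≠ 0 := by
    intro h1; rw [h1] at h0; exact hh.ne_zero (by rw [h0]; simp)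
  rw [h0]
  exact (IsUnit.mk0 _ this).map MvPolynomial.C

theorem ev_mul (q : Fin 2 → ℝ) (a b : A2) : ev q (a * b) = ev q a * ev q b := by simp [ev]

/-- at a nonsingular zero of `h`, both signs occur nearby -/
theorem both_signs (p : Fin 2 → ℝ) (h : A2) (hne : h ≠ 0) (h0 : ev p h = 0) (hg : gr p 0 h ≠ 0 ∨ gr p 1 h ≠ 0)
    (U : Set (Fin 2 → ℝ)) (hU : U ∈ nhds p) : (∃ q ∈ U, 0 < ev q h) ∧ ∃ q ∈ U, ev q h < 0 := by
  constructor
  · obtain ⟨q, h1, h2, h3⟩ := (loc1 (fun _ : Fin 1 => h) p h (g_mem _ 0) h0 hg).2 h hne U hU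
    exact ⟨q, h1, lt_of_le_of_ne (h3 h (by simp)) (Ne.symm h2)⟩
  · obtain ⟨q, h1, h2, h3⟩ := (loc1 (fun _ : Fin 1 => -h) p (-h) (g_mem _ 0) (by simpa [ev] using h0)
      (by simpa [gr, ev] using hg)).2 h hne U hU
    have := h3 (-h) (by simp)
    rw [ev, map_neg] at this
    exact ⟨q, h1, lt_of_le_of_ne (by simpa [ev] using this) h2⟩

/-- nonnegativity after division -/
theorem div_nonneg' {s : ℕ} (g : Fin s → A2) (hd : ∀ p ∈ KK g, DensPt g p) (d f : A2) (hd0 : d ≠ 0)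
    (hdn : ∀ q ∈ KK g, 0 ≤ ev q d) (hf : ∀ q ∈ KK g, 0 ≤ ev q (d * f)) : ∀ q ∈ KK g, 0 ≤ ev q f := by
  intro p hp
  by_contra hcon
  push Not at hcon
  have hU : {q | ev q f < 0} ∈ nhds p := (isOpen_lt (ev_continuous f) continuous_const).mem_nhds hcon
  obtain ⟨q, hq, hqK, hne⟩ := hd p hp d hd0 _ hU
  have h1 := hf q hqK
  have h2 : 0 < ev q d := lt_of_le_of_ne (hdn q hqK) (Ne.symm hne)
  rw [ev_mul] at h1
  have h3 : ev q f < 0 := hq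
  nlinarith

theorem pos_of_opp {s : ℕ} (g : Fin s → A2) (hK : IsCompact (KK g)) (hgood : ∀ p ∈ KK g, GoodPt g p)
    (hirr : ∀ i, Irreducible (g i)) (hdeg : Degen g) (f : A2) (hf : ∀ q ∈ KK g, 0 ≤ ev q f) : f ∈ TT g := by
  obtain ⟨i, j, r, hr, hji⟩ := hdeg
  by_cases hf0 : f = 0
  · rw [hf0]; exact zero_mem _
  by_cases hdv : g i ∣ f
  · obtain ⟨q, rfl⟩ := hdv
    have e : g i * q = g i * (cc (1/2) * (q + 1)) ^ 2 + (cc (-r⁻¹) * g j) * (cc (1/2) * (q - 1)) ^ 2 := by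
      have e1 : cc (1/2) ^ 2 * 4 = 1 := by
        rw [cc, show (4 : A2) = MvPolynomial.C 4 from (map_ofNat MvPolynomial.C 4).symm, ← map_pow, ← map_mul]; norm_num
      have e2 : cc (-r⁻¹) * cc r = -1 := by
        rw [cc, cc, ← map_mul, neg_mul, inv_mul_cancel₀ hr.ne, map_neg, map_one]
      rw [hji]
      linear_combination (-(g i * q)) * e1 - g i * (cc (1/2) * (q - 1)) ^ 2 * e2
    rw [e]
    refine add_mem (mul_mem (g_mem g i) (TT_pre g _)) (mul_mem (mul_mem (cc_mem (TT_pre g) ?_) (g_mem g j)) (TT_pre g _))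
    rw [neg_nonneg]; exact (inv_lt_zero.2 hr).le
  · refine fin_case g hK hgood f hf ((fin_common2 (hirr i) f hf0 hdv).subset ?_)
    rintro q ⟨hq, h0⟩
    refine ⟨?_, h0⟩
    have h1 := hq i
    have h2 := hq j
    rw [hji, ev_cc_mul] at h2
    nlinarith

theorem main_ind {s : ℕ} (g : Fin s → A2) (hK : IsCompact (KK g)) (hirr : ∀ i, Irreducible (g i))
    (hbd : ∀ p ∈ frontier (KK g), Bd g p) (hgood : ∀ p ∈ KK g, GoodPt g p) (hd : ∀ p ∈ KK g, DensPt g p) :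
    ∀ (n : ℕ) (f : A2), f.totalDegree < n → (∀ q ∈ KK g, 0 ≤ ev q f) → f ∈ TT g := by
  intro n
  induction n with
  | zero => intro f hf; omega
  | succ n ih =>
    intro f hn hf
    by_cases hf0 : f = 0
    · rw [hf0]; exact zero_mem _
    by_cases hfin : {q | q ∈ KK g ∧ ev q f = 0}.Finite
    · exact fin_case g hK hgood f hf hfin
    obtain ⟨h, hh, ⟨f1, hf1⟩, hinf⟩ := inf_factor _ f hf0 hfin
    have hf10 : f1 ≠ 0 := by rintro rfl; exact hf0 (by rw [hf1, mul_zero])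
    have hdh := irr_deg hh
    have hdf : f.totalDegree = h.totalDegree + f1.totalDegree := by
      rw [hf1]; exact MvPolynomial.totalDegree_mul_of_isDomain hh.ne_zero hf10
    by_cases hdv : h ∣ f1
    · obtain ⟨f2, hf2⟩ := hdv
      have hf20 : f2 ≠ 0 := by rintro rfl; exact hf10 (by rw [hf2, mul_zero])
      have hdf2 : f1.totalDegree = h.totalDegree + f2.totalDegree := by
        rw [hf2]; exact MvPolynomial.totalDegree_mul_of_isDomain hh.ne_zero hf20
      have e : f = h ^ 2 * f2 := by rw [hf1, hf2]; ring
      rw [e]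
      refine mul_mem (TT_pre g h) (ih f2 (by omega) ?_)
      refine div_nonneg' g hd (h ^ 2) f2 (pow_ne_zero _ hh.ne_zero) (fun q _ => ?_) (by rw [← e]; exact hf)
      rw [ev, map_pow]; exact sq_nonneg _
    · obtain ⟨i, hi⟩ : ∃ i, Associated h (g i) := by
        by_contra hcon
        push Not at hcon
        apply hinf
        obtain ⟨l, hl⟩ := grad_ne hh
        have hl0 : MvPolynomial.pderiv l h ≠ 0 := by intro h0; exact hl (by rw [h0]; exact dvd_zero _)
        have F1 := fin_common2 hh f1 hf10 hdv
        have F2 := fin_common2 hh _ hl0 hl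
        have F3 : (⋃ i, {q : Fin 2 → ℝ | ev q h = 0 ∧ ev q (g i) = 0}).Finite :=
          Set.finite_iUnion (fun i => finite_common h (g i) hh (hirr i) (hcon i))
        refine ((F1.union F2).union F3).subset ?_
        rintro p ⟨hpK, hp0⟩
        by_contra hnot
        simp only [Set.mem_union, Set.mem_setOf_eq, Set.mem_iUnion, not_or, not_and, not_exists] at hnot
        obtain ⟨⟨n1, n2⟩, n3⟩ := hnot
        have n1 := n1 hp0
        have n2 := n2 hp0
        by_cases hinside : p ∈ interior (KK g)
        · have hg : gr p 0 h ≠ 0 ∨ gr p 1 h ≠ 0 := by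
            fin_cases l
            · exact Or.inl n2
            · exact Or.inr n2
          rcases lt_or_gt_of_ne n1 with n1 | n1
          · have hU : KK g ∩ {q | ev q f1 < 0} ∈ nhds p := Filter.inter_mem (mem_interior_iff_mem_nhds.1 hinside)
              ((isOpen_lt (ev_continuous f1) continuous_const).mem_nhds n1)
            obtain ⟨q, ⟨hq1, hq2⟩, hq3⟩ := (both_signs p h hh.ne_zero hp0 hg _ hU).1
            have := hf q hq1
            rw [hf1, ev_mul] at this
            have hq2' : ev q f1 < 0 := hq2
            nlinarith
          · have hU : KK g ∩ {q | 0 < ev q f1} ∈ nhds p := Filter.inter_mem (mem_interior_iff_mem_nhds.1 hinside)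
              ((isOpen_lt continuous_const (ev_continuous f1)).mem_nhds n1)
            obtain ⟨q, ⟨hq1, hq2⟩, hq3⟩ := (both_signs p h hh.ne_zero hp0 hg _ hU).2
            have := hf q hq1
            rw [hf1, ev_mul] at this
            have hq2' : 0 < ev q f1 := hq2
            nlinarith
        · have hb := hbd p ⟨subset_closure hpK, hinside⟩
          have : ∃ i, ev p (g i) = 0 := by
            rcases hb with ⟨i, h0, _⟩ | ⟨i, j, _, h0, _⟩ | ⟨i, j, _, h0, _⟩ | ⟨i, j, k, _, _, _, h0, _⟩ <;> exact ⟨i, h0⟩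
          obtain ⟨i, hi⟩ := this
          exact n3 i hp0 hi
      obtain ⟨r, hr, hgi⟩ := assoc_const hi
      have e : f = g i * (cc r⁻¹ * f1) := by
        have : cc r * cc r⁻¹ = 1 := by rw [cc, cc, ← map_mul, mul_inv_cancel₀ hr, map_one]
        rw [hgi, hf1]
        linear_combination (-(h * f1)) * this
      have hne : cc r⁻¹ * f1 ≠ 0 := by intro h0; rw [h0, mul_zero] at e; exact hf0 e
      have hdeg : f.totalDegree = (g i).totalDegree + (cc r⁻¹ * f1).totalDegree := by
        nth_rewrite 1 [e]; exact MvPolynomial.totalDegree_mul_of_isDomain (hirr i).ne_zero hne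
      have := irr_deg (hirr i)
      rw [e]
      refine mul_mem (g_mem g i) (ih _ (by omega) ?_)
      exact div_nonneg' g hd (g i) _ (hirr i).ne_zero (fun q hq => hq i) (by rw [← e]; exact hf)

theorem main_TT {s : ℕ} (g : Fin s → A2) (hK : IsCompact (KK g)) (hirr : ∀ i, Irreducible (g i))
    (hbd : ∀ p ∈ frontier (KK g), Bd g p) (f : A2) (hf : ∀ q ∈ KK g, 0 ≤ ev q f) : f ∈ TT g := by
  have hall := good_all g hirr hbd
  by_cases hdeg : Degen g
  · exact pos_of_opp g hK (fun p hp => (hall p hp).1) hirr hdeg f hf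
  · exact main_ind g hK hirr hbd (fun p hp => (hall p hp).1) (fun p hp => (hall p hp).2.resolve_left hdeg) _ f
      (Nat.lt_succ_self _) hf

end PS
end

noncomputable section

open MvPolynomial

/-- main corollary. Let `g 1, ..., g s` be irreducible polynomials in
`ℝ[x,y]` with `K` compact, such that every boundary point `p` of `K` is of one of the
four local types (1)–(4) described in the paper. Then the preordering generated by the
`g i` is saturated, i.e. it equals the set of polynomials nonnegative on `K`. -/
theorem preordering_saturated_of_boundary_conditions (s : ℕ)
    (g : Fin s → MvPolynomial (Fin 2) ℝ)
    (hirr : ∀ i, Irreducible (g i))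
    (K : Set (Fin 2 → ℝ)) (hK : K = {p | ∀ i, 0 ≤ eval p (g i)})
    (hcompact : IsCompact K)
    (hbdry : ∀ p ∈ frontier K,
      -- (1) `p` is a non-singular zero of some `g i` and `K` is defined locally at `p`
      -- by the single inequality `g i ≥ 0`
      (∃ i, eval p (g i) = 0 ∧
        (eval p (pderiv 0 (g i)) ≠ 0 ∨ eval p (pderiv 1 (g i)) ≠ 0) ∧
        ∃ U ∈ nhds p, K ∩ U = {q | 0 ≤ eval q (g i)} ∩ U) ∨
      -- (2) `p` is a non-singular zero of `g i` and `g j`, which meet transversally at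
      -- `p`, and `K` is defined locally at `p` by `g i ≥ 0, g j ≥ 0`
      (∃ i j, i ≠ j ∧ eval p (g i) = 0 ∧ eval p (g j) = 0 ∧
        (eval p (pderiv 0 (g i)) ≠ 0 ∨ eval p (pderiv 1 (g i)) ≠ 0) ∧
        (eval p (pderiv 0 (g j)) ≠ 0 ∨ eval p (pderiv 1 (g j)) ≠ 0) ∧
        eval p (pderiv 0 (g i)) * eval p (pderiv 1 (g j)) -
          eval p (pderiv 1 (g i)) * eval p (pderiv 0 (g j)) ≠ 0 ∧
        ∃ U ∈ nhds p, K ∩ U = {q | 0 ≤ eval q (g i) ∧ 0 ≤ eval q (g j)} ∩ U) ∨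
      -- (3) `p` is a non-singular zero of `g i` and `g j`, which share a common tangent
      -- at `p` but do not cross each other at `p`, and locally `K` is the region
      -- between the two curves
      (∃ i j, i ≠ j ∧ eval p (g i) = 0 ∧ eval p (g j) = 0 ∧
        (eval p (pderiv 0 (g i)) ≠ 0 ∨ eval p (pderiv 1 (g i)) ≠ 0) ∧
        (eval p (pderiv 0 (g j)) ≠ 0 ∨ eval p (pderiv 1 (g j)) ≠ 0) ∧
        eval p (pderiv 0 (g i)) * eval p (pderiv 1 (g j)) -
          eval p (pderiv 1 (g i)) * eval p (pderiv 0 (g j)) = 0 ∧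
        ∃ U ∈ nhds p, K ∩ U = {q | 0 ≤ eval q (g i) ∧ 0 ≤ eval q (g j)} ∩ U ∧
          (∀ q ∈ U, eval q (g i) = 0 → 0 ≤ eval q (g j)) ∧
          (∀ q ∈ U, eval q (g j) = 0 → 0 ≤ eval q (g i))) ∨
      -- (4) `p` is a non-singular zero of `g i`, `g j`, `g k`; `g i` and `g j` share a
      -- common tangent at `p`; `g i` and `g k` meet transversally at `p`; and locally
      -- `K` is the part of the region between `g i = 0` and `g j = 0` where `g k ≥ 0`
      (∃ i j k, i ≠ j ∧ j ≠ k ∧ i ≠ k ∧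
        eval p (g i) = 0 ∧ eval p (g j) = 0 ∧ eval p (g k) = 0 ∧
        (eval p (pderiv 0 (g i)) ≠ 0 ∨ eval p (pderiv 1 (g i)) ≠ 0) ∧
        (eval p (pderiv 0 (g j)) ≠ 0 ∨ eval p (pderiv 1 (g j)) ≠ 0) ∧
        (eval p (pderiv 0 (g k)) ≠ 0 ∨ eval p (pderiv 1 (g k)) ≠ 0) ∧
        eval p (pderiv 0 (g i)) * eval p (pderiv 1 (g j)) -
          eval p (pderiv 1 (g i)) * eval p (pderiv 0 (g j)) = 0 ∧
        eval p (pderiv 0 (g i)) * eval p (pderiv 1 (g k)) -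
          eval p (pderiv 1 (g i)) * eval p (pderiv 0 (g k)) ≠ 0 ∧
        ∃ U ∈ nhds p,
          K ∩ U = {q | 0 ≤ eval q (g i) ∧ 0 ≤ eval q (g j) ∧ 0 ≤ eval q (g k)} ∩ U ∧
          (∀ q ∈ U, 0 ≤ eval q (g k) → eval q (g i) = 0 → 0 ≤ eval q (g j)) ∧
          (∀ q ∈ U, 0 ≤ eval q (g k) → eval q (g j) = 0 → 0 ≤ eval q (g i)))) :
    preorderingGen (Set.range g) = {f | ∀ p ∈ K, 0 ≤ eval p f} := by
  subst hK
  apply Set.Subset.antisymm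
  · intro f hf p hp
    exact PS.TT_nonneg g hf hp
  · intro f hf
    exact PS.main_TT g hcompact hirr hbdry f hf
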